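/- Assume R is unmixed of dimension d ≥ 2. Then the following are equivalent: (1) R is Cohen-Macaulay; (2) N(R) ≤ e_1(q :_R m, R) − e_1(q, R) for some C-parameter ideal q of R; (3) N(R) ≤ f_0(q, R) for some C-parameter ideal q of R. -/

import Mathlib

/-! Preliminary definitions: lengths, dimensions, (C-)systems of parameters, Hilbert
coefficients, irreducible multiplicities, local cohomology invariants, stable values,
unmixedness, the unmixed component, and the g-invariant. -/

open CategoryTheory CategoryTheory.Limits Opposite IsLocalRing

universe u

noncomputable section

section Definitions

variable (R : Type u) [CommRing R]

/-- The length of an `R`-module, defined as the Krull dimension of its submodule lattice. -/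
def moduleLength (M : Type u) [AddCommGroup M] [Module R M] : WithBot ℕ∞ :=
  Order.krullDim (Submodule R M)

/-- The Krull dimension of an `R`-module `M`, i.e. `dim (R / Ann M)`. -/
def moduleDim (M : Type u) [AddCommGroup M] [Module R M] : WithBot ℕ∞ :=
  ringKrullDim (R ⧸ Module.annihilator R M)

/-- The colon submodule `(N :_M I) = {x : M | I • x ⊆ N}`. -/
def modColon {M : Type u} [AddCommGroup M] [Module R M] (N : Submodule R M) (I : Ideal R) :
    Submodule R M where
  carrier := {x | ∀ r ∈ I, r • x ∈ N}
  add_mem' := by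
    intro a b ha hb r hr
    simpa [smul_add] using N.add_mem (ha r hr) (hb r hr)
  zero_mem' := by
    intro r hr
    simpa using N.zero_mem
  smul_mem' := by
    intro c a ha r hr
    rw [smul_comm]
    exact N.smul_mem c (ha r hr)

/-- `x : Fin s → R` is a system of parameters of the module `M`:
`s = dim M`, the `x i` are nonunits, and `M/(x)M` has finite length. -/
def IsSOP (M : Type u) [AddCommGroup M] [Module R M] {s : ℕ} (x : Fin s → R) : Prop :=
  moduleDim R M = (s : WithBot ℕ∞) ∧ (∀ i, x i ∈ nonunits R) ∧
    IsFiniteLength R (M ⧸ (Ideal.span (Set.range x) • (⊤ : Submodule R M)))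

/-- The ideal `b(M)`: the intersection, over all systems of parameters `x` of `M` and all `i`,
of `Ann_R ((0) :_{M/(x_1,...,x_{i-1})M} x_i)`. -/
def bIdeal (M : Type u) [AddCommGroup M] [Module R M] : Ideal R :=
  ⨅ (s : ℕ) (x : Fin s → R) (_ : IsSOP R M x) (i : Fin s),
    (Submodule.torsionBy R
      (M ⧸ (Ideal.span (x '' {j | j < i}) • (⊤ : Submodule R M))) (x i)).annihilator

/-- `x` is a C-system of parameters of `M`: a system of parameters such that
`x i ∈ b(M/(x_{i+1},...,x_s)M)^3` for every `i` (for `i = s` the quotient is `M` itself). -/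
def IsCSOP (M : Type u) [AddCommGroup M] [Module R M] {s : ℕ} (x : Fin s → R) : Prop :=
  IsSOP R M x ∧ ∀ i : Fin s,
    x i ∈ (bIdeal R (M ⧸ (Ideal.span (x '' {j | i < j}) • (⊤ : Submodule R M)))) ^ 3

/-- A parameter ideal of `R`. -/
def IsParamIdeal (q : Ideal R) : Prop :=
  ∃ (s : ℕ) (x : Fin s → R), IsSOP R R x ∧ q = Ideal.span (Set.range x)

/-- A C-parameter ideal of `R`: an ideal generated by a C-system of parameters of `R`. -/
def IsCParamIdeal (q : Ideal R) : Prop :=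
  ∃ (s : ℕ) (x : Fin s → R), IsCSOP R R x ∧ q = Ideal.span (Set.range x)

/-- A C-parameter ideal of a module `M`. -/
def IsCParamIdealMod (M : Type u) [AddCommGroup M] [Module R M] (q : Ideal R) : Prop :=
  ∃ (s : ℕ) (x : Fin s → R), IsCSOP R M x ∧ q = Ideal.span (Set.range x)

/-- `e` is the family of Hilbert coefficients of `M` (of dimension `s`) with respect to `I`:
`ℓ(M/I^{n+1}M) = ∑_{i=0}^{s} (-1)^i (e i) binom(n+s-i, s-i)` for all large `n`. -/
def IsHilbCoeffMod (I : Ideal R) (M : Type u) [AddCommGroup M] [Module R M] (s : ℕ)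
    (e : ℕ → ℤ) : Prop :=
  ∃ N : ℕ, ∀ n ≥ N, ∃ L : ℕ,
    moduleLength R (M ⧸ (I ^ (n + 1) • (⊤ : Submodule R M))) = (L : WithBot ℕ∞) ∧
    (L : ℤ) = ∑ i ∈ Finset.range (s + 1),
      (-1) ^ i * e i * ((n + s - i).choose (s - i) : ℤ)

/-- `e` is the family of Hilbert coefficients of `R` (of dimension `d`) with respect to `I`;
`e 1` is the Chern number of `I`. -/
def IsHilbCoeff (I : Ideal R) (d : ℕ) (e : ℕ → ℤ) : Prop :=
  IsHilbCoeffMod R I R d e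

variable [IsLocalRing R]

/-- The colon ideal `(q :_R m)`. -/
def colonIdeal (q : Ideal R) : Ideal R :=
  modColon R q (maximalIdeal R)

/-- The index of reducibility `ir_M(q) = ℓ((qM :_M m)/qM)`. -/
def irMod (M : Type u) [AddCommGroup M] [Module R M] (q : Ideal R) : WithBot ℕ∞ :=
  moduleLength R
    ↥(Submodule.map (q • (⊤ : Submodule R M)).mkQ
      (modColon R (q • (⊤ : Submodule R M)) (maximalIdeal R)))

/-- `NN` is the stable value `𝒩(M)` of `M`: the common index of reducibility of all
C-parameter ideals of `M`. -/
def IsStableValueMod (M : Type u) [AddCommGroup M] [Module R M] (NN : ℕ) : Prop :=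
  ∀ q : Ideal R, IsCParamIdealMod R M q → irMod R M q = (NN : WithBot ℕ∞)

/-- `NN` is the stable value `𝒩(R)` of `R`. -/
def IsStableValue (NN : ℕ) : Prop :=
  ∀ q : Ideal R, IsCParamIdeal R q → irMod R R q = (NN : WithBot ℕ∞)

/-- `f` is the family of coefficients of the polynomial giving the index of reducibility,
`ir_M(I^{n+1}) = ℓ((I^{n+1}M :_M m)/I^{n+1}M) = ∑_{i=0}^{s-1} (-1)^i (f i) binom(n+s-1-i, s-1-i)`
for all large `n`; `f 0` is the irreducible multiplicity of `M` with respect to `I`. -/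
def IsIrrCoeffMod (I : Ideal R) (M : Type u) [AddCommGroup M] [Module R M] (s : ℕ)
    (f : ℕ → ℤ) : Prop :=
  ∃ N : ℕ, ∀ n ≥ N, ∃ L : ℕ,
    irMod R M (I ^ (n + 1)) = (L : WithBot ℕ∞) ∧
    (L : ℤ) = ∑ i ∈ Finset.range s,
      (-1) ^ i * f i * ((n + s - 1 - i).choose (s - 1 - i) : ℤ)

/-- Ring version of `IsIrrCoeffMod`. -/
def IsIrrCoeff (I : Ideal R) (d : ℕ) (f : ℕ → ℤ) : Prop :=
  IsIrrCoeffMod R I R d f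

/-- The local cohomology module `H^i_m(M)`. -/
def Hmod (M : Type u) [AddCommGroup M] [Module R M] (i : ℕ) : ModuleCat.{u} R :=
  (localCohomology (maximalIdeal R) i).obj (ModuleCat.of R M)

/-- `r_i(M) = ℓ((0) :_{H^i_m(M)} m)`, the length of the socle of `H^i_m(M)`. -/
def rLengthMod (M : Type u) [AddCommGroup M] [Module R M] (i : ℕ) : WithBot ℕ∞ :=
  moduleLength R ↥(Submodule.torsionBySet R ↥(Hmod R M i) ((maximalIdeal R : Ideal R) : Set R))

/-- `r_i(R)`. -/
def rLength (i : ℕ) : WithBot ℕ∞ := rLengthMod R R i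

/-- `M` is a Cohen-Macaulay `R`-module: `H^i_m(M) = 0` for all `i < dim M`. -/
def IsCMMod (M : Type u) [AddCommGroup M] [Module R M] : Prop :=
  ∀ i : ℕ, (i : WithBot ℕ∞) < moduleDim R M → Subsingleton ↥(Hmod R M i)

/-- `R` is a Cohen-Macaulay local ring: `H^i_m(R) = 0` for all `i < dim R`. -/
def IsCMLocal : Prop :=
  ∀ i : ℕ, (i : WithBot ℕ∞) < ringKrullDim R → Subsingleton ↥(Hmod R R i)

/-- `R` is a generalized Cohen-Macaulay local ring:
`H^i_m(R)` has finite length for all `i < dim R`. -/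
def IsGeneralizedCM : Prop :=
  ∀ i : ℕ, (i : WithBot ℕ∞) < ringKrullDim R → IsFiniteLength R ↥(Hmod R R i)

/-- `R` is a Gorenstein local ring: Cohen-Macaulay of type `r_d(R) = 1`, `d = dim R`. -/
def IsGorensteinLocal : Prop :=
  IsCMLocal R ∧ ∀ d : ℕ, ringKrullDim R = (d : WithBot ℕ∞) → rLength R d = (1 : WithBot ℕ∞)

/-- `R` is unmixed: `dim R̂/p = dim R̂` for every associated prime `p` of the
`m`-adic completion `R̂` of `R`. -/
def IsUnmixedRing : Prop :=
  ∀ p ∈ associatedPrimes (AdicCompletion (maximalIdeal R) R) (AdicCompletion (maximalIdeal R) R),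
    ringKrullDim ((AdicCompletion (maximalIdeal R) R) ⧸ p) =
      ringKrullDim (AdicCompletion (maximalIdeal R) R)

/-- `M` is unmixed: `dim R̂/p = dim M̂` for every associated prime `p` of the
`m`-adic completion `M̂` of `M`, viewed over `R̂`. -/
def IsUnmixedMod (M : Type u) [AddCommGroup M] [Module R M] : Prop :=
  ∀ p ∈ associatedPrimes (AdicCompletion (maximalIdeal R) R) (AdicCompletion (maximalIdeal R) M),
    ringKrullDim ((AdicCompletion (maximalIdeal R) R) ⧸ p) =
      moduleDim (AdicCompletion (maximalIdeal R) R) (AdicCompletion (maximalIdeal R) M)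

/-- `H^0_m(M)`, described as the submodule of elements killed by a power of `m`. -/
def H0Sub (M : Type u) [AddCommGroup M] [Module R M] : Submodule R M :=
  ⨆ n : ℕ, Submodule.torsionBySet R M (((maximalIdeal R) ^ n : Ideal R) : Set R)

/-- The unmixed component `u = U_R(0)` of `R`: the largest ideal of dimension `< dim R`. -/
def unmixedComponent : Ideal R := sSup {J : Ideal R | moduleDim R ↥J < ringKrullDim R}

end Definitions

section CMImage

/-- `R` is a homomorphic image of a Cohen-Macaulay (Noetherian) local ring. -/
def IsHomImageOfCM (R : Type u) [CommRing R] : Prop :=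
  ∃ (A : Type u) (_ : CommRing A) (_ : IsLocalRing A) (_ : IsNoetherianRing A),
    IsCMLocal A ∧ ∃ f : A →+* R, Function.Surjective f

end CMImage

section GInvariant

variable (R : Type u) [CommRing R] [IsLocalRing R] [IsNoetherianRing R]

/-- The canonical homomorphism from `Ext^p(R/q, R)` (the term of the directed system indexed by
the ideal `q` with `J ≤ rad q`) into the local cohomology module `H^p_J(R)`, given by the
structure of `H^p_J(R)` as an inductive limit. -/
def canonicalToLocalCohomology (J q : Ideal R) (h : J ≤ q.radical) (p : ℕ) :
    ((localCohomology.diagram (localCohomology.selfLERadicalDiagram J) p).obj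
        (op (⟨q, h⟩ : localCohomology.SelfLERadical J))).obj (ModuleCat.of R R) ⟶
      (localCohomology J p).obj (ModuleCat.of R R) :=
  haveI := localCohomology.hasColimitDiagram.{u, u} (localCohomology.selfLERadicalDiagram J) p
  (colimit.ι (localCohomology.diagram (localCohomology.selfLERadicalDiagram J) p)
      (op (⟨q, h⟩ : localCohomology.SelfLERadical J))).app (ModuleCat.of R R) ≫
    (localCohomology.isoSelfLERadical J p).hom.app (ModuleCat.of R R)

/-- A map of `R`-modules is surjective on socles. -/
def SurjectiveOnSocles {A B : ModuleCat.{u} R} (φ : A ⟶ B) : Prop :=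
  ∀ y ∈ Submodule.torsionBySet R ↥B ((maximalIdeal R : Ideal R) : Set R),
    ∃ z ∈ Submodule.torsionBySet R ↥A ((maximalIdeal R : Ideal R) : Set R), φ z = y

/-- The defining property of the g-invariant: for every system of parameters `x` of `R`
contained in `m^(n₀)` and every `p`, the canonical homomorphism into the local cohomology
module `H^p_m(R)` is surjective on the socles. -/
def GProperty (n₀ : ℕ) : Prop :=
  ∀ (s : ℕ) (x : Fin s → R), IsSOP R R x → (∀ i, x i ∈ maximalIdeal R ^ n₀) →
    ∀ (h : maximalIdeal R ≤ (Ideal.span (Set.range x)).radical) (p : ℕ),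
      SurjectiveOnSocles R
        (canonicalToLocalCohomology R (maximalIdeal R) (Ideal.span (Set.range x)) h p)

/-- The g-invariant `g(R)`: the least `n₀` satisfying `GProperty`. -/
def gInvariant : ℕ := sInf {n₀ : ℕ | GProperty R n₀}

end GInvariant

end

section QuasiRegular

variable {R : Type*} [CommRing R] {κ : Type*}

lemma MvPolynomial.IsHomogeneous.degree_eq_of_coeff_ne_zero {k : ℕ} {F : MvPolynomial κ R}
    (hF : F.IsHomogeneous k) {γ : κ →₀ ℕ} (h : F.coeff γ ≠ 0) : γ.degree = k := by
  rw [Finsupp.degree_eq_weight_one]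
  exact hF h

variable [Fintype κ]

/-- Every monomial of large degree other than `y ^ γ₀`, multiplied by `y ^ (N - γ₀)`, lies in the
ideal of the `(N+1)`-st powers. -/
lemma eval_mul_prod_sub_mem (y : κ → R) (F : MvPolynomial κ R) (γ₀ : κ →₀ ℕ)
    (hF : ∀ γ ∈ F.support, γ₀.degree ≤ γ.degree) (N : ℕ) (hN : ∀ i, γ₀ i ≤ N) :
    F.eval y * ∏ i, y i ^ (N - γ₀ i) - F.coeff γ₀ * ∏ i, y i ^ N ∈
      Ideal.span (Set.range fun i ↦ y i ^ (N + 1)) := by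
  classical
  have key : ∀ γ ∈ F.support, γ ≠ γ₀ →
      (F.coeff γ * ∏ i, y i ^ γ i) * ∏ i, y i ^ (N - γ₀ i) ∈
      Ideal.span (Set.range fun i ↦ y i ^ (N + 1)) := by
    intro γ hγ hne
    have : ∃ i, γ₀ i < γ i := by
      by_contra! h
      have hle : γ ≤ γ₀ := h
      have h1 := hF γ hγ
      rw [Finsupp.degree_eq_sum, Finsupp.degree_eq_sum] at h1
      have h2 : ∑ i, γ i = ∑ i, γ₀ i := le_antisymm (Finset.sum_le_sum fun i _ ↦ h i) h1
      have h3 := (Finset.sum_eq_sum_iff_of_le (fun i _ ↦ h i)).1 h2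
      exact hne (Finsupp.ext fun i ↦ h3 i (Finset.mem_univ i))
    obtain ⟨i, hi⟩ := this
    rw [mul_assoc, ← Finset.prod_mul_distrib]
    refine Ideal.mul_mem_left _ _ ?_
    rw [← Finset.mul_prod_erase _ _ (Finset.mem_univ i), ← pow_add]
    refine Ideal.mul_mem_right _ _ ?_
    have := hN i
    exact Ideal.mem_of_dvd _ (pow_dvd_pow (y i) (show N + 1 ≤ γ i + (N - γ₀ i) by omega))
      (Ideal.subset_span ⟨i, rfl⟩)
  rw [MvPolynomial.eval_eq', Finset.sum_mul]
  by_cases h0 : γ₀ ∈ F.support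
  · rw [← Finset.add_sum_erase _ _ h0]
    have : (F.coeff γ₀ * ∏ i, y i ^ γ₀ i) * ∏ i, y i ^ (N - γ₀ i) = F.coeff γ₀ * ∏ i, y i ^ N := by
      rw [mul_assoc, ← Finset.prod_mul_distrib]
      congr 1
      refine Finset.prod_congr rfl fun i _ ↦ ?_
      rw [← pow_add, Nat.add_sub_cancel' (hN i)]
    rw [this, add_sub_cancel_left]
    exact Ideal.sum_mem _ fun γ hγ ↦
      key γ (Finset.mem_of_mem_erase hγ) (Finset.ne_of_mem_erase hγ)
  · rw [MvPolynomial.notMem_support_iff.1 h0, zero_mul, sub_zero]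
    exact Ideal.sum_mem _ fun γ hγ ↦ key γ hγ (by rintro rfl; exact h0 hγ)

/-- The sequence `y` is quasi-regular relative to the ideal `J'`, assuming that monomials of
equal exponents can be cancelled modulo `J'`. -/
lemma coeff_mem_of_eval_mem_pow (y : κ → R) (J' : Ideal R)
    (hJ : ∀ N : ℕ, 0 < N → ∀ c, c * ∏ i, y i ^ N ∈ Ideal.span (Set.range fun i ↦ y i ^ (N + 1)) →
      c ∈ J')
    {k : ℕ} (F : MvPolynomial κ R) (hF : F.IsHomogeneous k)
    (h : F.eval y ∈ Ideal.span (Set.range y) ^ (k + 1)) (γ : κ →₀ ℕ) : F.coeff γ ∈ J' := by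
  by_cases h0 : F.coeff γ = 0
  · rw [h0]; exact zero_mem _
  have hdeg : γ.degree = k := hF.degree_eq_of_coeff_ne_zero h0
  obtain ⟨G, hG, hGF⟩ := (Ideal.mem_span_pow_iff_exists_isHomogeneous _ _).1 h
  have hGγ : G.coeff γ = 0 := by
    by_contra hh
    have := hG.degree_eq_of_coeff_ne_zero hh
    omega
  have := eval_mul_prod_sub_mem y (F - G) γ ?_ (k + 1) ?_
  · rw [map_sub, hGF, sub_self, zero_mul, zero_sub, MvPolynomial.coeff_sub, hGγ, sub_zero,
      neg_mem_iff] at this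
    exact hJ _ k.succ_pos _ this
  · intro δ hδ
    classical
    rcases Finset.mem_union.1 (MvPolynomial.support_sub _ _ _ hδ) with h | h
    · rw [hdeg, hF.degree_eq_of_coeff_ne_zero (MvPolynomial.mem_support_iff.1 h)]
    · rw [hdeg, hG.degree_eq_of_coeff_ne_zero (MvPolynomial.mem_support_iff.1 h)]; omega
  · intro i
    have := Finsupp.le_degree i γ
    omega

end QuasiRegular

section Layers

/-- A relative quasi-regularity package: `y` behaves like a quasi-regular sequence modulo the
saturation `J'` of `(y)` with respect to `t`. -/
structure QuasiRegularPair {R : Type*} [CommRing R] {κ : Type*} [Fintype κ]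
    (y : κ → R) (t : R) (J' : Ideal R) : Prop where
  cancel : ∀ N : ℕ, 0 < N → ∀ c,
    c * ∏ i, y i ^ N ∈ Ideal.span (Set.range fun i ↦ y i ^ (N + 1)) → c ∈ J'
  mul_mem : ∀ c ∈ J', t * c ∈ Ideal.span (Set.range y)
  mem_of_mul_mem : ∀ c, t * c ∈ J' → c ∈ J'

variable {R : Type*} [CommRing R] {κ : Type*} [Fintype κ] {y : κ → R} {t : R} {J' : Ideal R}

lemma QuasiRegularPair.mem_of_pow_mul_mem (h : QuasiRegularPair y t J') (j : ℕ) (c : R)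
    (hc : t ^ j * c ∈ J') : c ∈ J' := by
  induction j with
  | zero => simpa using hc
  | succ j ih => exact ih (h.mem_of_mul_mem _ (by rwa [← mul_assoc, ← pow_succ']))

lemma QuasiRegularPair.coeff_mem (h : QuasiRegularPair y t J') {k j : ℕ} (F : MvPolynomial κ R)
    (hF : F.IsHomogeneous k) (hm : t ^ j * F.eval y ∈ Ideal.span (Set.range y) ^ (k + 1))
    (γ : κ →₀ ℕ) : F.coeff γ ∈ J' := by
  refine h.mem_of_pow_mul_mem j _ ?_
  have := coeff_mem_of_eval_mem_pow y J' h.cancel (k := k) (MvPolynomial.C (t ^ j) * F)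
    (by simpa using (MvPolynomial.isHomogeneous_C κ (t ^ j)).mul hF) (by simpa using hm) γ
  rwa [MvPolynomial.coeff_C_mul] at this

lemma eval_mul_mem_of_coeff {I L : Ideal R} {k : ℕ} (s : R)
    (hIL : ∀ c ∈ I, ∀ a ∈ Ideal.span (Set.range y) ^ k, s * c * a ∈ L)
    {F : MvPolynomial κ R} (hF : F.IsHomogeneous k) (hc : ∀ γ, F.coeff γ ∈ I) :
    s * F.eval y ∈ L := by
  rw [MvPolynomial.eval_eq', Finset.mul_sum]
  refine Ideal.sum_mem _ fun γ hγ ↦ ?_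
  rw [← mul_assoc]
  refine hIL _ (hc γ) _ ?_
  have hdeg := hF.degree_eq_of_coeff_ne_zero (MvPolynomial.mem_support_iff.1 hγ)
  rw [Ideal.mem_span_pow_iff_exists_isHomogeneous]
  exact ⟨MvPolynomial.monomial γ 1, MvPolynomial.isHomogeneous_monomial _ hdeg, by
    simp [MvPolynomial.eval_monomial, Finsupp.prod_fintype]⟩

/-- Expansion of a power of `J + (t)` along `t`. -/
lemma pow_mul_sup_pow_le (J : Ideal R) (t : R) (i m : ℕ) :
    J ^ i * (J ⊔ Ideal.span {t}) ^ (m + 1) ≤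
      Ideal.span {t ^ (m + 1)} * J ^ i ⊔ J ^ (i + 1) * (J ⊔ Ideal.span {t}) ^ m := by
  set q := J ⊔ Ideal.span {t} with hq
  have h1 : q ^ (m + 1) ≤ Ideal.span {t ^ (m + 1)} ⊔ J * q ^ m := by
    induction m with
    | zero => simp [hq, sup_comm]
    | succ m ih =>
      calc q ^ (m + 1 + 1) = J * q ^ (m + 1) ⊔ Ideal.span {t} * q ^ (m + 1) := by
            rw [pow_succ' q (m + 1), ← Ideal.sup_mul]
        _ ≤ J * q ^ (m + 1) ⊔ Ideal.span {t} * (Ideal.span {t ^ (m + 1)} ⊔ J * q ^ m) := by gcongr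
        _ ≤ _ := by
          rw [Ideal.mul_sup]
          refine sup_le le_sup_left (sup_le ?_ ?_) |>.trans (sup_comm _ _).le
          · rw [Ideal.span_singleton_mul_span_singleton, ← pow_succ']; exact le_sup_right
          · refine le_sup_of_le_left ?_
            rw [mul_left_comm, pow_succ' q m]
            exact Ideal.mul_mono_right (Ideal.mul_mono_left le_sup_right)
  calc J ^ i * q ^ (m + 1) ≤ J ^ i * (Ideal.span {t ^ (m + 1)} ⊔ J * q ^ m) := by gcongr
    _ = _ := by rw [Ideal.mul_sup, mul_comm, pow_succ J i, mul_assoc]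

lemma QuasiRegularPair.layer_coeff_mem (h : QuasiRegularPair y t J') {k j : ℕ}
    (F : MvPolynomial κ R) (hF : F.IsHomogeneous k)
    (hm : t ^ j * F.eval y ∈ Ideal.span (Set.range y) ^ (k + 1) ⊔
      (Ideal.span (Set.range y) ⊔ Ideal.span {t}) ^ (k + j + 1)) (γ : κ →₀ ℕ) :
    F.coeff γ ∈ J' ⊔ Ideal.span {t} := by
  set J := Ideal.span (Set.range y) with hJdef
  set q := J ⊔ Ideal.span {t} with hq
  have hJF : F.eval y ∈ J ^ k := (Ideal.mem_span_pow_iff_exists_isHomogeneous _ _).2 ⟨F, hF, rfl⟩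
  have hJq : J ≤ q := le_sup_left
  have htq : t ∈ q := Ideal.mem_sup_right (Ideal.mem_span_singleton_self t)
  have step : ∀ i ≤ k, t ^ j * F.eval y ∈ J ^ (k + 1) ⊔ J ^ i * q ^ (k + j + 1 - i) := by
    intro i
    induction i with
    | zero => intro _; simpa using hm
    | succ i ih =>
      intro hi
      obtain ⟨u, hu, v, hv, huv⟩ := Submodule.mem_sup.1 (ih (by omega))
      have hsub : k + j + 1 - i = (k + j - i) + 1 := by omega
      rw [hsub] at hv
      obtain ⟨w, hw, v', hv', rfl⟩ := Submodule.mem_sup.1 (pow_mul_sup_pow_le _ _ _ _ hv)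
      obtain ⟨g, hg, rfl⟩ := Ideal.mem_span_singleton_mul.1 hw
      obtain ⟨G, hG, rfl⟩ := (Ideal.mem_span_pow_iff_exists_isHomogeneous _ _).1 hg
      have hmem : t ^ (k + j - i + 1) * G.eval y ∈ J ^ (i + 1) := by
        have e : t ^ (k + j - i + 1) * G.eval y = t ^ j * F.eval y - u - v' := by
          rw [← huv]; ring
        rw [e]
        refine sub_mem (sub_mem ?_ ?_) ?_
        · exact Ideal.mul_mem_left _ _ (Ideal.pow_le_pow_right hi hJF)
        · exact Ideal.pow_le_pow_right (by omega) hu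
        · exact Ideal.mul_le_left (I := J ^ (i + 1)) (J := q ^ (k + j - i)) hv'
      have hco := h.coeff_mem G hG hmem
      have h2 : t * G.eval y ∈ J ^ (i + 1) :=
        eval_mul_mem_of_coeff (I := J') (L := J ^ (i + 1)) t (fun c hc a ha ↦ by
          rw [pow_succ']; exact Ideal.mul_mem_mul (h.mul_mem c hc) ha) hG hco
      have hs2 : k + j + 1 - (i + 1) = k + j - i := by omega
      rw [← huv, hs2]
      refine Submodule.add_mem_sup hu (add_mem ?_ hv')
      rw [show t ^ (k + j - i + 1) * G.eval y = t * G.eval y * t ^ (k + j - i) by ring]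
      exact Ideal.mul_mem_mul h2 (Ideal.pow_mem_pow htq _)
  obtain ⟨u, hu, v, hv, huv⟩ := Submodule.mem_sup.1 (step k le_rfl)
  have hsub : k + j + 1 - k = j + 1 := by omega
  rw [hsub] at hv
  obtain ⟨w, hw, v', hv', rfl⟩ := Submodule.mem_sup.1 (pow_mul_sup_pow_le _ _ _ _ hv)
  obtain ⟨g, hg, rfl⟩ := Ideal.mem_span_singleton_mul.1 hw
  obtain ⟨G, hG, rfl⟩ := (Ideal.mem_span_pow_iff_exists_isHomogeneous _ _).1 hg
  have hmem : t ^ j * (F - MvPolynomial.C t * G).eval y ∈ J ^ (k + 1) := by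
    have e : t ^ j * (F - MvPolynomial.C t * G).eval y = u + v' := by
      simp only [map_sub, map_mul, MvPolynomial.eval_C, mul_sub, ← huv]; ring
    rw [e]
    exact add_mem hu (Ideal.mul_le_left (I := J ^ (k + 1)) (J := q ^ j) hv')
  have := h.coeff_mem (F - MvPolynomial.C t * G)
    (hF.sub (by simpa using (MvPolynomial.isHomogeneous_C κ t).mul hG)) hmem γ
  simp only [MvPolynomial.coeff_sub, MvPolynomial.coeff_C_mul] at this
  have e : F.coeff γ = (F.coeff γ - t * G.coeff γ) + t * G.coeff γ := by ring
  rw [e]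
  exact Submodule.add_mem_sup this (Ideal.mul_mem_right _ _ (Ideal.mem_span_singleton_self t))

end Layers

section Parameters

section

variable {R : Type u} [CommRing R]

lemma mk_mem_smul_top_iff (I J : Ideal R) (c : R) :
    (Submodule.Quotient.mk c : R ⧸ (I • (⊤ : Submodule R R))) ∈
      J • (⊤ : Submodule R (R ⧸ (I • (⊤ : Submodule R R)))) ↔ c ∈ I ⊔ J := by
  have h : J • (⊤ : Submodule R (R ⧸ (I • (⊤ : Submodule R R)))) =
      Submodule.map (I • (⊤ : Submodule R R)).mkQ J := by
    conv_rhs => rw [← Ideal.mul_top J, ← smul_eq_mul, Submodule.map_smul'']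
    rw [Submodule.map_top, Submodule.range_mkQ]
  rw [h, ← Submodule.mkQ_apply, ← Submodule.mem_comap, Submodule.comap_map_mkQ, smul_eq_mul,
    Ideal.mul_top]

lemma moduleDim_quotient (I : Ideal R) :
    moduleDim R (R ⧸ (I • (⊤ : Submodule R R))) = ringKrullDim (R ⧸ I) := by
  have : I • (⊤ : Submodule R R) = I := by rw [smul_eq_mul, Ideal.mul_top]
  rw [this, moduleDim, Ideal.annihilator_quotient]

end

variable {R : Type u} [CommRing R] [IsLocalRing R]

lemma isFiniteLength_quotient_iff [IsNoetherianRing R] (I : Ideal R) :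
    IsFiniteLength R (R ⧸ I) ↔ maximalIdeal R ≤ I.radical := by
  have h1 : IsFiniteLength R (R ⧸ I) ↔ IsArtinianRing (R ⧸ I) := by
    rw [isFiniteLength_iff_isNoetherian_isArtinian]
    refine ⟨fun h ↦ ?_, fun h ↦ ⟨inferInstance, ?_⟩⟩
    · have := h.2
      exact isArtinian_of_tower R this
    · have : IsArtinian (R ⧸ I) (R ⧸ I) := h
      exact isArtinian_of_surjective_algebraMap (Ideal.Quotient.mk_surjective (I := I))
  rw [h1, isArtinianRing_iff_krullDimLE_zero, Ring.krullDimLE_zero_iff, Ideal.radical_eq_sInf]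
  constructor
  · intro h
    refine le_sInf fun p ⟨hIp, hp⟩ ↦ ?_
    have hp' : (p.map (Ideal.Quotient.mk I)).IsPrime := Ideal.isPrime_map_quotientMk_of_isPrime hIp
    have := h _ hp'
    have h2 : (p.map (Ideal.Quotient.mk I)).comap (Ideal.Quotient.mk I) = p := by
      rw [Ideal.comap_map_mk hIp]
    have h3 : p.IsMaximal := by
      rw [← h2]
      exact Ideal.comap_isMaximal_of_surjective _ Ideal.Quotient.mk_surjective
    exact (IsLocalRing.eq_maximalIdeal h3).ge
  · intro h P hP
    have h2 : (P.comap (Ideal.Quotient.mk I)).IsPrime := Ideal.comap_isPrime _ _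
    have h3 : maximalIdeal R ≤ P.comap (Ideal.Quotient.mk I) := by
      refine h.trans (sInf_le ⟨?_, h2⟩)
      intro a ha
      rw [Ideal.mem_comap, Ideal.Quotient.eq_zero_iff_mem.2 ha]
      exact zero_mem _
    have h4 := (IsLocalRing.maximalIdeal.isMaximal R).eq_of_le h2.ne_top h3
    have h5 := Ideal.map_comap_of_surjective (Ideal.Quotient.mk I) Ideal.Quotient.mk_surjective P
    rw [← h5, ← h4]
    refine (Ideal.map_eq_top_or_isMaximal_of_surjective _ Ideal.Quotient.mk_surjective
      inferInstance).resolve_left fun h6 ↦ hP.ne_top ?_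
    rw [← h5, ← h4, h6]

/-- `z` kills all the colon quotients of systems of parameters of length `s` of `R/I`. -/
def KillsColons (I : Ideal R) (s : ℕ) (z : R) : Prop :=
  ∀ y : Fin s → R, (∀ i, y i ∈ maximalIdeal R) →
    maximalIdeal R ≤ (I ⊔ Ideal.span (Set.range y)).radical →
    ∀ i c, y i * c ∈ I ⊔ Ideal.span (y '' {j | j < i}) → z * c ∈ I ⊔ Ideal.span (y '' {j | j < i})

lemma isFiniteLength_quotient_quotient_iff [IsNoetherianRing R] (I J : Ideal R) :
    IsFiniteLength R ((R ⧸ (I • (⊤ : Submodule R R))) ⧸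
      (J • (⊤ : Submodule R (R ⧸ (I • (⊤ : Submodule R R)))))) ↔
    maximalIdeal R ≤ (I ⊔ J).radical := by
  rw [← isFiniteLength_quotient_iff]
  set f := (J • (⊤ : Submodule R (R ⧸ (I • (⊤ : Submodule R R))))).mkQ ∘ₗ
    (I • (⊤ : Submodule R R)).mkQ
  have hf : Function.Surjective f :=
    (Submodule.mkQ_surjective _).comp (Submodule.mkQ_surjective _)
  have hk : LinearMap.ker f = I ⊔ J := by
    ext c
    rw [LinearMap.mem_ker, ← mk_mem_smul_top_iff, ← Submodule.Quotient.mk_eq_zero]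
    rfl
  have e := f.quotKerEquivOfSurjective hf
  rw [hk] at e
  exact ⟨fun h ↦ e.symm.isFiniteLength h, fun h ↦ e.isFiniteLength h⟩

lemma isSOP_quotient_iff [IsNoetherianRing R] (I : Ideal R) {s : ℕ} (y : Fin s → R) :
    IsSOP R (R ⧸ (I • (⊤ : Submodule R R))) y ↔ ringKrullDim (R ⧸ I) = s ∧
      (∀ i, y i ∈ maximalIdeal R) ∧ maximalIdeal R ≤ (I ⊔ Ideal.span (Set.range y)).radical := by
  rw [IsSOP, moduleDim_quotient, isFiniteLength_quotient_quotient_iff]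
  rfl

lemma mem_bIdeal_quotient_iff [IsNoetherianRing R] (I : Ideal R) {s : ℕ}
    (hs : ringKrullDim (R ⧸ I) = s) (z : R) :
    z ∈ bIdeal R (R ⧸ (I • (⊤ : Submodule R R))) ↔ KillsColons I s z := by
  have key : ∀ {s' : ℕ} (y : Fin s' → R) (i : Fin s'),
      z ∈ (Submodule.torsionBy R ((R ⧸ (I • (⊤ : Submodule R R))) ⧸
        (Ideal.span (y '' {j | j < i}) • (⊤ : Submodule R (R ⧸ (I • (⊤ : Submodule R R))))))
        (y i)).annihilator ↔
      ∀ c, y i * c ∈ I ⊔ Ideal.span (y '' {j | j < i}) →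
        z * c ∈ I ⊔ Ideal.span (y '' {j | j < i}) := by
    intro s' y i
    rw [Submodule.mem_annihilator]
    constructor
    · intro h c hc
      have := h (Submodule.Quotient.mk (Submodule.Quotient.mk c)) (by
        rw [Submodule.mem_torsionBy_iff, ← Submodule.Quotient.mk_smul, ← Submodule.Quotient.mk_smul,
          Submodule.Quotient.mk_eq_zero, mk_mem_smul_top_iff]
        exact hc)
      rwa [← Submodule.Quotient.mk_smul, ← Submodule.Quotient.mk_smul,
          Submodule.Quotient.mk_eq_zero, mk_mem_smul_top_iff] at this
    · intro h m hm
      obtain ⟨m, rfl⟩ := Submodule.Quotient.mk_surjective _ m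
      obtain ⟨c, rfl⟩ := Submodule.Quotient.mk_surjective _ m
      rw [Submodule.mem_torsionBy_iff, ← Submodule.Quotient.mk_smul, ← Submodule.Quotient.mk_smul,
          Submodule.Quotient.mk_eq_zero, mk_mem_smul_top_iff] at hm
      rw [← Submodule.Quotient.mk_smul, ← Submodule.Quotient.mk_smul,
          Submodule.Quotient.mk_eq_zero, mk_mem_smul_top_iff]
      exact h c hm
  simp only [bIdeal, Submodule.mem_iInf, key, isSOP_quotient_iff]
  constructor
  · intro h y h1 h2
    exact h s y ⟨hs, h1, h2⟩
  · rintro h s' y ⟨h0, h1, h2⟩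
    obtain rfl : s' = s := by exact_mod_cast h0.symm.trans hs
    exact h y h1 h2

lemma isSOP_iff [IsNoetherianRing R] {s : ℕ} (y : Fin s → R) :
    IsSOP R R y ↔ ringKrullDim R = s ∧
      (∀ i, y i ∈ maximalIdeal R) ∧ maximalIdeal R ≤ (Ideal.span (Set.range y)).radical := by
  have : Ideal.span (Set.range y) • (⊤ : Submodule R R) = Ideal.span (Set.range y) := by
    rw [smul_eq_mul, Ideal.mul_top]
  rw [IsSOP, this, isFiniteLength_quotient_iff, moduleDim]
  have h : Module.annihilator R R = ⊥ := Module.annihilator_eq_bot.2 inferInstance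
  rw [h, ringKrullDim_eq_of_ringEquiv (RingEquiv.quotientBot R)]
  rfl

end Parameters

section Colons

section

variable {R : Type u} [CommRing R]

/-- The colon ideal `J : t` of an ideal by an element. -/
def colonElt (J : Ideal R) (t : R) : Ideal R := Submodule.comap (LinearMap.mulLeft R t) J

lemma mem_colonElt {J : Ideal R} {t c : R} : c ∈ colonElt J t ↔ t * c ∈ J := Iff.rfl

lemma le_colonElt (J : Ideal R) (t : R) : J ≤ colonElt J t := fun _ h ↦ J.mul_mem_left t h

end

variable {R : Type u} [CommRing R] [IsLocalRing R]

/-- A finite type can be enumerated so that a given finite set `A` comes first, followed by a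
given element outside of `A`. -/
lemma exists_equiv_fin_image_eq {ι : Type*} [Fintype ι] {s : ℕ} (hs : Fintype.card ι = s)
    (A : Set ι) {a : ι} (ha : a ∉ A) :
    ∃ σ : Fin s ≃ ι, σ '' {j | j < σ.symm a} = A := by
  classical
  let e : Fin s ≃ ι := (Fintype.equivFinOfCardEq hs).symm
  let f : ι → ℕ := fun i ↦ if i ∈ A then 0 else if i = a then 1 else 2
  have hmono := Tuple.monotone_sort (f ∘ e)
  set σ := (Tuple.sort (f ∘ e)).trans e with hσ
  have hmono' : Monotone (f ∘ σ) := hmono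
  have hfa : f a = 1 := by simp [f, ha]
  refine ⟨σ, ?_⟩
  ext i
  obtain ⟨j, rfl⟩ := σ.surjective i
  rw [σ.injective.mem_set_image, Set.mem_ofPred_eq]
  constructor
  · intro h
    have h1 := hmono' h.le
    simp only [Function.comp, σ.apply_symm_apply, hfa] at h1
    by_contra hA
    have h2 : σ j = a := by
      by_contra h3
      simp [f, hA, h3] at h1
    rw [← h2] at h
    simp at h
  · intro h
    by_contra h1
    have h2 := hmono' (not_lt.1 h1)
    simp [hfa] at h2
    simp [f, h] at h2

lemma KillsColons.of_fintype {I : Ideal R} {s : ℕ} {z : R} (hz : KillsColons I s z)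
    {ι : Type*} [Fintype ι] (hs : Fintype.card ι = s) (y : ι → R)
    (hy : ∀ i, y i ∈ maximalIdeal R)
    (hrad : maximalIdeal R ≤ (I ⊔ Ideal.span (Set.range y)).radical)
    {A : Set ι} {a : ι} (ha : a ∉ A) {c : R} (hc : y a * c ∈ I ⊔ Ideal.span (y '' A)) :
    z * c ∈ I ⊔ Ideal.span (y '' A) := by
  obtain ⟨σ, hσ⟩ := exists_equiv_fin_image_eq hs A ha
  have := hz (y ∘ σ) (fun i ↦ hy _) (by rwa [σ.surjective.range_comp]) (σ.symm a) c
  rw [Set.image_comp, hσ] at this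
  exact this (by simpa using hc)

lemma maximalIdeal_le_radical_of_pow {ι : Type*} {y v : ι → R}
    (hrad : maximalIdeal R ≤ (Ideal.span (Set.range y)).radical)
    (hv : ∀ i, ∃ n, v i = y i ^ n) :
    maximalIdeal R ≤ (Ideal.span (Set.range v)).radical := by
  rw [← Ideal.radical_idem (Ideal.span (Set.range v))]
  refine hrad.trans (Ideal.radical_mono (Ideal.span_le.2 ?_))
  rintro _ ⟨i, rfl⟩
  obtain ⟨n, hn⟩ := hv i
  exact ⟨n, hn ▸ Ideal.subset_span ⟨i, rfl⟩⟩

/-- Cancelling monomials, up to a power of an element killing the colon quotients. -/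
lemma KillsColons.pow_mul_mem_of_mul_prod_mem {s : ℕ} {z : R} (hz : KillsColons (⊥ : Ideal R) s z)
    {ι : Type*} [Fintype ι] (hs : Fintype.card ι = s) (y : ι → R)
    (hy : ∀ i, y i ∈ maximalIdeal R)
    (hrad : maximalIdeal R ≤ (Ideal.span (Set.range y)).radical)
    (B : Finset ι) {N : ℕ} (hN : 0 < N) {c : R}
    (hc : c * ∏ i ∈ B, y i ^ N ∈ Ideal.span ((fun i ↦ y i ^ (N + 1)) '' B)) :
    z ^ B.card * c ∈ Ideal.span (y '' B) := by
  classical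
  suffices key : ∀ C ⊆ B, ∀ c,
      c * ∏ i ∈ C, y i ^ N ∈ Ideal.span ((fun i ↦ if i ∈ C then y i ^ (N + 1) else y i) '' B) →
      z ^ C.card * c ∈ Ideal.span (y '' B) by
    refine key B subset_rfl c ?_
    convert hc using 2
    refine Set.image_congr fun i hi ↦ ?_
    simp [Finset.mem_coe.1 hi]
  intro C
  induction C using Finset.induction_on with
  | empty => intro _ c hc; simpa using hc
  | insert a C ha ih =>
    intro hCB c hc
    obtain ⟨haB, hCB⟩ := Finset.insert_subset_iff.1 hCB
    rw [Finset.card_insert_of_notMem ha, pow_succ, mul_assoc]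
    refine ih hCB _ ?_
    let v : ι → R := fun i ↦ if i ∈ C then y i ^ (N + 1) else if i = a then y a ^ N else y i
    have hv : ∀ i, ∃ n, 0 < n ∧ v i = y i ^ n := by
      intro i
      by_cases h1 : i ∈ C
      · exact ⟨N + 1, by omega, by simp [v, h1]⟩
      · by_cases h2 : i = a
        · subst h2; exact ⟨N, hN, by simp [v, h1]⟩
        · exact ⟨1, one_pos, by simp [v, h1, h2]⟩
    set A : Set ι := (B : Set ι) \ {a}
    have hBA : (B : Set ι) = insert a A := by
      simp [A, Set.insert_eq_of_mem (Finset.mem_coe.2 haB)]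
    rw [hBA, Set.image_insert_eq, Ideal.span_insert] at hc
    have him1 : (fun i ↦ if i ∈ insert a C then y i ^ (N + 1) else y i) '' A = v '' A := by
      refine Set.image_congr fun i hi ↦ ?_
      have : i ≠ a := hi.2
      simp [v, this]
    have him2 : (fun i ↦ if i ∈ C then y i ^ (N + 1) else y i) '' A = v '' A := by
      refine Set.image_congr fun i hi ↦ ?_
      have : i ≠ a := hi.2
      simp [v, this]
    obtain ⟨w, hw, u, hu, huw⟩ := Submodule.mem_sup.1 hc
    obtain ⟨r, rfl⟩ := Ideal.mem_span_singleton'.1 hw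
    rw [him1] at hu
    have h1 : v a * (c * ∏ i ∈ C, y i ^ N - r * y a) ∈ ⊥ ⊔ Ideal.span (v '' A) := by
      rw [bot_sup_eq]
      convert hu using 1
      rw [Finset.prod_insert ha] at huw
      simp only [Finset.mem_insert_self, if_true] at huw
      simp only [v, ha, if_false, if_true]
      linear_combination -huw
    have h2 := hz.of_fintype hs v (fun i ↦ by
        obtain ⟨n, hn, h⟩ := hv i
        exact h ▸ Ideal.pow_mem_of_mem _ (hy i) n hn) (by
        rw [bot_sup_eq]
        exact maximalIdeal_le_radical_of_pow hrad fun i ↦ (hv i).imp fun n h ↦ h.2)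
      (by simp [A]) h1
    rw [bot_sup_eq] at h2
    rw [hBA, Set.image_insert_eq, Ideal.span_insert, him2]
    simp only [ha, if_false]
    rw [show z * c * ∏ i ∈ C, y i ^ N = z * r * y a + z * (c * ∏ i ∈ C, y i ^ N - r * y a) by ring]
    exact Submodule.add_mem_sup (Ideal.mul_mem_left _ _ (Ideal.mem_span_singleton_self _)) h2

lemma KillsColons.mono_mul {I : Ideal R} {s : ℕ} {z : R} (hz : KillsColons I s z) (r : R) :
    KillsColons I s (r * z) := fun y h1 h2 i c hc ↦ by
  rw [mul_assoc]; exact Ideal.mul_mem_left _ _ (hz y h1 h2 i c hc)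

/-- If the last element of a system of parameters `x` kills the colon quotients, then the first
elements are quasi-regular up to its saturation. -/
lemma KillsColons.quasiRegularPair {e : ℕ} {x : Fin (e + 1) → R}
    (hz : KillsColons (⊥ : Ideal R) (e + 1) (x (Fin.last e)))
    (hx : ∀ i, x i ∈ maximalIdeal R)
    (hrad : maximalIdeal R ≤ (Ideal.span (Set.range x)).radical) :
    QuasiRegularPair (fun i : Fin e ↦ x i.castSucc) (x (Fin.last e))
      (colonElt (Ideal.span (Set.range fun i : Fin e ↦ x i.castSucc)) (x (Fin.last e))) := by
  classical
  set t := x (Fin.last e)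
  set J := Ideal.span (Set.range fun i : Fin e ↦ x i.castSucc) with hJ
  set B : Finset (Fin (e + 1)) := Finset.univ.map Fin.castSuccEmb with hB
  have himg : ∀ v : Fin (e + 1) → R, v '' B = Set.range fun i : Fin e ↦ v i.castSucc := by
    intro v
    rw [hB, Finset.coe_map, Finset.coe_univ, Set.image_univ, ← Set.range_comp]
    rfl
  have hsat : ∀ c, t * (t * c) ∈ J → t * c ∈ J := by
    intro c hc
    have := hz.of_fintype (Fintype.card_fin _)
      (fun i ↦ if i = Fin.last e then t ^ 2 else x i) (A := B) (a := Fin.last e) (c := c)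
      (fun i ↦ by
        by_cases h : i = Fin.last e
        · simp only [h, if_true]; exact Ideal.pow_mem_of_mem _ (hx _) 2 two_pos
        · simp only [h, if_false]; exact hx i)
      (by
        rw [bot_sup_eq]
        refine maximalIdeal_le_radical_of_pow hrad fun i ↦ ?_
        by_cases h : i = Fin.last e
        · exact ⟨2, by simp [h, t]⟩
        · exact ⟨1, by simp [h]⟩)
      (by simp [hB])
    simp only [himg, bot_sup_eq, Fin.castSucc_ne_last, if_false, if_true] at this
    exact this (by rwa [pow_two, mul_assoc])
  refine ⟨fun N hN c hc ↦ ?_, fun c hc ↦ hc, hsat⟩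
  have h1 := hz.pow_mul_mem_of_mul_prod_mem (Fintype.card_fin _) x hx hrad B hN (c := c) (by
    rw [himg, hB, Finset.prod_map]; exact hc)
  rw [himg] at h1
  have h2 : ∀ n, t ^ (n + 1) * c ∈ J → t * c ∈ J := by
    intro n
    induction n with
    | zero => intro h; simpa using h
    | succ n ih =>
      intro h
      refine ih ?_
      rw [pow_succ', mul_assoc]
      refine hsat _ ?_
      rwa [← mul_assoc, ← mul_assoc, ← pow_two, ← pow_add, add_comm 2]
  refine h2 B.card ?_
  rw [pow_succ', mul_assoc]
  exact J.mul_mem_left _ h1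

lemma ringKrullDim_quotient_le_card [IsNoetherianRing R] {I : Ideal R} (hI : I ≤ maximalIdeal R)
    {ι : Type*} [Fintype ι] (y : ι → R) (hy : ∀ i, y i ∈ maximalIdeal R)
    (hrad : maximalIdeal R ≤ (I ⊔ Ideal.span (Set.range y)).radical) :
    ringKrullDim (R ⧸ I) ≤ (Fintype.card ι : ℕ) := by
  classical
  have hsurj : Function.Surjective (Ideal.Quotient.mk I) := Ideal.Quotient.mk_surjective
  have : Nontrivial (R ⧸ I) :=
    Ideal.Quotient.nontrivial_iff.2 (ne_top_of_le_ne_top Ideal.IsPrime.ne_top' hI)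
  have : IsLocalRing (R ⧸ I) := .of_surjective' _ hsurj
  have hmem : ∀ r, Ideal.Quotient.mk I r ∈ maximalIdeal (R ⧸ I) ↔ r ∈ maximalIdeal R := by
    intro r
    have := Ideal.comap_isMaximal_of_surjective (K := maximalIdeal (R ⧸ I)) _ hsurj
    rw [← eq_maximalIdeal this]
    rfl
  have hle : Ideal.span (Set.range (Ideal.Quotient.mk I ∘ y)) ≤ maximalIdeal (R ⧸ I) := by
    rw [Ideal.span_le]; rintro _ ⟨i, rfl⟩; exact (hmem _).2 (hy i)
  have hcomap : (Ideal.span (Set.range (Ideal.Quotient.mk I ∘ y))).comap (Ideal.Quotient.mk I) =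
      I ⊔ Ideal.span (Set.range y) := by
    rw [Set.range_comp, ← Ideal.map_span, Ideal.comap_map_of_surjective' _ hsurj, Ideal.mk_ker,
      sup_comm]
  have hmin : maximalIdeal (R ⧸ I) ∈
      (Ideal.span (Set.range (Ideal.Quotient.mk I ∘ y))).minimalPrimes := by
    refine ⟨⟨inferInstance, hle⟩, fun P hP _ ↦ ?_⟩
    intro r hr
    obtain ⟨r, rfl⟩ := hsurj r
    obtain ⟨n, hn⟩ := hrad ((hmem r).1 hr)
    rw [← hcomap, Ideal.mem_comap, map_pow] at hn
    exact hP.1.mem_of_pow_mem n (hP.2 hn)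
  rw [← maximalIdeal_height_eq_ringKrullDim]
  have h1 := Ideal.height_le_card_of_mem_minimalPrimes_span (Set.finite_range _) hmin
  have h2 : (Set.range (Ideal.Quotient.mk I ∘ y)).ncard ≤ Fintype.card ι := by
    rw [← Set.image_univ, ← Nat.card_eq_fintype_card, ← Set.ncard_univ]
    exact (Set.ncard_image_le Set.finite_univ)
  exact_mod_cast h1.trans (by exact_mod_cast h2)

lemma card_le_of_le_radical_span [IsNoetherianRing R] {d : ℕ} (hd : ringKrullDim R = d)
    {ι : Type*} [Fintype ι] (y : ι → R) (hy : ∀ i, y i ∈ maximalIdeal R)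
    (hrad : maximalIdeal R ≤ (Ideal.span (Set.range y)).radical) : d ≤ Fintype.card ι := by
  have := ringKrullDim_quotient_le_card (I := ⊥) bot_le y hy (by rwa [bot_sup_eq])
  rw [ringKrullDim_eq_of_ringEquiv (RingEquiv.quotientBot R), hd] at this
  exact_mod_cast this

/-- Cutting by part of a system of parameters lowers the dimension by the number of elements. -/
lemma ringKrullDim_quotient_eq_of_isSOP [IsNoetherianRing R] {a b : ℕ}
    (hd : ringKrullDim R = (a + b : ℕ)) {ι κ : Type*} [Fintype ι] [Fintype κ]
    (hι : Fintype.card ι = a) (hκ : Fintype.card κ = b) (y : ι → R) (w : κ → R)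
    (hy : ∀ i, y i ∈ maximalIdeal R) (hw : ∀ i, w i ∈ maximalIdeal R)
    (hrad : maximalIdeal R ≤ (Ideal.span (Set.range w) ⊔ Ideal.span (Set.range y)).radical) :
    ringKrullDim (R ⧸ Ideal.span (Set.range w)) = a := by
  have hwm : Ideal.span (Set.range w) ≤ maximalIdeal R := by
    rw [Ideal.span_le]; rintro _ ⟨i, rfl⟩; exact hw i
  have hle : ringKrullDim (R ⧸ Ideal.span (Set.range w)) ≤ a :=
    hι ▸ ringKrullDim_quotient_le_card hwm y hy hrad
  refine le_antisymm hle ?_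
  have h1 := ringKrullDim_le_ringKrullDim_quotient_add_encard (Set.range w) (by
    rw [IsLocalRing.ringJacobson_eq_maximalIdeal]; exact Ideal.span_le.1 hwm)
  have h2 : (Set.range w).encard ≤ b := by
    rw [← hκ, ← Set.image_univ]
    refine (Set.encard_image_le _ _).trans ?_
    rw [Set.encard_univ, ENat.card_eq_coe_fintype_card]
  have : Nontrivial (R ⧸ Ideal.span (Set.range w)) :=
    Ideal.Quotient.nontrivial_iff.2 (ne_top_of_le_ne_top Ideal.IsPrime.ne_top' hwm)
  have h0 : 0 ≤ ringKrullDim (R ⧸ Ideal.span (Set.range w)) := ringKrullDim_nonneg_of_nontrivial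
  rw [hd] at h1
  generalize ringKrullDim (R ⧸ Ideal.span (Set.range w)) = D at *
  obtain ⟨D, rfl⟩ := WithBot.ne_bot_iff_exists.1 (ne_bot_of_le_ne_bot (by simp) h0)
  have hD : D ≤ a := by exact_mod_cast hle
  obtain ⟨n, rfl⟩ := ENat.ne_top_iff_exists.1 (ne_top_of_le_ne_top (ENat.natCast_ne_top a) hD)
  obtain ⟨k, hk⟩ := ENat.ne_top_iff_exists.1 (ne_top_of_le_ne_top (ENat.natCast_ne_top b) h2)
  rw [← hk] at h1 h2
  have h1' : a + b ≤ n + k := by exact_mod_cast h1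
  have h2' : k ≤ b := by exact_mod_cast h2
  exact_mod_cast (by omega : a ≤ n)

end Colons

section Length

variable {R : Type u} [CommRing R] {M N : Type*} [AddCommGroup M] [Module R M] [AddCommGroup N]
  [Module R N]

lemma length_eq_inf_ker_add_map (f : M →ₗ[R] N) (S : Submodule R M) :
    Module.length R S = Module.length R ↥(S ⊓ LinearMap.ker f) + Module.length R (S.map f) := by
  refine Module.length_eq_add_of_exact (Submodule.inclusion inf_le_left)
    (f.submoduleMap S) (Submodule.inclusion_injective _) (f.submoduleMap_surjective S) ?_
  intro x
  constructor
  · intro hx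
    have hx : f x = 0 := congrArg Subtype.val hx
    exact ⟨⟨x, x.2, hx⟩, rfl⟩
  · rintro ⟨y, rfl⟩
    exact Subtype.ext y.2.2

lemma length_le_of_le {S T : Submodule R M} (h : S ≤ T) :
    Module.length R S ≤ Module.length R T :=
  Module.length_le_of_injective _ (Submodule.inclusion_injective h)

end Length

section Socle

variable (R : Type u) [CommRing R] [IsLocalRing R]

/-- The socle of a module over a local ring. -/
def socle (M : Type u) [AddCommGroup M] [Module R M] : Submodule R M :=
  modColon R ⊥ (maximalIdeal R)

variable {R} {M N P : Type u} [AddCommGroup M] [Module R M] [AddCommGroup N] [Module R N]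
  [AddCommGroup P] [Module R P]

lemma map_mem_socle (f : M →ₗ[R] N) {x : M} (hx : x ∈ socle R M) : f x ∈ socle R N :=
  fun r hr ↦ by rw [← map_smul, hx r hr]; simp

lemma mem_socle_of_injective {f : M →ₗ[R] N} (hf : Function.Injective f) {x : M}
    (hx : f x ∈ socle R N) : x ∈ socle R M :=
  fun r hr ↦ hf (by rw [map_smul, hx r hr]; simp)

lemma length_socle_le_of_injective {f : M →ₗ[R] N} (hf : Function.Injective f) :
    Module.length R (socle R M) ≤ Module.length R (socle R N) :=
  Module.length_le_of_injective
    ((f ∘ₗ (socle R M).subtype).codRestrict (socle R N) fun x ↦ map_mem_socle f x.2)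
    fun _ _ h ↦ Subtype.ext (hf (congrArg Subtype.val h))

lemma length_socle_eq_of_equiv (e : M ≃ₗ[R] N) :
    Module.length R (socle R M) = Module.length R (socle R N) :=
  le_antisymm (length_socle_le_of_injective e.injective)
    (length_socle_le_of_injective e.symm.injective)

lemma length_socle_inf_sup_le (Ψ : P →ₗ[R] M) (K : Submodule R M) (K' : Submodule R P)
    (h : ∀ x, Ψ x ∈ K → x ∈ K') (h' : ∀ x ∈ K', Ψ x ∈ K) :
    Module.length R ↥(socle R M ⊓ (LinearMap.range Ψ ⊔ K)) ≤
      Module.length R ↥(socle R M ⊓ K) + Module.length R (socle R (P ⧸ K')) := by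
  have hinj : Function.Injective (K'.mapQ K Ψ h') := by
    rw [← LinearMap.ker_eq_bot, eq_bot_iff]
    intro x hx
    obtain ⟨x, rfl⟩ := Submodule.mkQ_surjective _ x
    rw [LinearMap.mem_ker, Submodule.mkQ_apply, Submodule.mapQ_apply,
      Submodule.Quotient.mk_eq_zero] at hx
    exact (Submodule.Quotient.mk_eq_zero _).2 (h x hx)
  rw [length_eq_inf_ker_add_map K.mkQ]
  refine add_le_add (length_le_of_le ?_) ?_
  · rw [Submodule.ker_mkQ]
    exact inf_le_inf_right _ inf_le_left
  · have : (socle R M ⊓ (LinearMap.range Ψ ⊔ K)).map K.mkQ ≤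
        (socle R (P ⧸ K')).map (K'.mapQ K Ψ h') := by
      rintro _ ⟨x, ⟨hx, hx'⟩, rfl⟩
      obtain ⟨_, ⟨p, rfl⟩, k, hk, rfl⟩ := Submodule.mem_sup.1 hx'
      have e : K.mkQ (Ψ p + k) = K'.mapQ K Ψ h' (K'.mkQ p) := by
        simpa using hk
      refine ⟨K'.mkQ p, mem_socle_of_injective hinj ?_, e.symm⟩
      rw [← e]
      exact map_mem_socle _ hx
    refine (length_le_of_le this).trans ?_
    exact Module.length_le_of_surjective _ ((K'.mapQ K Ψ h').submoduleMap_surjective _)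

lemma length_socle_pi {ι : Type} [Fintype ι] :
    Module.length R (socle R (ι → M)) = Fintype.card ι * Module.length R (socle R M) := by
  have e : socle R (ι → M) ≃ₗ[R] (ι → socle R M) :=
    { toFun := fun x i ↦ ⟨x.1 i, fun r hr ↦ congrFun (x.2 r hr) i⟩
      invFun := fun x ↦ ⟨fun i ↦ x i, fun r hr ↦ funext fun i ↦ (x i).2 r hr⟩
      map_add' := fun _ _ ↦ rfl
      map_smul' := fun _ _ ↦ rfl
      left_inv := fun _ ↦ rfl
      right_inv := fun _ ↦ rfl }
  rw [e.length_eq, Module.length_pi]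
  simp

lemma map_mkQ_modColon (I : Submodule R M) :
    (modColon R I (maximalIdeal R)).map I.mkQ = socle R (M ⧸ I) := by
  ext x
  obtain ⟨x, rfl⟩ := Submodule.mkQ_surjective _ x
  constructor
  · rintro ⟨y, hy, hyx⟩ r hr
    rw [← hyx, ← map_smul]
    exact (Submodule.Quotient.mk_eq_zero _).2 (hy r hr)
  · intro hx
    refine ⟨x, fun r hr ↦ ?_, rfl⟩
    have := hx r hr
    rw [← map_smul] at this
    exact (Submodule.Quotient.mk_eq_zero _).1 this

lemma irMod_eq (q : Ideal R) :
    irMod R R q = (Module.length R (socle R (R ⧸ q)) : WithBot ℕ∞) := by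
  have : q • (⊤ : Submodule R R) = q := by rw [smul_eq_mul, Ideal.mul_top]
  rw [irMod, map_mkQ_modColon, moduleLength, ← Module.coe_length, this]

end Socle

section Layers

variable {R : Type u} [CommRing R] {κ : Type} [Fintype κ] [DecidableEq κ]

/-- The set of exponents of monomials of degree `k`. -/
abbrev Exponents (κ : Type) [Fintype κ] [DecidableEq κ] (k : ℕ) : Type :=
  ↥((Finset.univ : Finset κ).finsuppAntidiag k)

/-- The evaluation at `y` of a form of degree `k` given by its coefficients. -/
def evalForm (y : κ → R) (k : ℕ) : (Exponents κ k → R) →ₗ[R] R :=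
  ∑ γ : Exponents κ k, (LinearMap.proj γ).smulRight (∏ i, y i ^ γ.1 i)

lemma evalForm_apply (y : κ → R) (k : ℕ) (g : Exponents κ k → R) :
    evalForm y k g = ∑ γ : Exponents κ k, g γ * ∏ i, y i ^ γ.1 i := by
  simp [evalForm]

lemma exists_form_eq_evalForm (y : κ → R) (k : ℕ) (g : Exponents κ k → R) :
    ∃ F : MvPolynomial κ R, F.IsHomogeneous k ∧ F.eval y = evalForm y k g ∧
      ∀ γ : Exponents κ k, F.coeff γ.1 = g γ := by
  refine ⟨∑ γ : Exponents κ k, MvPolynomial.monomial γ.1 (g γ), ?_, ?_, fun γ ↦ ?_⟩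
  · refine MvPolynomial.IsHomogeneous.sum _ _ _ fun γ _ ↦
      MvPolynomial.isHomogeneous_monomial _ ?_
    have := (Finset.mem_finsuppAntidiag.1 γ.2).1
    rw [Finsupp.degree_eq_sum, this]
  · simp [evalForm_apply, MvPolynomial.eval_monomial, Finsupp.prod_fintype]
  · simp only [MvPolynomial.coeff_sum, MvPolynomial.coeff_monomial]
    rw [Finset.sum_eq_single γ]
    · simp
    · intro b _ hb
      rw [if_neg fun h ↦ hb (Subtype.ext h)]
    · simp

lemma range_evalForm (y : κ → R) (k : ℕ) :
    LinearMap.range (evalForm y k) = Ideal.span (Set.range y) ^ k := by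
  ext r
  constructor
  · rintro ⟨g, rfl⟩
    obtain ⟨F, hF, h, -⟩ := exists_form_eq_evalForm y k g
    exact (Ideal.mem_span_pow_iff_exists_isHomogeneous _ _).2 ⟨F, hF, h⟩
  · intro h
    obtain ⟨F, hF, rfl⟩ := (Ideal.mem_span_pow_iff_exists_isHomogeneous _ _).1 h
    refine ⟨fun γ ↦ F.coeff γ.1, ?_⟩
    rw [evalForm_apply, MvPolynomial.eval_eq', Finset.sum_coe_sort
      ((Finset.univ : Finset κ).finsuppAntidiag k) (fun γ ↦ F.coeff γ * ∏ i, y i ^ γ i)]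
    symm
    refine Finset.sum_subset (fun γ hγ ↦ ?_) fun γ _ hγ ↦ ?_
    · have hdeg := hF.degree_eq_of_coeff_ne_zero (MvPolynomial.mem_support_iff.1 hγ)
      rw [Finset.mem_finsuppAntidiag]
      exact ⟨by rwa [Finsupp.degree_eq_sum] at hdeg, by simp⟩
    · rw [MvPolynomial.notMem_support_iff.1 hγ, zero_mul]

lemma prod_pow_mem (y : κ → R) {k : ℕ} (γ : Exponents κ k) :
    ∏ i, y i ^ γ.1 i ∈ Ideal.span (Set.range y) ^ k := by
  rw [← range_evalForm]
  refine ⟨Pi.single γ 1, ?_⟩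
  rw [evalForm_apply, Finset.sum_eq_single γ]
  · simp
  · intro b _ hb; simp [hb]
  · simp

lemma evalForm_mem (y : κ → R) {k : ℕ} {I : Ideal R} {g : Exponents κ k → R} (hg : ∀ γ, g γ ∈ I) :
    evalForm y k g ∈ I * Ideal.span (Set.range y) ^ k := by
  rw [evalForm_apply]
  exact sum_mem fun γ _ ↦ Ideal.mul_mem_mul (hg γ) (prod_pow_mem y γ)

lemma card_exponents {e : ℕ} (h : Fintype.card κ = e + 1) (k : ℕ) :
    Fintype.card (Exponents κ k) = (k + e).choose e := by
  rw [Fintype.card_coe, Finset.card_finsuppAntidiag_nat_eq_choose, Finset.card_univ, h,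
    show e + 1 + k - 1 = k + e by omega, Nat.choose_symm_add]

/-- The quotient of a finite power of `R` by the power of an ideal. -/
def piQuotientEquiv {ι : Type} [Fintype ι] [DecidableEq ι] (I : Ideal R) :
    ((ι → R) ⧸ Submodule.pi Set.univ (fun _ : ι ↦ I)) ≃ₗ[R] (ι → R ⧸ I) :=
  Submodule.quotientPi (fun _ : ι ↦ I)

end Layers

section LengthBound

variable {R : Type u} [CommRing R] {κ : Type} [Fintype κ] [DecidableEq κ]

lemma length_map_pow_le (y : κ → R) {q : Ideal R} (hq : Ideal.span (Set.range y) ≤ q) (n : ℕ) :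
    Module.length R ↥(Submodule.map (Submodule.mkQ (q ^ (n + 1))) (Ideal.span (Set.range y) ^ n : Ideal R)) ≤
      Fintype.card (Exponents κ n) * Module.length R (R ⧸ q) := by
  let Ψ : (Exponents κ n → R) →ₗ[R] R ⧸ q ^ (n + 1) := (q ^ (n + 1)).mkQ ∘ₗ evalForm y n
  have hker : Submodule.pi Set.univ (fun _ : Exponents κ n ↦ q) ≤ LinearMap.ker Ψ := by
    intro g hg
    refine (Submodule.Quotient.mk_eq_zero _).2 ?_
    have := evalForm_mem y (I := q) fun γ ↦ hg γ trivial
    rw [pow_succ']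
    exact Ideal.mul_mono_right (Ideal.pow_right_mono hq _) this
  have h1 : Submodule.map (Submodule.mkQ (q ^ (n + 1))) (Ideal.span (Set.range y) ^ n : Ideal R) =
      LinearMap.range (Submodule.liftQ _ Ψ hker) := by
    rw [Submodule.range_liftQ, LinearMap.range_comp, range_evalForm]
  rw [h1]
  refine (Module.length_le_of_surjective _ (LinearMap.surjective_rangeRestrict _)).trans ?_
  rw [(piQuotientEquiv q).length_eq, Module.length_pi, ENat.card_eq_coe_fintype_card]

end LengthBound

section SocleBound

variable {R : Type u} [CommRing R] [IsLocalRing R] {κ : Type} [Fintype κ] [DecidableEq κ]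
  {y : κ → R} {t : R} {J' : Ideal R}

lemma length_socle_pi_quotient (I : Ideal R) (ι : Type) [Fintype ι] [DecidableEq ι] :
    Module.length R (socle R ((ι → R) ⧸ Submodule.pi Set.univ (fun _ : ι ↦ I))) =
      Fintype.card ι * Module.length R (socle R (R ⧸ I)) := by
  rw [length_socle_eq_of_equiv (piQuotientEquiv I), length_socle_pi]

/-- One step of the filtration bounding the socle of `q^n/q^(n+1)`. -/
lemma QuasiRegularPair.length_socle_layer_le (h : QuasiRegularPair y t J') (k j : ℕ) :
    Module.length R ↥(socle R (R ⧸ (Ideal.span (Set.range y) ⊔ Ideal.span {t}) ^ (k + j + 2)) ⊓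
      Submodule.map (Submodule.mkQ _)
        (Ideal.span (Set.range y) ^ k * (Ideal.span (Set.range y) ⊔ Ideal.span {t}) ^ (j + 1) : Ideal R)) ≤
    Module.length R ↥(socle R (R ⧸ (Ideal.span (Set.range y) ⊔ Ideal.span {t}) ^ (k + j + 2)) ⊓
      Submodule.map (Submodule.mkQ _)
        (Ideal.span (Set.range y) ^ (k + 1) *
          (Ideal.span (Set.range y) ⊔ Ideal.span {t}) ^ j : Ideal R)) +
    Fintype.card (Exponents κ k) * Module.length R (socle R (R ⧸ J' ⊔ Ideal.span {t})) := by
  set J := Ideal.span (Set.range y) with hJ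
  set q := J ⊔ Ideal.span {t} with hq
  have htq : t ∈ q := Ideal.mem_sup_right (Ideal.mem_span_singleton_self t)
  let Ψ : (Exponents κ k → R) →ₗ[R] R ⧸ q ^ (k + j + 2) :=
    (q ^ (k + j + 2)).mkQ ∘ₗ (LinearMap.mulLeft R (t ^ (j + 1))) ∘ₗ evalForm y k
  set K : Submodule R (R ⧸ q ^ (k + j + 2)) :=
    Submodule.map (Submodule.mkQ _) (J ^ (k + 1) * q ^ j : Ideal R) with hK
  have hΨ : ∀ g, Ψ g ∈ K ↔ t ^ (j + 1) * evalForm y k g ∈ J ^ (k + 1) * q ^ j ⊔ q ^ (k + j + 2) := by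
    intro g
    change (q ^ (k + j + 2)).mkQ (t ^ (j + 1) * evalForm y k g) ∈ K ↔ _
    rw [hK, ← Submodule.mem_comap, Submodule.comap_map_mkQ, sup_comm]
  have h1 := length_socle_inf_sup_le Ψ K
    (Submodule.pi Set.univ (fun _ : Exponents κ k ↦ J' ⊔ Ideal.span {t})) (fun g hg ↦ by
      rw [hΨ] at hg
      obtain ⟨F, hF, hFe, hFc⟩ := exists_form_eq_evalForm y k g
      rw [← hFe] at hg
      intro γ _
      rw [← hFc γ]
      refine h.layer_coeff_mem (j := j + 1) F hF ?_ γ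
      exact (sup_le_sup_right Ideal.mul_le_left _ : J ^ (k + 1) * q ^ j ⊔ _ ≤ _) hg) (fun g hg ↦ by
      rw [hΨ]
      have hg' : ∀ γ, g γ ∈ J' ⊔ Ideal.span {t} := fun γ ↦ hg γ trivial
      rw [evalForm_apply, Finset.mul_sum]
      refine sum_mem fun γ _ ↦ ?_
      obtain ⟨a, ha, b, hb, hab⟩ := Submodule.mem_sup.1 (hg' γ)
      obtain ⟨b, rfl⟩ := Ideal.mem_span_singleton'.1 hb
      rw [← hab]
      have hp := prod_pow_mem y γ
      rw [show t ^ (j + 1) * ((a + b * t) * ∏ i, y i ^ γ.1 i) =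
        t * a * (∏ i, y i ^ γ.1 i) * t ^ j + b * ((∏ i, y i ^ γ.1 i) * t ^ (j + 2)) by ring]
      refine Submodule.add_mem_sup (Ideal.mul_mem_mul ?_ (Ideal.pow_mem_pow htq _)) ?_
      · rw [pow_succ']; exact Ideal.mul_mem_mul (h.mul_mem a ha) hp
      · refine Ideal.mul_mem_left _ _ ?_
        rw [add_assoc, pow_add]
        exact Ideal.mul_mem_mul (Ideal.pow_right_mono le_sup_left _ hp) (Ideal.pow_mem_pow htq _))
  rw [length_socle_pi_quotient] at h1
  refine (length_le_of_le (inf_le_inf_left _ ?_)).trans h1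
  refine (Submodule.map_mono (pow_mul_sup_pow_le J t k j)).trans ?_
  rw [Submodule.map_sup]
  refine sup_le_sup_right ?_ _
  rintro _ ⟨r, hr, rfl⟩
  obtain ⟨g, hg, rfl⟩ := Ideal.mem_span_singleton_mul.1 hr
  rw [← range_evalForm] at hg
  obtain ⟨g, rfl⟩ := hg
  exact ⟨g, rfl⟩

/-- The bound for the socle of `q^n/q^(n+1)`. -/
lemma QuasiRegularPair.length_socle_inf_pow_le (h : QuasiRegularPair y t J') {e : ℕ}
    (he : Fintype.card κ = e + 1) (n : ℕ) :
    Module.length R ↥(socle R (R ⧸ (Ideal.span (Set.range y) ⊔ Ideal.span {t}) ^ (n + 1)) ⊓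
      Submodule.map (Submodule.mkQ _) ((Ideal.span (Set.range y) ⊔ Ideal.span {t}) ^ n : Ideal R)) ≤
    (n + e + 1).choose (e + 1) * Module.length R (socle R (R ⧸ J' ⊔ Ideal.span {t})) +
      (n + e).choose e * Module.length R (R ⧸ Ideal.span (Set.range y) ⊔ Ideal.span {t}) := by
  set J := Ideal.span (Set.range y) with hJ
  set q := J ⊔ Ideal.span {t} with hq
  have key : ∀ j ≤ n, Module.length R ↥(socle R (R ⧸ q ^ (n + 1)) ⊓
      Submodule.map (Submodule.mkQ _) (J ^ (n - j) * q ^ j : Ideal R)) ≤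
      (∑ i ∈ Finset.range j, (n - 1 - i + e).choose e : ℕ) *
        Module.length R (socle R (R ⧸ J' ⊔ Ideal.span {t})) +
      (n + e).choose e * Module.length R (R ⧸ q) := by
    intro j
    induction j with
    | zero =>
      intro _
      refine (length_le_of_le inf_le_right).trans ?_
      rw [Nat.sub_zero, pow_zero, mul_one]
      refine (length_map_pow_le y le_sup_left n).trans ?_
      rw [card_exponents he]
      simp [q, J]
    | succ j ih =>
      intro hj
      have h1 := h.length_socle_layer_le (n - (j + 1)) j
      rw [show n - (j + 1) + j + 2 = n + 1 by omega, show n - (j + 1) + 1 = n - j by omega] at h1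
      refine h1.trans ((add_le_add_left (ih (by omega)) _).trans ?_)
      rw [card_exponents he, Finset.sum_range_succ, show n - 1 - j = n - (j + 1) by omega]
      push_cast
      rw [add_mul]
      exact le_of_eq (by ring)
  have := key n le_rfl
  rw [Nat.sub_self, pow_zero, one_mul] at this
  refine this.trans (add_le_add_left ?_ _)
  gcongr
  rcases n with _ | n
  · simp
  have h2 := Finset.sum_range_reflect (fun k ↦ (k + e).choose e) (n + 1)
  rw [Nat.sum_range_add_choose] at h2
  rw [h2]
  exact Nat.choose_le_choose _ (by omega)

end SocleBound

section PowerColon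

variable {R : Type u} [CommRing R] [IsNoetherianRing R]

/-- The filtration `(q^(p+2) : q) ∩ q^p`. -/
def colonFiltration (q : Ideal R) : q.Filtration R where
  N p := modColon R (q ^ (p + 2) : Ideal R) q ⊓ (q ^ p : Ideal R)
  mono p := by
    refine inf_le_inf (fun x hx r hr ↦ ?_) (Ideal.pow_le_pow_right p.le_succ)
    exact Ideal.pow_le_pow_right (by omega) (hx r hr)
  smul_le p := by
    rw [Submodule.smul_le]
    rintro a ha x ⟨hx, hx'⟩
    refine ⟨fun r hr ↦ ?_, ?_⟩
    · rw [show p + 1 + 2 = (p + 2) + 1 by ring, pow_succ']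
      exact Ideal.mul_mem_mul hr (hx a ha)
    · change _ ∈ q ^ (p + 1)
      rw [pow_succ']
      exact Ideal.mul_mem_mul ha hx'

lemma exists_forall_modColon_pow_inf_le (q : Ideal R) :
    ∃ N, ∀ p ≥ N, ∀ x ∈ q ^ p, (∀ r ∈ q, r * x ∈ q ^ (p + 2)) → x ∈ q ^ (p + 1) := by
  have h1 : (colonFiltration q).Stable :=
    (q.stableFiltration_stable (⊤ : Submodule R R)).of_le fun p ↦ by
      refine inf_le_right.trans (le_of_eq ?_)
      simp
  obtain ⟨N, hN⟩ := h1
  refine ⟨N + 1, fun p hp x hx hx' ↦ ?_⟩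
  obtain ⟨p, rfl⟩ : ∃ p', p = p' + 1 := ⟨p - 1, by omega⟩
  have h2 : x ∈ (colonFiltration q).N (p + 1) := ⟨fun r hr ↦ hx' r hr, hx⟩
  rw [← hN p (by omega)] at h2
  refine (Submodule.smul_le.2 ?_ : q • (colonFiltration q).N p ≤ (q ^ (p + 1 + 1) : Ideal R)) h2
  rintro a ha y ⟨hy, -⟩
  exact hy a ha

lemma exists_forall_modColon_pow_le {q : Ideal R} {t : R} (ht : t ∈ q)
    (hreg : ∀ c, t * c = 0 → c = 0) :
    ∃ N, ∀ n ≥ N, ∀ x, (∀ r ∈ q, r * x ∈ q ^ (n + 1)) → x ∈ q ^ n := by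
  obtain ⟨N, hN⟩ := exists_forall_modColon_pow_inf_le q
  obtain ⟨k, hk⟩ := Ideal.exists_pow_inf_eq_pow_smul q (Ideal.span {t} : Submodule R R)
  refine ⟨N + k, fun n hn x hx ↦ ?_⟩
  have h1 : x ∈ q ^ (n + 1 - k) := by
    have h2 : t * x ∈ q ^ (n + 1) • (⊤ : Submodule R R) ⊓ Ideal.span {t} := by
      refine ⟨?_, Ideal.mul_mem_right _ _ (Ideal.mem_span_singleton_self t)⟩
      rw [smul_eq_mul, Ideal.mul_top]
      exact hx t ht
    rw [hk (n + 1) (by omega)] at h2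
    have h3 := Submodule.smul_mono (le_refl (q ^ (n + 1 - k))) (inf_le_right :
      q ^ k • (⊤ : Submodule R R) ⊓ Ideal.span {t} ≤ _) h2
    rw [smul_eq_mul, Ideal.mem_mul_span_singleton] at h3
    obtain ⟨z, hz, hzx⟩ := h3
    have : x - z = 0 := hreg _ (by rw [mul_sub, ← hzx]; ring)
    rwa [sub_eq_zero.1 this]
  have h2 : ∀ p, n + 1 - k ≤ p → p ≤ n → x ∈ q ^ p := by
    intro p hp
    induction p, hp using Nat.le_induction with
    | base => intro _; exact h1
    | succ p hp ih =>
      intro hpn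
      exact hN p (by omega) x (ih (by omega)) fun r hr ↦
        Ideal.pow_le_pow_right (by omega) (hx r hr)
  rcases Nat.eq_zero_or_pos k with rfl | hk0
  · exact Ideal.pow_le_pow_right (by omega) h1
  · exact h2 n (by omega) le_rfl

end PowerColon

section SocleLifting

variable {R : Type u} [CommRing R] [IsLocalRing R] [IsNoetherianRing R]

lemma exists_mul_notMem_and_mul_mem {q : Ideal R} (hq : maximalIdeal R ≤ q.radical) {x : R}
    (hx : x ∉ q) : ∃ r, r * x ∉ q ∧ ∀ s ∈ maximalIdeal R, s * (r * x) ∈ q := by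
  obtain ⟨n, hn⟩ := q.exists_radical_pow_le_of_fg (IsNoetherian.noetherian _)
  have hn : maximalIdeal R ^ n ≤ q := (Ideal.pow_right_mono hq n).trans hn
  have hex : ∃ n, ∀ r ∈ maximalIdeal R ^ n, r * x ∈ q :=
    ⟨n, fun r hr ↦ q.mul_mem_right _ (hn hr)⟩
  classical
  have h0 : Nat.find hex ≠ 0 := by
    intro h0
    have := Nat.find_spec hex
    rw [h0] at this
    exact hx (by simpa using this 1 (by simp))
  obtain ⟨m, hm⟩ := Nat.exists_eq_succ_of_ne_zero h0
  have h1 := Nat.find_min hex (m := m) (by omega)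
  push Not at h1
  obtain ⟨r, hr, hrx⟩ := h1
  refine ⟨r, hrx, fun s hs ↦ ?_⟩
  rw [← mul_assoc]
  refine Nat.find_spec hex _ ?_
  rw [hm, pow_succ']
  exact Ideal.mul_mem_mul hs hr

/-- Passing to the saturation `W` of `J` drops the index of reducibility. -/
lemma length_socle_add_one_le {J W b : Ideal R} {t : R} (hJW : J ≤ W) (htW : ∀ c ∈ W, t * c ∈ J)
    (hWt : ∀ c, t * c ∈ W → c ∈ W) (hb : ∀ z ∈ b, ∀ w ∈ W, z * w ∈ J)
    (hbm : b ≤ maximalIdeal R) (ht : t ∈ b * b)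
    (hrad : maximalIdeal R ≤ (J ⊔ Ideal.span {t}).radical) (hne : ¬ W ≤ J) :
    Module.length R (socle R (R ⧸ W ⊔ Ideal.span {t})) + 1 ≤
      Module.length R (socle R (R ⧸ J ⊔ Ideal.span {t})) := by
  have hle : J ⊔ Ideal.span {t} ≤ W ⊔ Ideal.span {t} := sup_le_sup_right hJW _
  let f : (R ⧸ J ⊔ Ideal.span {t}) →ₗ[R] R ⧸ W ⊔ Ideal.span {t} := Submodule.factor hle
  rw [length_eq_inf_ker_add_map f (socle R (R ⧸ J ⊔ Ideal.span {t})), add_comm]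
  refine add_le_add ?_ (length_le_of_le ?_)
  · rw [Order.one_le_iff_ne_zero, Ne, Module.length_eq_zero_iff]
    intro hsub
    have hWq : ¬ W ≤ J ⊔ Ideal.span {t} := by
      refine fun h ↦ hne fun w hw ↦ ?_
      obtain ⟨j, hj, u, hu, rfl⟩ := Submodule.mem_sup.1 (h hw)
      obtain ⟨c, rfl⟩ := Ideal.mem_span_singleton'.1 hu
      refine J.add_mem hj ?_
      rw [mul_comm]
      refine htW _ (hWt _ ?_)
      rw [mul_comm]
      simpa using W.sub_mem hw (hJW hj)
    obtain ⟨w, hw, hwq⟩ := SetLike.not_le_iff_exists.1 hWq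
    obtain ⟨r, hr, hrs⟩ := exists_mul_notMem_and_mul_mem hrad hwq
    apply hr
    have hmem : Submodule.Quotient.mk (r * w) ∈
        socle R (R ⧸ J ⊔ Ideal.span {t}) ⊓ LinearMap.ker f := by
      refine ⟨fun s hs ↦ ?_, ?_⟩
      · exact (Submodule.Quotient.mk_eq_zero _).2 (hrs s hs)
      · exact (Submodule.Quotient.mk_eq_zero _).2
          (Ideal.mem_sup_left (W.mul_mem_left _ hw))
    have := congrArg Subtype.val (hsub.elim ⟨_, hmem⟩ 0)
    exact (Submodule.Quotient.mk_eq_zero _).1 this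
  · intro x hx
    obtain ⟨a, rfl⟩ := Submodule.Quotient.mk_surjective _ x
    have ha : ∀ r ∈ maximalIdeal R, ∃ s, ∃ u ∈ W, r * a = t * s + u := by
      intro r hr
      have := (Submodule.Quotient.mk_eq_zero _).1 (hx r hr)
      obtain ⟨u, hu, v, hv, huv⟩ := Submodule.mem_sup.1 this
      obtain ⟨c, rfl⟩ := Ideal.mem_span_singleton'.1 hv
      have huv : u + c * t = r * a := huv
      exact ⟨c, u, hu, by rw [← huv]; ring⟩
    have key : ∀ τ ∈ b * b, ∃ a', τ * a - t * a' ∈ J ∧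
        ∀ r s u, u ∈ W → r * a = t * s + u → r * a' - τ * s ∈ J := by
      intro τ hτ
      refine Submodule.mul_induction_on hτ (fun y hy z hz ↦ ?_) fun τ τ' h h' ↦ ?_
      · obtain ⟨s', u', hu', h'⟩ := ha y (hbm hy)
        refine ⟨z * s', ?_, fun r s u hu h ↦ ?_⟩
        · rw [show y * z * a - t * (z * s') = z * u' by linear_combination z * h']
          exact hb z hz _ hu'
        · rw [show r * (z * s') - y * z * s = z * (r * s' - y * s) by ring]
          refine hb z hz _ (hWt _ ?_)
          rw [show t * (r * s' - y * s) = y * u - r * u' by linear_combination y * h - r * h']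
          exact W.sub_mem (W.mul_mem_left _ hu) (W.mul_mem_left _ hu')
      · obtain ⟨a₁, h1, h2⟩ := h
        obtain ⟨a₂, h3, h4⟩ := h'
        refine ⟨a₁ + a₂, ?_, fun r s u hu hh ↦ ?_⟩
        · rw [show (τ + τ') * a - t * (a₁ + a₂) = (τ * a - t * a₁) + (τ' * a - t * a₂) by ring]
          exact J.add_mem h1 h3
        · rw [show r * (a₁ + a₂) - (τ + τ') * s = (r * a₁ - τ * s) + (r * a₂ - τ' * s) by ring]
          exact J.add_mem (h2 r s u hu hh) (h4 r s u hu hh)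
    obtain ⟨a', h1, h2⟩ := key t ht
    refine ⟨Submodule.Quotient.mk a', fun r hr ↦ ?_, ?_⟩
    · obtain ⟨s, u, hu, h⟩ := ha r hr
      refine (Submodule.Quotient.mk_eq_zero _).2 ?_
      change r * a' ∈ _
      rw [show r * a' = (r * a' - t * s) + s * t by ring]
      exact Submodule.add_mem_sup (h2 r s u hu h) (Ideal.mem_span_singleton'.2 ⟨s, rfl⟩)
    · refine (Submodule.Quotient.eq _).2 (Ideal.mem_sup_left ?_)
      refine hWt _ ?_
      change t * (a' - a) ∈ W
      rw [← neg_mem_iff, show -(t * (a' - a)) = t * a - t * a' by ring]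
      exact hJW h1

end SocleLifting

section Asymptotics

open Finset

lemma choose_add_le_choose_add (n : ℕ) {k l : ℕ} (h : k ≤ l) :
    (n + k).choose k ≤ (n + l).choose l := by
  rw [Nat.choose_symm_add.symm, Nat.choose_symm_add.symm]
  exact Nat.choose_le_choose _ (by omega)

lemma le_of_forall_sum_choose_le {e : ℕ} {f : ℕ → ℤ} {A B : ℤ} {N : ℕ}
    (h : ∀ n ≥ N, ∑ i ∈ range (e + 2), (-1) ^ i * f i * ((n + (e + 1) - i).choose (e + 1 - i) : ℤ) ≤
      A * ((n + e + 1).choose (e + 1) : ℤ) + B * ((n + e).choose e : ℤ)) : f 0 ≤ A := by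
  by_contra! hA
  set F : ℤ := ∑ i ∈ range (e + 1), |f (i + 1)| with hF
  have key : ∀ n ≥ N, (n : ℤ) + e + 1 ≤ (e + 1) * (B + F) := by
    intro n hn
    have h1 := h n hn
    rw [sum_range_succ'] at h1
    have h2 : -(F * ((n + e).choose e : ℤ)) ≤ ∑ i ∈ range (e + 1),
        (-1) ^ (i + 1) * f (i + 1) * ((n + (e + 1) - (i + 1)).choose (e + 1 - (i + 1)) : ℤ) := by
      rw [hF, sum_mul, ← sum_neg_distrib]
      refine sum_le_sum fun i hi ↦ ?_
      have hi : i < e + 1 := mem_range.1 hi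
      have h3 : ((n + (e + 1) - (i + 1)).choose (e + 1 - (i + 1)) : ℤ) ≤ ((n + e).choose e : ℤ) := by
        have := choose_add_le_choose_add n (show e - i ≤ e by omega)
        rw [show n + (e + 1) - (i + 1) = n + (e - i) by omega,
          show e + 1 - (i + 1) = e - i by omega]
        exact_mod_cast this
      have h4 : -|f (i + 1)| ≤ (-1) ^ (i + 1) * f (i + 1) := by
        rcases neg_one_pow_eq_or ℤ (i + 1) with h | h <;> rw [h]
        · rw [one_mul]; exact neg_abs_le _
        · rw [neg_one_mul]; exact neg_le_neg (le_abs_self _)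
      calc -(|f (i + 1)| * ((n + e).choose e : ℤ))
          ≤ -(|f (i + 1)| * ((n + (e + 1) - (i + 1)).choose (e + 1 - (i + 1)) : ℤ)) :=
            neg_le_neg (mul_le_mul_of_nonneg_left h3 (abs_nonneg _))
        _ = -|f (i + 1)| * ((n + (e + 1) - (i + 1)).choose (e + 1 - (i + 1)) : ℤ) := by ring
        _ ≤ _ := mul_le_mul_of_nonneg_right h4 (by positivity)
    have h5 : ((n : ℤ) + e + 1) * ((n + e).choose e : ℤ) =
        ((n + e + 1).choose (e + 1) : ℤ) * (e + 1) := by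
      exact_mod_cast Nat.add_one_mul_choose_eq (n + e) e
    simp only [pow_zero, one_mul, Nat.sub_zero, ← add_assoc] at h1
    have h6 : ((n + e + 1).choose (e + 1) : ℤ) ≤ (f 0 - A) * ((n + e + 1).choose (e + 1) : ℤ) :=
      le_mul_of_one_le_left (by positivity) (by omega)
    have h7 : ((n + e + 1).choose (e + 1) : ℤ) ≤ (B + F) * ((n + e).choose e : ℤ) := by
      simp only [← add_assoc] at h2
      linarith
    have h8 : (0 : ℤ) < ((n + e).choose e : ℤ) := by exact_mod_cast Nat.choose_pos (by omega)
    refine le_of_mul_le_mul_right ?_ h8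
    rw [h5]
    calc _ ≤ (B + F) * ((n + e).choose e : ℤ) * (e + 1) :=
          mul_le_mul_of_nonneg_right h7 (by positivity)
      _ = _ := by ring
  have := key (N + ((e + 1) * (B + F)).toNat) (by omega)
  have h9 := Int.self_le_toNat ((e + 1) * (B + F))
  push_cast at this
  omega

/-- If the difference of two Hilbert functions is squeezed between `0` and the function
`A * C(n+e+1,e+1)` up to lower terms, then the first coefficients differ by at most `A`. -/
lemma sub_le_of_forall_sum_choose {e : ℕ} {a a' : ℕ → ℤ} {A B : ℤ} {N : ℕ}
    (h0 : ∀ n ≥ N, ∑ i ∈ range (e + 3), (-1) ^ i * a i * ((n + (e + 2) - i).choose (e + 2 - i) : ℤ) ≤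
      ∑ i ∈ range (e + 3), (-1) ^ i * a' i * ((n + (e + 2) - i).choose (e + 2 - i) : ℤ))
    (h : ∀ n ≥ N, ∑ i ∈ range (e + 3), (-1) ^ i * a' i * ((n + (e + 2) - i).choose (e + 2 - i) : ℤ) ≤
      ∑ i ∈ range (e + 3), (-1) ^ i * a i * ((n + (e + 2) - i).choose (e + 2 - i) : ℤ) +
      (A * ((n + e + 1).choose (e + 1) : ℤ) + B * ((n + e).choose e : ℤ))) :
    a 1 - a' 1 ≤ A := by
  have hsub : ∀ n : ℕ, ∑ i ∈ range (e + 3), (-1) ^ i * (a' i - a i) *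
        ((n + (e + 2) - i).choose (e + 2 - i) : ℤ) =
      ∑ i ∈ range (e + 3), (-1) ^ i * a' i * ((n + (e + 2) - i).choose (e + 2 - i) : ℤ) -
      ∑ i ∈ range (e + 3), (-1) ^ i * a i * ((n + (e + 2) - i).choose (e + 2 - i) : ℤ) := by
    intro n
    rw [← sum_sub_distrib]
    exact sum_congr rfl fun i _ ↦ by ring
  have h1 : a' 0 - a 0 ≤ 0 := by
    refine le_of_forall_sum_choose_le (e := e + 1) (f := fun i ↦ a' i - a i) (A := 0)
      (B := |A| + |B|) (N := N) fun n hn ↦ ?_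
    have := h n hn
    have h2 := hsub n
    have h3 : ((n + e).choose e : ℤ) ≤ ((n + (e + 1)).choose (e + 1) : ℤ) := by
      exact_mod_cast choose_add_le_choose_add n (Nat.le_succ e)
    have h4 : A * ((n + e + 1).choose (e + 1) : ℤ) ≤ |A| * ((n + (e + 1)).choose (e + 1) : ℤ) :=
      mul_le_mul_of_nonneg_right (le_abs_self _) (by positivity)
    have h5 : B * ((n + e).choose e : ℤ) ≤ |B| * ((n + (e + 1)).choose (e + 1) : ℤ) :=
      (mul_le_mul_of_nonneg_right (le_abs_self _) (by positivity)).trans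
        (mul_le_mul_of_nonneg_left h3 (abs_nonneg _))
    change ∑ i ∈ range (e + 3), (-1) ^ i * (a' i - a i) *
        ((n + (e + 2) - i).choose (e + 2 - i) : ℤ) ≤ _
    rw [h2]
    linarith
  have h1' : -(a' 0 - a 0) ≤ 0 := by
    refine le_of_forall_sum_choose_le (e := e + 1) (f := fun i ↦ -(a' i - a i)) (A := 0)
      (B := 0) (N := N) fun n hn ↦ ?_
    have := h0 n hn
    have h2 := hsub n
    change ∑ i ∈ range (e + 3), (-1) ^ i * (-(a' i - a i)) *
        ((n + (e + 2) - i).choose (e + 2 - i) : ℤ) ≤ _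
    simp only [mul_neg, neg_mul, sum_neg_distrib]
    rw [h2]
    linarith
  have h10 : a' 0 - a 0 = 0 := by omega
  have : -(a' 1 - a 1) ≤ A := by
    refine le_of_forall_sum_choose_le (e := e) (f := fun i ↦ -(a' (i + 1) - a (i + 1))) (A := A)
      (B := B) (N := N) fun n hn ↦ ?_
    have := h n hn
    have h2 := hsub n
    rw [sum_range_succ', h10] at h2
    have h3 : ∑ i ∈ range (e + 2), (-1) ^ (i + 1) * (a' (i + 1) - a (i + 1)) *
        ((n + (e + 2) - (i + 1)).choose (e + 2 - (i + 1)) : ℤ) =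
      ∑ i ∈ range (e + 2), (-1) ^ i * (-(a' (i + 1) - a (i + 1))) *
        ((n + (e + 1) - i).choose (e + 1 - i) : ℤ) := by
      refine sum_congr rfl fun i _ ↦ ?_
      rw [show n + (e + 2) - (i + 1) = n + (e + 1) - i by omega,
        show e + 2 - (i + 1) = e + 1 - i by omega]
      ring
    rw [h3] at h2
    linarith
  linarith

end Asymptotics

section LastEntry

lemma Fin.range_eq_union_last {α : Type*} {e : ℕ} (x : Fin (e + 1) → α) :
    Set.range x = Set.range (fun i : Fin e ↦ x i.castSucc) ∪ {x (Fin.last e)} := by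
  ext z
  constructor
  · rintro ⟨i, rfl⟩
    induction i using Fin.lastCases with
    | last => exact Or.inr rfl
    | cast i => exact Or.inl ⟨i, rfl⟩
  · rintro (⟨i, rfl⟩ | rfl)
    exacts [⟨_, rfl⟩, ⟨_, rfl⟩]

lemma Fin.image_lt_last {α : Type*} {e : ℕ} (x : Fin (e + 1) → α) :
    x '' {j | j < Fin.last e} = Set.range fun i : Fin e ↦ x i.castSucc := by
  ext z
  constructor
  · rintro ⟨i, hi, rfl⟩
    exact ⟨i.castPred hi.ne, by simp⟩
  · rintro ⟨i, rfl⟩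
    exact ⟨_, Fin.castSucc_lt_last i, rfl⟩

lemma span_range_eq_sup {R : Type*} [CommRing R] {e : ℕ} (x : Fin (e + 1) → R) :
    Ideal.span (Set.range x) =
      Ideal.span (Set.range fun i : Fin e ↦ x i.castSucc) ⊔ Ideal.span {x (Fin.last e)} := by
  rw [Fin.range_eq_union_last, Ideal.span_union]

end LastEntry

section Setup

variable {R : Type u} [CommRing R] [IsLocalRing R]

/-- The ideal of all elements killing the colon quotients of systems of parameters of `R/I`. -/
def colonKiller (I : Ideal R) (s : ℕ) : Ideal R where
  carrier := {z | KillsColons I s z}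
  add_mem' h h' y h1 h2 i c hc := by
    rw [add_mul]; exact add_mem (h y h1 h2 i c hc) (h' y h1 h2 i c hc)
  zero_mem' y h1 h2 i c hc := by rw [zero_mul]; exact zero_mem _
  smul_mem' r z h := h.mono_mul r

lemma mem_colonKiller {I : Ideal R} {s : ℕ} {z : R} : z ∈ colonKiller I s ↔ KillsColons I s z :=
  Iff.rfl

lemma bIdeal_eq_colonKiller [IsNoetherianRing R] (I : Ideal R) {s : ℕ}
    (hs : ringKrullDim (R ⧸ I) = s) :
    bIdeal R (R ⧸ (I • (⊤ : Submodule R R))) = colonKiller I s :=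
  Ideal.ext fun z ↦ mem_bIdeal_quotient_iff I hs z

/-- Each entry is a nonzerodivisor modulo the previous ones. -/
def IsRegSeq {n : ℕ} (x : Fin n → R) : Prop :=
  ∀ i c, x i * c ∈ Ideal.span (x '' {j | j < i}) → c ∈ Ideal.span (x '' {j | j < i})

lemma isRegSeq_of_colonElt_le [IsNoetherianRing R] {e : ℕ} {x : Fin (e + 1) → R}
    (hz : KillsColons (⊥ : Ideal R) (e + 1) (x (Fin.last e)))
    (hx : ∀ i, x i ∈ maximalIdeal R)
    (hrad : maximalIdeal R ≤ (Ideal.span (Set.range x)).radical)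
    (hW : colonElt (Ideal.span (Set.range fun i : Fin e ↦ x i.castSucc)) (x (Fin.last e)) ≤
      Ideal.span (Set.range fun i : Fin e ↦ x i.castSucc)) : IsRegSeq x := by
  set t := x (Fin.last e) with ht
  have hkill : ∀ i : Fin (e + 1), ∀ c, x i * c ∈ Ideal.span (x '' {j | j < i}) →
      t * c ∈ Ideal.span (x '' {j | j < i}) := fun i c hc ↦ by
    have := hz.of_fintype (Fintype.card_fin _) x hx (by rwa [bot_sup_eq]) (A := {j | j < i})
      (a := i) (by simp) (c := c) (by rwa [bot_sup_eq])
    rwa [bot_sup_eq] at this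
  have hsq : ∀ i : Fin (e + 1), ∀ c, t ^ 2 * c ∈ Ideal.span (x '' {j | j < i}) →
      t * c ∈ Ideal.span (x '' {j | j < i}) := fun i c hc ↦ by
    set y := Function.update x (Fin.last e) (t ^ 2) with hy
    have hyx : y '' {j | j < i} = x '' {j | j < i} := by
      refine Set.image_congr fun j hj ↦ Function.update_of_ne ?_ _ _
      exact (lt_of_lt_of_le hj (Fin.le_last i)).ne
    have hpow : ∀ j, ∃ n, y j = x j ^ n := by
      intro j
      by_cases hj : j = Fin.last e
      · subst hj; exact ⟨2, by simp [hy, ht]⟩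
      · exact ⟨1, by simp [hy, hj]⟩
    have hym : ∀ j, y j ∈ maximalIdeal R := by
      intro j
      by_cases hj : j = Fin.last e
      · subst hj; simpa [hy] using Ideal.pow_mem_of_mem _ (hx _) 2 (by norm_num)
      · simpa [hy, hj] using hx j
    have := hz.of_fintype (Fintype.card_fin _) y hym
      (by rw [bot_sup_eq]; exact maximalIdeal_le_radical_of_pow hrad hpow) (A := {j | j < i})
      (a := Fin.last e) (by simp [Fin.le_last]) (c := c) (by rwa [bot_sup_eq, hyx, hy, Function.update_self])
    rwa [bot_sup_eq, hyx] at this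
  have key : ∀ k ≤ e, ∀ i : Fin (e + 1), (i : ℕ) + k = e →
      colonElt (Ideal.span (x '' {j | j < i})) t ≤ Ideal.span (x '' {j | j < i}) := by
    intro k
    induction k with
    | zero =>
      intro _ i hi
      have : i = Fin.last e := Fin.ext (by simpa using hi)
      rwa [this, Fin.image_lt_last]
    | succ k ih =>
      intro hk i hi
      have hilt : (i : ℕ) + 1 < e + 1 := by omega
      have ih' := ih (by omega) ⟨i + 1, hilt⟩ (by simp; omega)
      have himg : x '' {j | j < ⟨i + 1, hilt⟩} = x '' {j | j < i} ∪ {x i} := by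
        rw [← Set.image_singleton, ← Set.image_union]
        congr 1
        ext j
        simp only [Set.mem_ofPred_eq, Set.mem_union, Set.mem_singleton_iff, Fin.lt_def, Fin.ext_iff]
        omega
      rw [himg, Ideal.span_union] at ih'
      refine Submodule.le_of_le_smul_of_le_jacobson_bot (IsNoetherian.noetherian _)
        (IsLocalRing.maximalIdeal_le_jacobson _) (I := maximalIdeal R) ?_
      intro c hc
      obtain ⟨a, ha, v, hv, rfl⟩ := Submodule.mem_sup.1 (ih' (Ideal.mem_sup_left hc))
      obtain ⟨r, rfl⟩ := Ideal.mem_span_singleton'.1 hv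
      refine Submodule.add_mem_sup ha ?_
      rw [mul_comm]
      refine Submodule.smul_mem_smul (hx i) ?_
      refine hsq i r ?_
      rw [sq, mul_assoc]
      refine hkill i _ ?_
      have := Ideal.sub_mem _ (mem_colonElt.1 hc) (Ideal.mul_mem_left _ t ha)
      rwa [show t * (a + r * x i) - t * a = x i * (t * r) by ring] at this
  exact fun i c hc ↦ key (e - i) (by omega) i (by omega) (hkill i c hc)

/-- The saturation of `J` with respect to the last parameter is killed into `J` by `b`. -/
lemma mul_mem_of_mem_colonElt {e : ℕ} {x : Fin (e + 1) → R}
    (hx : ∀ i, x i ∈ maximalIdeal R)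
    (hrad : maximalIdeal R ≤ (Ideal.span (Set.range x)).radical) {z : R}
    (hz : z ∈ colonKiller (⊥ : Ideal R) (e + 1)) {w : R}
    (hw : w ∈ colonElt (Ideal.span (Set.range fun i : Fin e ↦ x i.castSucc)) (x (Fin.last e))) :
    z * w ∈ Ideal.span (Set.range fun i : Fin e ↦ x i.castSucc) := by
  have := KillsColons.of_fintype hz (Fintype.card_fin _) x hx (by rwa [bot_sup_eq])
    (A := {j | j < Fin.last e}) (a := Fin.last e) (by simp) (c := w)
    (by rwa [bot_sup_eq, Fin.image_lt_last])
  rwa [bot_sup_eq, Fin.image_lt_last] at this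

/-- If `x` is not a regular sequence, the socles of `R/q^(n+1)` grow strictly slower than
`r * C(n+d-1, d-1)`, where `r` is the index of reducibility of `q`. -/
lemma exists_length_socle_le [IsNoetherianRing R] {e : ℕ} {x : Fin (e + 2) → R}
    (hx : ∀ i, x i ∈ maximalIdeal R)
    (hrad : maximalIdeal R ≤ (Ideal.span (Set.range x)).radical)
    (ht : x (Fin.last (e + 1)) ∈ colonKiller (⊥ : Ideal R) (e + 2) ^ 3)
    (htreg : ∀ c, x (Fin.last (e + 1)) * c = 0 → c = 0) (hreg : ¬ IsRegSeq x) {r : ℕ}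
    (hr : Module.length R (socle R (R ⧸ Ideal.span (Set.range x))) = r) :
    0 < r ∧ ∃ N B : ℕ, ∀ n ≥ N,
      Module.length R (socle R (R ⧸ Ideal.span (Set.range x) ^ (n + 1))) ≤
        ((n + e + 1).choose (e + 1) * (r - 1) + (n + e).choose e * B : ℕ) := by
  set b := colonKiller (⊥ : Ideal R) (e + 2)
  set t := x (Fin.last (e + 1)) with htdef
  have htb : t ∈ b := Ideal.pow_le_self (by norm_num) ht
  have htbb : t ∈ b * b := by
    rw [← sq]; exact Ideal.pow_le_pow_right (by norm_num) ht
  have hqr := KillsColons.quasiRegularPair (x := x) htb hx hrad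
  rw [← htdef] at hqr
  set y := fun i : Fin (e + 1) ↦ x i.castSucc
  set J := Ideal.span (Set.range y) with hJ
  set W := colonElt J t with hW
  have hspan : Ideal.span (Set.range x) = J ⊔ Ideal.span {t} := span_range_eq_sup x
  have hne : ¬ W ≤ J := fun h ↦ hreg (isRegSeq_of_colonElt_le htb hx hrad h)
  have hbW : ∀ z ∈ b, ∀ w ∈ W, z * w ∈ J := fun z hz w hw ↦
    mul_mem_of_mem_colonElt hx hrad hz hw
  have hbm : b ≤ maximalIdeal R := by
    refine le_maximalIdeal fun h ↦ hne fun w hw ↦ ?_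
    simpa using hbW 1 (h ▸ Submodule.mem_top) w hw
  rw [hspan] at hr hrad ⊢
  have h1 := length_socle_add_one_le (le_colonElt J t) (fun c hc ↦ hc) hqr.mem_of_mul_mem hbW hbm
    htbb hrad hne
  rw [hr] at h1
  have hfin : Module.length R (socle R (R ⧸ W ⊔ Ideal.span {t})) ≤ ((r - 1 : ℕ) : ℕ∞) := by
    have h2 : Module.length R (socle R (R ⧸ W ⊔ Ideal.span {t})) ≠ ⊤ := fun h ↦ by
      rw [h] at h1; simp at h1
    obtain ⟨l, hl⟩ := ENat.ne_top_iff_exists.1 h2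
    rw [← hl] at h1 ⊢
    have : l + 1 ≤ r := by exact_mod_cast h1
    exact_mod_cast (by omega : l ≤ r - 1)
  have hrpos : 0 < r := by
    have := le_add_self.trans h1
    exact_mod_cast this
  obtain ⟨B, hB⟩ : ∃ B : ℕ, Module.length R (R ⧸ J ⊔ Ideal.span {t}) = B := by
    have := (isFiniteLength_quotient_iff (J ⊔ Ideal.span {t})).2 hrad
    exact (ENat.ne_top_iff_exists.1 (Module.length_ne_top_iff.2 this)).imp fun _ h ↦ h.symm
  have htq : t ∈ J ⊔ Ideal.span {t} := Ideal.mem_sup_right (Ideal.mem_span_singleton_self t)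
  have hqm : J ⊔ Ideal.span {t} ≤ maximalIdeal R := by
    rw [← hspan, Ideal.span_le]; rintro _ ⟨i, rfl⟩; exact hx i
  obtain ⟨N, hN⟩ := exists_forall_modColon_pow_le htq htreg
  refine ⟨hrpos, N, B, fun n hn ↦ ?_⟩
  have h3 : socle R (R ⧸ (J ⊔ Ideal.span {t}) ^ (n + 1)) ≤
      Submodule.map (Submodule.mkQ _) ((J ⊔ Ideal.span {t}) ^ n : Ideal R) := by
    intro v hv
    obtain ⟨a, rfl⟩ := Submodule.mkQ_surjective _ v
    refine ⟨a, hN n hn a fun s hs ↦ ?_, rfl⟩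
    exact (Submodule.Quotient.mk_eq_zero _).1 (hv s (hqm hs))
  have h4 := hqr.length_socle_inf_pow_le (Fintype.card_fin (e + 1)) n
  rw [inf_eq_left.2 h3] at h4
  refine h4.trans ?_
  rw [hB]
  push_cast
  gcongr
  exact_mod_cast hfin

end Setup

section Saturation

variable {R : Type*} [CommRing R]

/-- The saturation `⋃ (J : t^n)`. -/
def saturation (J : Ideal R) (t : R) : Ideal R where
  carrier := {r | ∃ n, t ^ n * r ∈ J}
  add_mem' := by
    rintro r s ⟨n, hn⟩ ⟨k, hk⟩
    refine ⟨n + k, ?_⟩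
    rw [show t ^ (n + k) * (r + s) = t ^ k * (t ^ n * r) + t ^ n * (t ^ k * s) by ring]
    exact add_mem (J.mul_mem_left _ hn) (J.mul_mem_left _ hk)
  zero_mem' := ⟨0, by simp⟩
  smul_mem' := by
    rintro a r ⟨n, hn⟩
    refine ⟨n, ?_⟩
    rw [smul_eq_mul, show t ^ n * (a * r) = a * (t ^ n * r) by ring]
    exact J.mul_mem_left _ hn

lemma mem_saturation {J : Ideal R} {t r : R} : r ∈ saturation J t ↔ ∃ n, t ^ n * r ∈ J := Iff.rfl

lemma le_saturation (J : Ideal R) (t : R) : J ≤ saturation J t := fun r hr ↦ ⟨0, by simpa⟩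

lemma mem_saturation_of_mul_mem {J : Ideal R} {t r : R} (h : t * r ∈ saturation J t) :
    r ∈ saturation J t := by
  obtain ⟨n, hn⟩ := h
  exact ⟨n + 1, by rwa [pow_succ, mul_assoc]⟩

end Saturation

section DVR

lemma pow_three_le {R : Type u} [CommRing R] [IsLocalRing R] {b B w : Ideal R} {z : R} (hble : b ≤ Ideal.span {z} ⊔ B) (hbw : b * B ≤ w)
    (hbm : b ≤ maximalIdeal R) (hz : z ∈ b) :
    b ^ 3 ≤ Ideal.span {z ^ 3} ⊔ maximalIdeal R * w := by
  have hzm : Ideal.span {z} ≤ maximalIdeal R := (Ideal.span_singleton_le_iff_mem _).2 (hbm hz)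
  have h1 : b ≤ maximalIdeal R := hbm
  have h2 : b * b ≤ Ideal.span {z ^ 2} ⊔ w := by
    calc b * b ≤ b * (Ideal.span {z} ⊔ B) := Ideal.mul_mono_right hble
      _ = b * Ideal.span {z} ⊔ b * B := Ideal.mul_sup _ _ _
      _ ≤ (Ideal.span {z} ⊔ B) * Ideal.span {z} ⊔ w :=
        sup_le_sup (Ideal.mul_mono_left hble) hbw
      _ ≤ Ideal.span {z ^ 2} ⊔ w := by
        refine sup_le ?_ le_sup_right
        rw [Ideal.sup_mul, Ideal.span_singleton_mul_span_singleton, ← pow_two]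
        refine sup_le_sup_left ?_ _
        rw [mul_comm]
        exact (Ideal.mul_mono_left ((Ideal.span_singleton_le_iff_mem _).2 hz)).trans hbw
  calc b ^ 3 = b * (b * b) := by rw [pow_succ', pow_two]
    _ ≤ b * (Ideal.span {z ^ 2} ⊔ w) := Ideal.mul_mono_right h2
    _ = b * Ideal.span {z ^ 2} ⊔ b * w := Ideal.mul_sup _ _ _
    _ ≤ (Ideal.span {z} ⊔ B) * Ideal.span {z ^ 2} ⊔ maximalIdeal R * w :=
      sup_le_sup (Ideal.mul_mono_left hble) (Ideal.mul_mono_left hbm)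
    _ ≤ Ideal.span {z ^ 3} ⊔ maximalIdeal R * w := by
      refine sup_le ?_ le_sup_right
      rw [Ideal.sup_mul, Ideal.span_singleton_mul_span_singleton, ← pow_succ']
      refine sup_le_sup_left ?_ _
      rw [← Ideal.span_singleton_pow, pow_two, ← mul_assoc, mul_comm, mul_comm B]
      exact Ideal.mul_mono hzm
        ((Ideal.mul_mono_left ((Ideal.span_singleton_le_iff_mem _).2 hz)).trans hbw)

variable {R : Type u} [CommRing R] [IsLocalRing R] [IsNoetherianRing R]

lemma exists_isUnit_sub_mem {P : Ideal R} {y : R} (hm : maximalIdeal R ≤ Ideal.span {y} ⊔ P)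
    (hym : y ∈ maximalIdeal R) {z : R} (hz : z ∉ P) : ∃ k c, IsUnit c ∧ z - y ^ k * c ∈ P := by
  by_contra! hcon
  have key : ∀ k, ∃ c, z - y ^ k * c ∈ P := by
    intro k
    induction k with
    | zero => exact ⟨z, by simp⟩
    | succ k ih =>
      obtain ⟨c, hc⟩ := ih
      have hcm : c ∈ maximalIdeal R := by
        rw [mem_maximalIdeal]
        exact fun hu ↦ hcon k c hu hc
      obtain ⟨v, hv, p, hp, rfl⟩ := Submodule.mem_sup.1 (hm hcm)
      obtain ⟨c', rfl⟩ := Ideal.mem_span_singleton'.1 hv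
      refine ⟨c', ?_⟩
      rw [show z - y ^ (k + 1) * c' = (z - y ^ k * (c' * y + p)) + y ^ k * p by ring]
      exact P.add_mem hc (P.mul_mem_left _ hp)
  have h0 : (Submodule.Quotient.mk z : R ⧸ P) ∈
      (⨅ i : ℕ, maximalIdeal R ^ i • ⊤ : Submodule R (R ⧸ P)) := by
    rw [Submodule.mem_iInf]
    intro k
    obtain ⟨c, hc⟩ := key k
    rw [(Submodule.Quotient.eq P).2 hc, ← smul_eq_mul, Submodule.Quotient.mk_smul]
    exact Submodule.smul_mem_smul (Ideal.pow_mem_pow hym k) trivial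
  rw [Ideal.iInf_pow_smul_eq_bot_of_isLocalRing _ Ideal.IsPrime.ne_top'] at h0
  exact hz ((Submodule.Quotient.mk_eq_zero _).1 h0)

/-- If `R/P` is a discrete valuation ring and `b` multiplies `P` into `w`, an element of `b^3`
lying in `w` is not a minimal generator of `w`. -/
lemma mem_maximalIdeal_mul_of_mem_pow_three {P w b : Ideal R} (hwP : w ≤ P)
    (hbP : ∀ z ∈ b, ∀ r ∈ P, z * r ∈ w) (hbm : b ≤ maximalIdeal R) {y : R}
    (hm : maximalIdeal R ≤ Ideal.span {y} ⊔ P) (hym : y ∈ maximalIdeal R)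
    (hy : ∀ r, y * r ∈ P → r ∈ P) {t : R} (ht : t ∈ b ^ 3) (htw : t ∈ w) :
    t ∈ maximalIdeal R * w := by
  by_cases hb : b ≤ P
  · rw [pow_succ, pow_two, mul_assoc] at ht
    exact Ideal.mul_mono hbm (Ideal.mul_le.2 fun z hz r hr ↦ hbP z hz r (hb hr)) ht
  have hex : ∃ k, ∃ z ∈ b, ∃ c, IsUnit c ∧ z - y ^ k * c ∈ P := by
    obtain ⟨z, hz, hzP⟩ := SetLike.not_le_iff_exists.1 hb
    obtain ⟨k, c, hc, h⟩ := exists_isUnit_sub_mem hm hym hzP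
    exact ⟨k, z, hz, c, hc, h⟩
  classical
  obtain ⟨z, hz, c, hc, hzc⟩ := Nat.find_spec hex
  have hmin : ∀ k, (∃ z ∈ b, ∃ c, IsUnit c ∧ z - y ^ k * c ∈ P) → Nat.find hex ≤ k :=
    fun k hk ↦ Nat.find_min' hex hk
  set k := Nat.find hex
  have hyk : ∀ n r, y ^ n * r ∈ P → r ∈ P := by
    intro n
    induction n with
    | zero => intro r hr; simpa using hr
    | succ n ih => exact fun r hr ↦ ih r (hy _ (by rwa [← mul_assoc, ← pow_succ']))
  have hzr : ∀ r, z * r ∈ P → r ∈ P := by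
    intro r hr
    refine hyk k r ?_
    have h1 : c * (y ^ k * r) ∈ P := by
      rw [show c * (y ^ k * r) = z * r - (z - y ^ k * c) * r by ring]
      exact P.sub_mem hr (P.mul_mem_right _ hzc)
    exact (Ideal.unit_mul_mem_iff_mem P hc).1 h1
  have hble : b ≤ Ideal.span {z} ⊔ (b ⊓ P) := by
    intro z' hz'
    have h1 : ∃ g, z' - g * z ∈ P := by
      by_cases hzP' : z' ∈ P
      · exact ⟨0, by simpa⟩
      obtain ⟨k', c', hc', h⟩ := exists_isUnit_sub_mem hm hym hzP'
      have hle := hmin k' ⟨z', hz', c', hc', h⟩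
      obtain ⟨j, rfl⟩ := Nat.exists_eq_add_of_le hle
      obtain ⟨u, hu⟩ := hc.exists_right_inv
      refine ⟨y ^ j * c' * u, ?_⟩
      rw [show z' - y ^ j * c' * u * z = (z' - y ^ (k + j) * c') -
          y ^ j * c' * u * (z - y ^ k * c) - y ^ k * y ^ j * c' * (c * u - 1) by ring, hu]
      simpa using P.sub_mem h (P.mul_mem_left _ hzc)
    obtain ⟨g, hg⟩ := h1
    rw [show z' = g * z + (z' - g * z) by ring]
    exact Submodule.add_mem_sup (Ideal.mem_span_singleton'.2 ⟨g, rfl⟩)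
      ⟨b.sub_mem hz' (b.mul_mem_left _ hz), hg⟩
  have hbw : b * (b ⊓ P) ≤ w := Ideal.mul_le.2 fun z hz r hr ↦ hbP z hz r hr.2
  have hb3 := pow_three_le hble hbw hbm hz
  obtain ⟨v, hv, t', ht', rfl⟩ := Submodule.mem_sup.1 (hb3 ht)
  obtain ⟨g, rfl⟩ := Ideal.mem_span_singleton'.1 hv
  refine add_mem ?_ ht'
  have h1 : g * z ^ 3 ∈ w := by
    have h2 : t' ∈ w := Ideal.mul_le_right ht'
    exact (Ideal.add_mem_iff_left w h2).1 htw
  have hg : g ∈ P := by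
    refine hzr _ (hzr _ (hzr _ (hwP ?_)))
    rwa [show z * (z * (z * g)) = g * z ^ 3 by ring]
  rw [show g * z ^ 3 = z ^ 2 * (z * g) by ring]
  exact Ideal.mul_mem_mul (Ideal.pow_mem_of_mem _ (hbm hz) 2 (by norm_num)) (hbP z hz g hg)

end DVR

section ChernBound

variable {R : Type u} [CommRing R] [IsLocalRing R]

lemma mem_span_range_of_mul_mem {n : ℕ} {y : Fin n → R} {t : R}
    (h1 : KillsColons (Ideal.span {t}) n 1) (hy : ∀ i, y i ∈ maximalIdeal R)
    (hrad : maximalIdeal R ≤ (Ideal.span {t} ⊔ Ideal.span (Set.range y)).radical)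
    (htreg : ∀ c, t * c = 0 → c = 0) {c : R} (hc : t * c ∈ Ideal.span (Set.range y)) :
    c ∈ Ideal.span (Set.range y) := by
  have key : ∀ k ≤ n, ∀ c, t * c ∈ Ideal.span (y '' {j | (j : ℕ) < k}) →
      c ∈ Ideal.span (y '' {j | (j : ℕ) < k}) := by
    intro k
    induction k with
    | zero =>
      intro _ c hc
      simp only [Nat.not_lt_zero, Set.ofPred_false, Set.image_empty, Ideal.span_empty,
        Ideal.mem_bot] at hc ⊢
      exact htreg c hc
    | succ k ih =>
      intro hk c hc
      have himg : y '' {j | (j : ℕ) < k + 1} = y '' {j | (j : ℕ) < k} ∪ {y ⟨k, hk⟩} := by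
        rw [← Set.image_singleton, ← Set.image_union]
        congr 1
        ext j
        simp only [Set.mem_ofPred_eq, Set.mem_union, Set.mem_singleton_iff, Fin.ext_iff]
        omega
      rw [himg, Ideal.span_union] at hc ⊢
      obtain ⟨a, ha, v, hv, hav⟩ := Submodule.mem_sup.1 hc
      obtain ⟨s, rfl⟩ := Ideal.mem_span_singleton'.1 hv
      have h2 := h1 y hy hrad ⟨k, hk⟩ s (by
        have hset : {j : Fin n | j < ⟨k, hk⟩} = {j : Fin n | (j : ℕ) < k} := rfl
        rw [hset, show y ⟨k, hk⟩ * s = c * t - a by linear_combination hav]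
        exact sub_mem (Ideal.mem_sup_left (Ideal.mem_span_singleton'.2 ⟨c, rfl⟩))
          (Ideal.mem_sup_right ha))
      rw [one_mul] at h2
      obtain ⟨v', hv', a', ha', rfl⟩ := Submodule.mem_sup.1 h2
      obtain ⟨s', rfl⟩ := Ideal.mem_span_singleton'.1 hv'
      have h3 : c - s' * y ⟨k, hk⟩ ∈ Ideal.span (y '' {j | (j : ℕ) < k}) := by
        refine ih (by omega) _ ?_
        rw [show t * (c - s' * y ⟨k, hk⟩) = a + a' * y ⟨k, hk⟩ by linear_combination -hav]
        exact add_mem ha (Ideal.mul_mem_right _ _ ha')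
      rw [show c = (c - s' * y ⟨k, hk⟩) + s' * y ⟨k, hk⟩ by ring]
      exact Submodule.add_mem_sup h3 (Ideal.mem_span_singleton'.2 ⟨s', rfl⟩)
  have huniv : y '' {j | (j : ℕ) < n} = Set.range y := by
    rw [← Set.image_univ]; congr 1; ext j; simp
  rw [← huniv] at hc ⊢
  exact key n le_rfl c hc

variable [IsNoetherianRing R]

lemma notMem_maximalIdeal_mul_saturation {e : ℕ} {x : Fin (e + 2) → R}
    (hd : ringKrullDim R = (e + 2 : ℕ)) (hx : ∀ i, x i ∈ maximalIdeal R)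
    (hrad : maximalIdeal R ≤ (Ideal.span (Set.range x)).radical)
    (ht : KillsColons (⊥ : Ideal R) (e + 2) (x (Fin.last (e + 1)))) :
    x (Fin.last e).castSucc ∉ maximalIdeal R * saturation
      (Ideal.span (Set.range fun i : Fin (e + 1) ↦ x i.castSucc)) (x (Fin.last (e + 1))) := by
  intro hs
  set t := x (Fin.last (e + 1)) with htdef
  set s := x (Fin.last e).castSucc with hsdef
  set y := fun i : Fin e ↦ x i.castSucc.castSucc with hydef
  set Q := Ideal.span (Set.range y) with hQ
  set J := Ideal.span (Set.range fun i : Fin (e + 1) ↦ x i.castSucc) with hJ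
  have hJQ : J = Q ⊔ Ideal.span {s} := span_range_eq_sup (fun i : Fin (e + 1) ↦ x i.castSucc)
  set P := saturation J t with hP
  have hspan : Ideal.span (Set.range x) = J ⊔ Ideal.span {t} := span_range_eq_sup x
  have hsP : s ∈ P := Ideal.mul_le_right hs
  -- `t * P ^ n ≤ Q + (s ^ n)`
  have htkill : ∀ n ≠ 0, ∀ N ≠ 0, ∀ c, t ^ N * c ∈ Q ⊔ Ideal.span {s ^ n} →
      t * c ∈ Q ⊔ Ideal.span {s ^ n} := by
    intro n hn N hN c hc
    let v : Fin (e + 2) → R := Fin.snoc (α := fun _ ↦ R) (Fin.snoc (α := fun _ ↦ R) y (s ^ n)) (t ^ N)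
    have hv0 : ∀ i : Fin e, v i.castSucc.castSucc = y i := fun i ↦ by simp [v]
    have hv1 : v (Fin.last e).castSucc = s ^ n := by simp [v]
    have hv2 : v (Fin.last (e + 1)) = t ^ N := by simp [v]
    have hpow : ∀ j, ∃ n, n ≠ 0 ∧ v j = x j ^ n := by
      intro j
      induction j using Fin.lastCases with
      | last => exact ⟨N, hN, hv2⟩
      | cast j =>
        induction j using Fin.lastCases with
        | last => exact ⟨n, hn, hv1⟩
        | cast j => exact ⟨1, one_ne_zero, by rw [hv0, pow_one]⟩
    have himg : Ideal.span (v '' {j | j < Fin.last (e + 1)}) = Q ⊔ Ideal.span {s ^ n} := by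
      rw [Fin.image_lt_last, span_range_eq_sup, hv1]
      simp only [hv0, hQ]
    have := ht.of_fintype (Fintype.card_fin _) v
      (fun j ↦ by
        obtain ⟨k, hk, h⟩ := hpow j
        rw [h]; exact Ideal.pow_mem_of_mem _ (hx j) k (Nat.pos_of_ne_zero hk))
      (by
        rw [bot_sup_eq]
        exact maximalIdeal_le_radical_of_pow hrad fun j ↦ (hpow j).imp fun _ h ↦ h.2)
      (A := {j | j < Fin.last (e + 1)}) (a := Fin.last (e + 1)) (by simp) (c := c)
      (by rwa [bot_sup_eq, himg, hv2])
    rwa [bot_sup_eq, himg] at this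
  have hQs : ∀ n, ∀ c ∈ P ^ n, ∃ N, t ^ N * c ∈ Q ⊔ Ideal.span {s ^ n} := by
    intro n
    induction n with
    | zero => intro c _; exact ⟨0, Ideal.mem_sup_right (by simp)⟩
    | succ n ih =>
      have hmul : ∀ u ∈ Q ⊔ Ideal.span {s ^ n}, ∀ v ∈ Q ⊔ Ideal.span {s},
          u * v ∈ Q ⊔ Ideal.span {s ^ (n + 1)} := by
        intro u hu v hv
        refine (?_ : (Q ⊔ Ideal.span {s ^ n}) * (Q ⊔ Ideal.span {s}) ≤ _) (Ideal.mul_mem_mul hu hv)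
        rw [Ideal.mul_sup, Ideal.sup_mul (K := Ideal.span {s}),
          Ideal.span_singleton_mul_span_singleton, pow_succ]
        exact sup_le (Ideal.mul_le_right.trans le_sup_left)
          (sup_le_sup_right Ideal.mul_le_left _)
      intro c hc
      rw [pow_succ] at hc
      have hc' : c ∈ saturation (Q ⊔ Ideal.span {s ^ (n + 1)}) t := by
        refine (Ideal.mul_le.2 fun u hu v hv ↦ ?_ : P ^ n * P ≤ _) hc
        obtain ⟨N, hN⟩ := ih u hu
        obtain ⟨M, hM⟩ := hv
        rw [hJQ] at hM
        refine ⟨N + M, ?_⟩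
        rw [show t ^ (N + M) * (u * v) = (t ^ N * u) * (t ^ M * v) by ring]
        exact hmul _ hN _ hM
      exact hc'
  have htP : ∀ n ≠ 0, ∀ c ∈ P ^ n, t * c ∈ Q ⊔ Ideal.span {s ^ n} := by
    intro n hn c hc
    obtain ⟨N, hN⟩ := hQs n c hc
    refine htkill n hn (N + 1) (by omega) c ?_
    rw [pow_succ', mul_assoc]
    exact Ideal.mul_mem_left _ _ hN
  set S := saturation Q t with hS
  let A : ℕ →o Submodule R R :=
    { toFun := fun n ↦ colonElt (Ideal.span {t} * P ^ n ⊔ S) (s ^ n)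
      monotone' := by
        refine monotone_nat_of_le_succ fun n r hr ↦ ?_
        change s ^ (n + 1) * r ∈ Ideal.span {t} * P ^ (n + 1) ⊔ S
        rw [pow_succ' s, mul_assoc]
        refine (?_ : Ideal.span {s} * (Ideal.span {t} * P ^ n ⊔ S) ≤ _)
          (Ideal.mul_mem_mul (Ideal.mem_span_singleton_self s) (mem_colonElt.1 hr))
        rw [Ideal.mul_sup]
        refine sup_le_sup ?_ Ideal.mul_le_right
        rw [mul_left_comm, pow_succ']
        exact Ideal.mul_mono_right (Ideal.mul_mono_left
          ((Ideal.span_singleton_le_iff_mem _).2 hsP)) }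
  obtain ⟨n, hn⟩ := (monotone_stabilizes_iff_noetherian (R := R) (M := R)).2 inferInstance A
  have hPS : P ^ (n + 1) ≤ S := by
    refine Submodule.le_of_le_smul_of_le_jacobson_bot (IsNoetherian.noetherian _)
      (IsLocalRing.maximalIdeal_le_jacobson _) (I := maximalIdeal R) ?_
    intro p hp
    obtain ⟨q', hq', v, hv, hqv⟩ := Submodule.mem_sup.1 (htP (n + 1) (by omega) p hp)
    obtain ⟨r, rfl⟩ := Ideal.mem_span_singleton'.1 hv
    have hr : r ∈ A (n + 1) := by
      change s ^ (n + 1) * r ∈ Ideal.span {t} * P ^ (n + 1) ⊔ S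
      rw [show s ^ (n + 1) * r = t * p - q' by linear_combination hqv]
      exact sub_mem (Ideal.mem_sup_left
        (Ideal.mul_mem_mul (Ideal.mem_span_singleton_self t) hp))
        (Ideal.mem_sup_right (le_saturation Q t hq'))
    rw [← hn (n + 1) (by omega)] at hr
    obtain ⟨u, hu, g, hg, hug⟩ := Submodule.mem_sup.1 (mem_colonElt.1 hr)
    obtain ⟨p', hp', rfl⟩ := Ideal.mem_span_singleton_mul.1 hu
    have h1 : p - s * p' ∈ S := by
      refine mem_saturation_of_mul_mem (t := t) ?_
      rw [show t * (p - s * p') = q' + s * g by linear_combination (-hqv) - s * hug]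
      exact add_mem (le_saturation Q t hq') (Ideal.mul_mem_left _ _ hg)
    rw [show p = (p - s * p') + s * p' by ring]
    refine Submodule.add_mem_sup h1 ?_
    change s * p' ∈ maximalIdeal R * P ^ (n + 1)
    rw [pow_succ', ← mul_assoc]
    exact Ideal.mul_mem_mul hs hp'
  obtain ⟨k, hk⟩ := mem_saturation.1 (hPS (Ideal.pow_mem_pow hsP (n + 1)))
  have hlt := card_le_of_le_radical_span hd
    (Fin.snoc (α := fun _ ↦ R) y (s + t) : Fin (e + 1) → R)
    (fun i ↦ by
      induction i using Fin.lastCases with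
      | last => simpa using add_mem (hx _) (hx _)
      | cast i => simpa using hx _) ?_
  · rw [Fintype.card_fin] at hlt; omega
  · refine hrad.trans ?_
    have h2 : Ideal.span (Set.range (Fin.snoc (α := fun _ ↦ R) y (s + t) : Fin (e + 1) → R)) =
        Q ⊔ Ideal.span {s + t} := by
      rw [span_range_eq_sup]; simp [hQ]
    rw [h2, hspan, hJQ, Ideal.radical_le_radical_iff, Ideal.radical_eq_sInf]
    refine le_sInf fun p ⟨hp, hpp⟩ ↦ ?_
    have hQp : Q ≤ p := le_sup_left.trans hp
    have hst : s + t ∈ p := hp (Ideal.mem_sup_right (Ideal.mem_span_singleton_self _))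
    have hboth : s ∈ p ∧ t ∈ p := by
      rcases hpp.mem_or_mem (hQp hk) with h | h
      · have := hpp.mem_of_pow_mem _ h
        exact ⟨(p.add_mem_iff_left this).1 hst, this⟩
      · have := hpp.mem_of_pow_mem _ h
        exact ⟨this, (p.add_mem_iff_right this).1 hst⟩
    exact sup_le (sup_le hQp ((Ideal.span_singleton_le_iff_mem _).2 hboth.1))
      ((Ideal.span_singleton_le_iff_mem _).2 hboth.2)

end ChernBound

section ColonProduct

variable {R : Type u} [CommRing R] [IsLocalRing R] [IsNoetherianRing R]

lemma notMem_maximalIdeal_mul_span_compl {e : ℕ} {x : Fin (e + 2) → R}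
    (hd : ringKrullDim R = (e + 2 : ℕ)) (hx : ∀ i, x i ∈ maximalIdeal R)
    (hrad : maximalIdeal R ≤ (Ideal.span (Set.range x)).radical) {i : Fin (e + 2)}
    (hi : i ≠ Fin.last (e + 1)) :
    x (Fin.last (e + 1)) ∉ maximalIdeal R * Ideal.span (x '' {i}ᶜ) := by
  intro h
  set t := x (Fin.last (e + 1))
  have hle : Ideal.span (x '' {i}ᶜ) ≤ Ideal.span (x '' ({i}ᶜ ∩ {Fin.last (e + 1)}ᶜ)) := by
    refine Submodule.le_of_le_smul_of_le_jacobson_bot (IsNoetherian.noetherian _)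
        (IsLocalRing.maximalIdeal_le_jacobson _) (I := maximalIdeal R) (Ideal.span_le.2 ?_)
    rintro _ ⟨j, hj, rfl⟩
    by_cases hjl : j = Fin.last (e + 1)
    · subst hjl; exact Ideal.mem_sup_right h
    · exact Ideal.mem_sup_left (Ideal.subset_span ⟨j, ⟨hj, hjl⟩, rfl⟩)
  have hlt := card_le_of_le_radical_span hd (fun j : Fin (e + 1) ↦ x j.castSucc)
    (fun j ↦ hx _) ?_
  · rw [Fintype.card_fin] at hlt; omega
  · refine hrad.trans (Ideal.radical_mono (Ideal.span_le.2 ?_))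
    rw [← Fin.image_lt_last]
    rintro _ ⟨j, rfl⟩
    by_cases hjl : j = Fin.last (e + 1)
    · subst hjl
      refine Ideal.span_mono (Set.image_mono fun j hj ↦ ?_)
        (hle (Ideal.subset_span ⟨_, hi.symm, rfl⟩))
      exact Fin.lt_last_iff_ne_last.2 hj.2
    · exact Ideal.subset_span ⟨j, Fin.lt_last_iff_ne_last.2 hjl, rfl⟩

/-- Unless `x` is a regular sequence, `m (q : m) ≤ m q` for the ideal `q` generated by `x`. -/
lemma maximalIdeal_mul_modColon_le {e : ℕ} {x : Fin (e + 2) → R}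
    (hd : ringKrullDim R = (e + 2 : ℕ)) (hx : ∀ i, x i ∈ maximalIdeal R)
    (hrad : maximalIdeal R ≤ (Ideal.span (Set.range x)).radical)
    (ht : x (Fin.last (e + 1)) ∈ colonKiller (⊥ : Ideal R) (e + 2) ^ 3)
    (hs : x (Fin.last e).castSucc ∈
      colonKiller (Ideal.span {x (Fin.last (e + 1))}) (e + 1) ^ 3)
    (htreg : ∀ c, x (Fin.last (e + 1)) * c = 0 → c = 0) (hreg : ¬ IsRegSeq x) :
    maximalIdeal R * colonIdeal R (Ideal.span (Set.range x)) ≤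
      maximalIdeal R * Ideal.span (Set.range x) := by
  classical
  set t := x (Fin.last (e + 1)) with htdef
  set b := colonKiller (⊥ : Ideal R) (e + 2) with hb
  have htb : t ∈ b := Ideal.pow_le_self (by norm_num) ht
  set J := Ideal.span (Set.range fun i : Fin (e + 1) ↦ x i.castSucc) with hJ
  have hspan : Ideal.span (Set.range x) = J ⊔ Ideal.span {t} := span_range_eq_sup x
  have hne : ¬ colonElt J t ≤ J := fun h ↦ hreg (isRegSeq_of_colonElt_le htb hx hrad h)
  have hbm : b ≤ maximalIdeal R := by
    refine le_maximalIdeal fun h ↦ hne fun w hw ↦ ?_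
    simpa using mul_mem_of_mem_colonElt hx hrad (z := 1) (h.symm.le trivial) hw
  refine Ideal.mul_le.2 fun y hy a ha ↦ ?_
  by_contra hya
  have haq : ∀ s ∈ maximalIdeal R, s * a ∈ Ideal.span (Set.range x) := ha
  obtain ⟨u, hu⟩ := Ideal.mem_span_range_iff_exists_fun.1 (haq y hy)
  obtain ⟨i, hi⟩ : ∃ i, IsUnit (u i) := by
    by_contra! hcon
    refine hya ?_
    rw [← hu]
    exact sum_mem fun j _ ↦ Ideal.mul_mem_mul ((mem_maximalIdeal _).2 (hcon j))
      (Ideal.subset_span ⟨j, rfl⟩)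
  obtain ⟨v, hv⟩ := hi.exists_right_inv
  set w := Ideal.span (x '' {i}ᶜ) with hw
  set P := saturation w (x i) with hP
  have hxi : x i - v * (y * a) ∈ w := by
    rw [← hu, ← Finset.add_sum_erase _ _ (Finset.mem_univ i)]
    rw [show x i - v * (u i * x i + ∑ j ∈ Finset.univ.erase i, u j * x j) =
      x i - (u i * v) * x i - v * ∑ j ∈ Finset.univ.erase i, u j * x j by ring, hv, one_mul,
      sub_self, zero_sub, neg_mem_iff]
    refine w.mul_mem_left _ (sum_mem fun j hj ↦ w.mul_mem_left _ (Ideal.subset_span ⟨j, ?_, rfl⟩))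
    exact Finset.ne_of_mem_erase hj
  have hq : Ideal.span (Set.range x) ≤ Ideal.span {y * a} ⊔ w := by
    rw [Ideal.span_le]
    rintro _ ⟨j, rfl⟩
    by_cases hj : j = i
    · subst hj
      rw [show x j = v * (y * a) + (x j - v * (y * a)) by ring]
      exact Submodule.add_mem_sup (Ideal.mem_span_singleton'.2 ⟨v, rfl⟩) hxi
    · exact Ideal.mem_sup_right (Ideal.subset_span ⟨j, hj, rfl⟩)
  have hmP : maximalIdeal R ≤ Ideal.span {y} ⊔ P := by
    intro s hs
    obtain ⟨c', hc', w', hw', hcw⟩ := Submodule.mem_sup.1 (hq (haq s hs))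
    obtain ⟨c, rfl⟩ := Ideal.mem_span_singleton'.1 hc'
    rw [show s = c * y + (s - c * y) by ring]
    refine Submodule.add_mem_sup (Ideal.mem_span_singleton'.2 ⟨c, rfl⟩) ⟨1, ?_⟩
    rw [show x i ^ 1 * (s - c * y) = (x i - v * (y * a)) * (s - c * y) + v * y * w' by
      linear_combination (-v * y) * hcw]
    exact w.add_mem (w.mul_mem_right _ hxi) (w.mul_mem_left _ hw')
  have hyP : ∀ r, y * r ∈ P → r ∈ P := by
    rintro r ⟨n, hn⟩
    refine ⟨n + 1, ?_⟩
    rw [show x i ^ (n + 1) * r = x i ^ n * r * (x i - v * (y * a)) +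
      v * a * (x i ^ n * (y * r)) by ring]
    exact w.add_mem (w.mul_mem_left _ hxi) (w.mul_mem_left _ hn)
  have hbP : ∀ z ∈ b, ∀ r ∈ P, z * r ∈ w := by
    rintro z hz r ⟨n, hn⟩
    set x' := Function.update x i (x i ^ (n + 1)) with hx'
    have hpow : ∀ j, ∃ k, k ≠ 0 ∧ x' j = x j ^ k := by
      intro j
      by_cases hj : j = i
      · subst hj; exact ⟨n + 1, by omega, by simp [hx']⟩
      · exact ⟨1, one_ne_zero, by simp [hx', hj]⟩
    have himg : x' '' {i}ᶜ = x '' {i}ᶜ :=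
      Set.image_congr fun j hj ↦ Function.update_of_ne hj _ _
    have := KillsColons.of_fintype hz (Fintype.card_fin _) x'
      (fun j ↦ by
        obtain ⟨k, hk, h⟩ := hpow j
        rw [h]; exact Ideal.pow_mem_of_mem _ (hx j) k (Nat.pos_of_ne_zero hk))
      (by
        rw [bot_sup_eq]
        exact maximalIdeal_le_radical_of_pow hrad fun j ↦ (hpow j).imp fun _ h ↦ h.2)
      (A := {i}ᶜ) (a := i) (by simp) (c := r)
      (by
        rw [bot_sup_eq, himg, hx', Function.update_self, pow_succ', mul_assoc]
        exact w.mul_mem_left _ hn)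
    rwa [bot_sup_eq, himg] at this
  by_cases hil : i = Fin.last (e + 1)
  · have hset : x '' {i}ᶜ = Set.range fun i : Fin (e + 1) ↦ x i.castSucc := by
      rw [← Fin.image_lt_last, hil]
      congr 1
      ext j
      exact Fin.lt_last_iff_ne_last.symm
    have hwJ : w = J := by rw [hw, hset]
    have hPJ : P = saturation J t := by rw [hP, hwJ, hil]
    have hrad' : maximalIdeal R ≤ (Ideal.span {t} ⊔ J).radical := by rwa [sup_comm, ← hspan]
    have hb'm : colonKiller (Ideal.span {t}) (e + 1) ≤ maximalIdeal R := by
      refine le_maximalIdeal fun h ↦ hne fun c hc ↦ ?_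
      exact mem_span_range_of_mul_mem (mem_colonKiller.1 (h ▸ Submodule.mem_top))
        (fun j ↦ hx _) hrad' htreg hc
    refine notMem_maximalIdeal_mul_saturation hd hx hrad htb ?_
    rw [← htdef, ← hJ, ← hPJ]
    refine mem_maximalIdeal_mul_of_mem_pow_three le_rfl (fun z _ r hr ↦ P.mul_mem_left z hr)
      le_rfl hmP hy hyP (Ideal.pow_right_mono hb'm 3 hs) ?_
    rw [hPJ]
    exact le_saturation J t (Ideal.subset_span ⟨Fin.last e, rfl⟩)
  · exact notMem_maximalIdeal_mul_span_compl hd hx hrad hil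
      (mem_maximalIdeal_mul_of_mem_pow_three (le_saturation w (x i)) hbP hbm hmP hy hyP ht
        (Ideal.subset_span ⟨_, fun h ↦ hil h.symm, rfl⟩))

end ColonProduct

section Lengths

variable {R : Type u} [CommRing R]

lemma moduleLength_quotient_smul_top (I : Ideal R) :
    moduleLength R (R ⧸ (I • (⊤ : Submodule R R))) = (Module.length R (R ⧸ I) : WithBot ℕ∞) := by
  have : I • (⊤ : Submodule R R) = I := by rw [smul_eq_mul, Ideal.mul_top]
  rw [moduleLength, ← Module.coe_length, this]

lemma length_quotient_eq_add {K L : Ideal R} (h : K ≤ L) :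
    Module.length R (R ⧸ K) =
      Module.length R ↥(Submodule.map (Submodule.mkQ K) L) + Module.length R (R ⧸ L) := by
  rw [Module.length_eq_add_of_exact (Submodule.map (Submodule.mkQ K) L).subtype
    (Submodule.mkQ (Submodule.map (Submodule.mkQ K) L)) (Submodule.subtype_injective _)
    (Submodule.mkQ_surjective _) (LinearMap.exact_subtype_mkQ _),
    (Submodule.quotientQuotientEquivQuotient K L h).length_eq]

lemma length_quotient_anti {K L : Ideal R} (h : K ≤ L) :
    Module.length R (R ⧸ L) ≤ Module.length R (R ⧸ K) := by
  rw [length_quotient_eq_add h]; exact le_add_self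

lemma le_of_mul_le_mul_pow {I q m : Ideal R} (h : m * I ≤ m * q) (n : ℕ) :
    m * I ^ n ≤ m * q ^ n := by
  induction n with
  | zero => simp
  | succ n ih =>
    calc m * I ^ (n + 1) = I * (m * I ^ n) := by rw [pow_succ]; ring
      _ ≤ I * (m * q ^ n) := Ideal.mul_mono_right ih
      _ = (m * I) * q ^ n := by ring
      _ ≤ (m * q) * q ^ n := Ideal.mul_mono_left h
      _ = m * q ^ (n + 1) := by rw [pow_succ]; ring

lemma Fin.image_lt_penultimate {α : Type*} {e : ℕ} (x : Fin (e + 2) → α) :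
    x '' {j | (Fin.last e).castSucc < j} = {x (Fin.last (e + 1))} := by
  rw [← Set.image_singleton]
  congr 1
  ext j
  simp only [Set.mem_ofPred_eq, Set.mem_singleton_iff, Fin.lt_def, Fin.ext_iff, Fin.val_castSucc,
    Fin.val_last]
  omega

end Lengths

section NotCM

variable {R : Type u} [CommRing R] [IsLocalRing R]

lemma le_colonIdeal (q : Ideal R) : q ≤ colonIdeal R q := fun _ h _ _ ↦ q.mul_mem_left _ h

variable [IsNoetherianRing R]

lemma IsCParamIdeal.exists_fin {e : ℕ} (hd : ringKrullDim R = (e + 2 : ℕ)) {q : Ideal R}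
    (hq : IsCParamIdeal R q) : ∃ x : Fin (e + 2) → R, q = Ideal.span (Set.range x) ∧
      (∀ i, x i ∈ maximalIdeal R) ∧ maximalIdeal R ≤ (Ideal.span (Set.range x)).radical ∧
      x (Fin.last (e + 1)) ∈ colonKiller (⊥ : Ideal R) (e + 2) ^ 3 ∧
      x (Fin.last e).castSucc ∈
        colonKiller (Ideal.span {x (Fin.last (e + 1))}) (e + 1) ^ 3 := by
  obtain ⟨s, x, ⟨hx, hC⟩, rfl⟩ := hq
  obtain ⟨hs, hxm, hrad⟩ := (isSOP_iff x).1 hx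
  obtain rfl : s = e + 2 := by
    rw [hs] at hd
    exact_mod_cast hd
  refine ⟨x, rfl, hxm, hrad, ?_, ?_⟩
  · have h := hC (Fin.last (e + 1))
    have hempty : x '' {j | Fin.last (e + 1) < j} = ∅ := by
      rw [Set.image_eq_empty, Set.eq_empty_iff_forall_notMem]
      exact fun j hj ↦ absurd hj (Fin.le_last j).not_gt
    rw [hempty, Ideal.span_empty, bIdeal_eq_colonKiller (s := e + 2)] at h
    · exact h
    · rw [ringKrullDim_eq_of_ringEquiv (RingEquiv.quotientBot R), hd]
  · have h := hC (Fin.last e).castSucc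
    rw [Fin.image_lt_penultimate, bIdeal_eq_colonKiller (s := e + 1)] at h
    · exact h
    · have h2 := ringKrullDim_quotient_eq_of_isSOP (a := e + 1) (b := 1) hd
        (Fintype.card_fin _) (Fintype.card_unit) (fun i : Fin (e + 1) ↦ x i.castSucc)
        (fun _ : Unit ↦ x (Fin.last (e + 1))) (fun i ↦ hxm _) (fun i ↦ hxm _)
        (by rwa [Set.range_const, sup_comm, ← span_range_eq_sup])
      rwa [Set.range_const] at h2

lemma isRegSeq_of_le_irrCoeff {e : ℕ} {x : Fin (e + 2) → R}
    (hx : ∀ i, x i ∈ maximalIdeal R)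
    (hrad : maximalIdeal R ≤ (Ideal.span (Set.range x)).radical)
    (ht : x (Fin.last (e + 1)) ∈ colonKiller (⊥ : Ideal R) (e + 2) ^ 3)
    (htreg : ∀ c, x (Fin.last (e + 1)) * c = 0 → c = 0) {r : ℕ}
    (hr : irMod R R (Ideal.span (Set.range x)) = r) {f : ℕ → ℤ}
    (hf : IsIrrCoeff R (Ideal.span (Set.range x)) (e + 2) f) (hle : (r : ℤ) ≤ f 0) :
    IsRegSeq x := by
  by_contra hreg
  rw [irMod_eq] at hr
  obtain ⟨hr0, N, B, h⟩ := exists_length_socle_le hx hrad ht htreg hreg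
    (by exact_mod_cast hr)
  obtain ⟨N', hN'⟩ := hf
  have := le_of_forall_sum_choose_le (e := e) (f := f) (A := (r - 1 : ℕ)) (B := B)
    (N := max N N') fun n hn ↦ ?_
  · omega
  · obtain ⟨L, hL, hL'⟩ := hN' n ((le_max_right _ _).trans hn)
    have h1 := h n ((le_max_left _ _).trans hn)
    rw [irMod_eq] at hL
    have hL : Module.length R (socle R (R ⧸ Ideal.span (Set.range x) ^ (n + 1))) = L := by
      exact_mod_cast hL
    rw [hL] at h1
    have h1 : L ≤ (n + e + 1).choose (e + 1) * (r - 1) + (n + e).choose e * B := by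
      exact_mod_cast h1
    have h2 : (L : ℤ) ≤ ((n + e + 1).choose (e + 1) : ℤ) * (r - 1 : ℕ) +
      ((n + e).choose e : ℤ) * B := by exact_mod_cast h1
    have h3 : (L : ℤ) = ∑ i ∈ Finset.range (e + 2), (-1) ^ i * f i *
        ((n + (e + 1) - i).choose (e + 1 - i) : ℤ) := hL'
    rw [← h3]
    linarith

lemma isRegSeq_of_le_hilbCoeff {e : ℕ} {x : Fin (e + 2) → R}
    (hd : ringKrullDim R = (e + 2 : ℕ)) (hx : ∀ i, x i ∈ maximalIdeal R)
    (hrad : maximalIdeal R ≤ (Ideal.span (Set.range x)).radical)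
    (ht : x (Fin.last (e + 1)) ∈ colonKiller (⊥ : Ideal R) (e + 2) ^ 3)
    (hs : x (Fin.last e).castSucc ∈
      colonKiller (Ideal.span {x (Fin.last (e + 1))}) (e + 1) ^ 3)
    (htreg : ∀ c, x (Fin.last (e + 1)) * c = 0 → c = 0) {r : ℕ}
    (hr : irMod R R (Ideal.span (Set.range x)) = r) {a a' : ℕ → ℤ}
    (ha : IsHilbCoeff R (colonIdeal R (Ideal.span (Set.range x))) (e + 2) a)
    (ha' : IsHilbCoeff R (Ideal.span (Set.range x)) (e + 2) a')
    (hle : (r : ℤ) ≤ a 1 - a' 1) : IsRegSeq x := by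
  by_contra hreg
  have hmI := maximalIdeal_mul_modColon_le hd hx hrad ht hs htreg hreg
  set q := Ideal.span (Set.range x)
  set I := colonIdeal R q
  have hqI : q ≤ I := le_colonIdeal q
  rw [irMod_eq] at hr
  obtain ⟨hr0, N, B, h⟩ := exists_length_socle_le hx hrad ht htreg hreg
    (by exact_mod_cast hr)
  obtain ⟨N₁, hN₁⟩ := ha
  obtain ⟨N₂, hN₂⟩ := ha'
  have key : ∀ n ≥ max N (max N₁ N₂), ∃ L L' : ℕ,
      (L : ℤ) = ∑ i ∈ Finset.range (e + 3), (-1) ^ i * a i *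
        ((n + (e + 2) - i).choose (e + 2 - i) : ℤ) ∧
      (L' : ℤ) = ∑ i ∈ Finset.range (e + 3), (-1) ^ i * a' i *
        ((n + (e + 2) - i).choose (e + 2 - i) : ℤ) ∧ L ≤ L' ∧
      L' ≤ L + ((n + e + 1).choose (e + 1) * (r - 1) + (n + e).choose e * B) := by
    intro n hn
    simp only [ge_iff_le, sup_le_iff] at hn
    obtain ⟨L, hL, hL'⟩ := hN₁ n hn.2.1
    obtain ⟨M, hM, hM'⟩ := hN₂ n hn.2.2
    refine ⟨L, M, hL', hM', ?_, ?_⟩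
    all_goals
      rw [moduleLength_quotient_smul_top] at hL hM
      have hL : Module.length R (R ⧸ I ^ (n + 1)) = L := by exact_mod_cast hL
      have hM : Module.length R (R ⧸ q ^ (n + 1)) = M := by exact_mod_cast hM
    · have := length_quotient_anti (Ideal.pow_right_mono hqI (n + 1))
      rw [hL, hM] at this
      exact_mod_cast this
    · have h1 := length_quotient_eq_add (Ideal.pow_right_mono hqI (n + 1))
      have h2 : Submodule.map (Submodule.mkQ (q ^ (n + 1))) (I ^ (n + 1) : Ideal R) ≤
          socle R (R ⧸ q ^ (n + 1)) := by
        rintro _ ⟨c, hc, rfl⟩ s hs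
        refine (Submodule.Quotient.mk_eq_zero _).2 ?_
        exact Ideal.mul_le_right (le_of_mul_le_mul_pow hmI (n + 1) (Ideal.mul_mem_mul hs hc))
      have h3 := (length_le_of_le h2).trans (h n hn.1)
      rw [hL, hM] at h1
      have h4 : (M : ℕ∞) ≤ ((n + e + 1).choose (e + 1) * (r - 1) + (n + e).choose e * B : ℕ) + L := by
        rw [h1]; gcongr
      rw [add_comm]
      exact_mod_cast h4
  have := sub_le_of_forall_sum_choose (e := e) (a := a) (a' := a') (A := (r - 1 : ℕ)) (B := B)
    (N := max N (max N₁ N₂)) (fun n hn ↦ ?_) fun n hn ↦ ?_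
  · omega
  · obtain ⟨L, L', h1, h2, h3, h4⟩ := key n hn
    rw [← h1, ← h2]; exact_mod_cast h3
  · obtain ⟨L, L', h1, h2, h3, h4⟩ := key n hn
    rw [← h1, ← h2]
    have h4 : (L' : ℤ) ≤ L + (((n + e + 1).choose (e + 1) : ℤ) * (r - 1 : ℕ) +
      ((n + e).choose e : ℤ) * B) := by exact_mod_cast h4
    linarith

end NotCM

section AdicNoetherian

variable {R : Type u} [CommRing R] {A : Type u} [CommRing A]

/-- The ring homomorphism from an adic completion of `A` to `R ⧸ J ^ n` induced by `φ : A →+* R`. -/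
noncomputable def adicCompletionToQuotient (φ : A →+* R) (I : Ideal A) (J : Ideal R)
    (h : I ≤ J.comap φ) (n : ℕ) : AdicCompletion I A →+* R ⧸ J ^ n :=
  (Ideal.quotientMap (J ^ n) φ ((Ideal.pow_right_mono h n).trans (Ideal.le_comap_pow φ n))).comp
    (AdicCompletion.evalₐ I n : AdicCompletion I A →+* A ⧸ I ^ n)

lemma factorPow_comp_adicCompletionToQuotient (φ : A →+* R) (I : Ideal A) (J : Ideal R)
    (h : I ≤ J.comap φ) {m n : ℕ} (hle : m ≤ n) :
    (Ideal.Quotient.factorPow J hle).comp (adicCompletionToQuotient φ I J h n) =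
      adicCompletionToQuotient φ I J h m := by
  ext x
  induction x using AdicCompletion.induction_on with | _ x =>
  have h2 := congrArg (Ideal.quotientMap (J ^ m) φ
    ((Ideal.pow_right_mono h m).trans (Ideal.le_comap_pow φ m)))
    (AdicCompletion.Ideal.mk_eq_mk I hle x)
  simpa [adicCompletionToQuotient] using h2

/-- The map on adic completions of rings induced by a ring homomorphism. -/
noncomputable def adicCompletionMapRingHom (φ : A →+* R) (I : Ideal A) (J : Ideal R)
    (h : I ≤ J.comap φ) : AdicCompletion I A →+* AdicCompletion J R :=
  AdicCompletion.liftRingHom J (adicCompletionToQuotient φ I J h)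
    (factorPow_comp_adicCompletionToQuotient φ I J h)

lemma adicCompletionMapRingHom_algebraMap (φ : A →+* R) (I : Ideal A) (J : Ideal R)
    (h : I ≤ J.comap φ) (a : A) : adicCompletionMapRingHom φ I J h (algebraMap _ _ a) =
      algebraMap R (AdicCompletion J R) (φ a) := by
  apply AdicCompletion.ext_evalₐ
  intro n
  have h2 := AdicCompletion.evalₐ_liftRingHom J (adicCompletionToQuotient φ I J h)
    (factorPow_comp_adicCompletionToQuotient φ I J h) n (algebraMap _ _ a)
  refine h2.trans ?_
  simp [adicCompletionToQuotient]

theorem isNoetherianRing_adicCompletion [IsNoetherianRing R] (J : Ideal R) :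
    IsNoetherianRing (AdicCompletion J R) := by
  obtain ⟨n, g, hg⟩ := Submodule.fg_iff_exists_fin_generating_family.1 (IsNoetherian.noetherian J)
  let I := MvPolynomial.idealOfVars (Fin n) R
  have hI : I.FG := IsNoetherian.noetherian _
  let φ : MvPolynomial (Fin n) R →+* R := (MvPolynomial.aeval g).toRingHom
  have hφ : I.map φ = J := by
    change Ideal.map φ (Ideal.span (Set.range MvPolynomial.X)) = J
    rw [Ideal.map_span, ← Set.range_comp, ← hg]
    congr 2
    ext i
    simp [φ]
  have : IsNoetherianRing (AdicCompletion I (MvPolynomial (Fin n) R)) :=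
    isNoetherianRing_of_ringEquiv (MvPowerSeries (Fin n) R)
      (MvPowerSeries.toAdicCompletionAlgEquiv (Fin n) R).toRingEquiv
  have hIJ := Ideal.map_le_iff_le_comap.1 hφ.le
  let F := adicCompletionMapRingHom φ I J hIJ
  let I' := I.map (algebraMap _ (AdicCompletion I (MvPolynomial (Fin n) R)))
  have hI' : I'.map F = J.map (algebraMap R (AdicCompletion J R)) := by
    have h2 := Ideal.map_map (I := I) φ (algebraMap R (AdicCompletion J R))
    rw [hφ] at h2
    rw [h2, Ideal.map_map]
    exact congrArg (Ideal.map · I) (RingHom.ext fun a ↦ adicCompletionMapRingHom_algebraMap φ I J hIJ a)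
  have := AdicCompletion.isAdicComplete_self I hI
  have hH : IsHausdorff (I'.map F) (AdicCompletion J R) := by
    rw [hI']
    exact (AdicCompletion.isAdicComplete_self J (IsNoetherian.noetherian J)).toIsHausdorff
  refine isNoetherianRing_of_surjective _ _ F
    (surjective_of_mk_map_comp_surjective (I := I') F (h := fun y ↦ ?_) (haus := hH))
  obtain ⟨y, rfl⟩ := Ideal.Quotient.mk_surjective y
  obtain ⟨r, hr⟩ := Ideal.Quotient.mk_surjective (AdicCompletion.evalOneₐ J y)
  refine ⟨algebraMap (MvPolynomial (Fin n) R) _ (MvPolynomial.C r), ?_⟩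
  change Ideal.Quotient.mk _ (F _) = _
  rw [adicCompletionMapRingHom_algebraMap, Ideal.Quotient.eq, hI',
    ← AdicCompletion.ker_evalOneₐ_eq_map J (IsNoetherian.noetherian J)]
  have : φ (MvPolynomial.C r) = r := by simp [φ]
  rw [this, RingHom.mem_ker, map_sub, sub_eq_zero]
  exact ((AdicCompletion.evalOneₐ J).commutes r).trans hr

end AdicNoetherian

section Unmixed

variable {R : Type u} [CommRing R] [IsLocalRing R] [IsNoetherianRing R]

theorem ringKrullDim_le_ringKrullDim_adicCompletion :
    ringKrullDim R ≤ ringKrullDim (AdicCompletion (maximalIdeal R) R) := by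
  have := isNoetherianRing_adicCompletion (maximalIdeal R)
  have : Module.Flat R (AdicCompletion (maximalIdeal R) R) := AdicCompletion.flat_of_isNoetherian _
  have : Algebra.HasGoingDown R (AdicCompletion (maximalIdeal R) R) := Algebra.HasGoingDown.of_flat
  have : (maximalIdeal (AdicCompletion (maximalIdeal R) R)).LiesOver (maximalIdeal R) :=
    ⟨(IsLocalRing.maximalIdeal_comap (algebraMap R (AdicCompletion (maximalIdeal R) R))).symm⟩
  rw [← IsLocalRing.maximalIdeal_height_eq_ringKrullDim,
    ← IsLocalRing.maximalIdeal_height_eq_ringKrullDim,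
    Ideal.height_eq_height_add_of_liesOver_of_hasGoingDown (maximalIdeal R)
      (maximalIdeal (AdicCompletion (maximalIdeal R) R))]
  exact_mod_cast le_self_add

theorem eq_zero_of_isUnmixedRing_of_mul_eq_zero (hum : IsUnmixedRing R) {e : ℕ}
    (hd : ringKrullDim R = (e + 1 : ℕ)) {x : Fin (e + 1) → R} (hx : ∀ i, x i ∈ maximalIdeal R)
    (hrad : maximalIdeal R ≤ (Ideal.span (Set.range x)).radical) {c : R}
    (hc : x (Fin.last e) * c = 0) : c = 0 := by
  have := isNoetherianRing_adicCompletion (maximalIdeal R)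
  set S := AdicCompletion (maximalIdeal R) R
  let g := algebraMap R S
  have hmap : maximalIdeal S = (maximalIdeal R).map g := AdicCompletion.maximalIdeal_eq_map
  have hg : Function.Injective g := fun a b h ↦ (AdicCompletion.of_inj (I := maximalIdeal R) (M := R)).1 h
  by_contra h0
  have hg0 : g c ≠ 0 := fun h ↦ h0 (hg (h.trans (map_zero g).symm))
  obtain ⟨P, hP, hle⟩ := exists_le_isAssociatedPrime_of_isNoetherianRing S (g c) hg0
  have hxP : g (x (Fin.last e)) ∈ P := hle (by
    rw [Submodule.mem_colon_singleton]
    change g _ * g c = 0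
    rw [← map_mul, hc, map_zero])
  have hPp : P.IsPrime := hP.isPrime
  have h1 := ringKrullDim_quotient_le_card (R := S) (I := P)
    (IsLocalRing.le_maximalIdeal hPp.ne_top)
    (fun i : Fin e ↦ g (x i.castSucc)) (fun i ↦ hmap ▸ Ideal.mem_map_of_mem g (hx _)) (by
      rw [hmap, Ideal.map_le_iff_le_comap]
      intro r hr
      obtain ⟨n, hn⟩ := hrad hr
      refine ⟨n, ?_⟩
      rw [← map_pow]
      have h2 := Ideal.mem_map_of_mem g hn
      refine (?_ : Ideal.map g _ ≤ _) h2
      rw [Ideal.map_span, Ideal.span_le]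
      rintro _ ⟨_, ⟨i, rfl⟩, rfl⟩
      induction i using Fin.lastCases with
      | last => exact Ideal.mem_sup_left hxP
      | cast i => exact Ideal.mem_sup_right (Ideal.subset_span ⟨i, rfl⟩))
  rw [hum P hP, Fintype.card_fin] at h1
  have h2 := hd ▸ (ringKrullDim_le_ringKrullDim_adicCompletion (R := R)).trans h1
  have : e + 1 ≤ e := by exact_mod_cast h2
  omega

end Unmixed

section OppositeHomology

variable {R : Type u} [CommRing R]

/-- `f`, in degree `i` of the cochain complex opposite to `K`, is a cocycle representing the
cohomology class `a`. -/
def Represents (K : ChainComplex (ModuleCat.{u} R)ᵒᵖ ℕ) (i : ℕ) (a : (K.homology i).unop)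
    (f : (K.X i).unop) : Prop :=
  ∃ z : (K.opcycles i).unop, (K.homologyι i).unop.hom z = a ∧ (K.pOpcycles i).unop.hom z = f

namespace Represents

variable {K L : ChainComplex (ModuleCat.{u} R)ᵒᵖ ℕ} {i : ℕ}

lemma exists_representative (a : (K.homology i).unop) : ∃ f, Represents K i a f := by
  have : Epi (K.homologyι i).unop := inferInstance
  obtain ⟨z, hz⟩ := (ModuleCat.epi_iff_surjective _).1 this a
  exact ⟨_, z, hz, rfl⟩

lemma d_eq_zero {a : (K.homology i).unop} {f : (K.X i).unop} (h : Represents K i a f) :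
    (K.d (i + 1) i).unop.hom f = 0 := by
  obtain ⟨z, -, rfl⟩ := h
  have := congr_arg Quiver.Hom.unop (K.d_pOpcycles (i + 1) i)
  exact congr_arg (fun φ : (K.opcycles i).unop ⟶ (K.X (i + 1)).unop ↦ φ.hom z) this

lemma exists_of_d_eq_zero {f : (K.X i).unop} (hf : (K.d (i + 1) i).unop.hom f = 0) :
    ∃ a, Represents K i a f := by
  have h := (ShortComplex.exact_of_g_is_cokernel
    (ShortComplex.mk _ _ (K.d_pOpcycles (i + 1) i))
    (K.opcyclesIsCokernel (i + 1) i (ChainComplex.prev ℕ i))).unop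
  obtain ⟨z, hz⟩ := (ShortComplex.moduleCat_exact_iff _).1 h f hf
  exact ⟨_, z, rfl, hz⟩

lemma eq_zero_iff {a : (K.homology i).unop} {f : (K.X i).unop} (h : Represents K i a f) :
    a = 0 ↔ ∃ g : (K.X (i - 1)).unop, (K.d i (i - 1)).unop.hom g = f := by
  obtain ⟨z, rfl, rfl⟩ := h
  have hi : (ComplexShape.down ℕ).next i = i - 1 := by
    cases i with
    | zero => exact ChainComplex.next_nat_zero
    | succ i => exact ChainComplex.next_nat_succ i
  have hex := (ShortComplex.exact_of_f_is_kernel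
    (ShortComplex.mk _ _ (K.homologyι_comp_fromOpcycles i (i - 1)))
    (K.homologyIsKernel i (i - 1) hi)).unop
  have hfac : (K.fromOpcycles i (i - 1)).unop ≫ (K.pOpcycles i).unop = (K.d i (i - 1)).unop :=
    congr_arg Quiver.Hom.unop (K.p_fromOpcycles i (i - 1))
  have hinj : Function.Injective (K.pOpcycles i).unop.hom :=
    (ModuleCat.mono_iff_injective _).1 inferInstance
  constructor
  · intro h0
    obtain ⟨g, hg⟩ := (ShortComplex.moduleCat_exact_iff _).1 hex z h0
    refine ⟨g, ?_⟩
    rw [← hfac]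
    exact congr_arg (K.pOpcycles i).unop.hom hg
  · rintro ⟨g, hg⟩
    rw [← hfac] at hg
    have hz : (K.fromOpcycles i (i - 1)).unop.hom g = z := hinj hg
    rw [← hz]
    have := congr_arg Quiver.Hom.unop (K.homologyι_comp_fromOpcycles i (i - 1))
    exact congr_arg (fun φ : (K.X (i - 1)).unop ⟶ (K.homology i).unop ↦ φ.hom g) this

lemma map (φ : K ⟶ L) {a : (L.homology i).unop} {f : (L.X i).unop} (h : Represents L i a f) :
    Represents K i ((HomologicalComplex.homologyMap φ i).unop.hom a) ((φ.f i).unop.hom f) := by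
  obtain ⟨z, rfl, rfl⟩ := h
  refine ⟨(HomologicalComplex.opcyclesMap φ i).unop.hom z, ?_, ?_⟩
  · have := congr_arg Quiver.Hom.unop (HomologicalComplex.homologyι_naturality φ i)
    exact (congr_arg (fun ψ : (L.opcycles i).unop ⟶ (K.homology i).unop ↦ ψ.hom z) this).symm
  · have := congr_arg Quiver.Hom.unop (HomologicalComplex.p_opcyclesMap φ i)
    exact congr_arg (fun ψ : (L.opcycles i).unop ⟶ (K.X i).unop ↦ ψ.hom z) this

end Represents

end OppositeHomology

section LocalCohomologyVanishing

variable {R : Type u} [CommRing R]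

/-- The functor `Hom(-, M)`, as a covariant functor to the opposite category. -/
noncomputable abbrev homOp (M : ModuleCat.{u} R) : ModuleCat.{u} R ⥤ (ModuleCat.{u} R)ᵒᵖ :=
  ((linearYoneda R (ModuleCat.{u} R)).obj M).rightOp

/-- A projective resolution of `R ⧸ J ^ n`. -/
noncomputable abbrev powerResolution (J : Ideal R) (n : ℕ) :
    ProjectiveResolution (ModuleCat.of R (R ⧸ J ^ n)) :=
  projectiveResolution _

/-- The projection `R ⧸ J ^ n' ⟶ R ⧸ J ^ n`. -/
noncomputable abbrev powerProj (J : Ideal R) {n n' : ℕ} (h : n ≤ n') :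
    ModuleCat.of R (R ⧸ J ^ n') ⟶ ModuleCat.of R (R ⧸ J ^ n) :=
  (localCohomology.ringModIdeals (localCohomology.idealPowersDiagram J)).map
    (X := op n') (Y := op n) (homOfLE h).op

/-- The chain map `ψ` lifts the projection `R ⧸ J ^ n' ⟶ R ⧸ J ^ n`. -/
def IsLiftPowerProj (J : Ideal R) {n n' : ℕ} (h : n ≤ n')
    (ψ : (powerResolution J n').complex ⟶ (powerResolution J n).complex) : Prop :=
  ψ ≫ (powerResolution J n).π =
    (powerResolution J n').π ≫ (ChainComplex.single₀ _).map (powerProj J h)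

lemma exists_isLiftPowerProj (J : Ideal R) {n n' : ℕ} (h : n ≤ n') :
    ∃ ψ, IsLiftPowerProj J h ψ :=
  ⟨ProjectiveResolution.lift _ _ _, ProjectiveResolution.lift_commutes _ _ _⟩

/-- Every cocycle of degree `i` on a resolution of `R ⧸ J ^ n` with values in `M` becomes a
coboundary on a resolution of some `R ⧸ J ^ n'`. -/
def CocyclesVanish (J : Ideal R) (i : ℕ) (M : ModuleCat.{u} R) : Prop :=
  ∀ (n : ℕ) (f : (powerResolution J n).complex.X i ⟶ M),
    (powerResolution J n).complex.d (i + 1) i ≫ f = 0 →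
    ∃ (n' : ℕ) (h : n ≤ n') (ψ : (powerResolution J n').complex ⟶ (powerResolution J n).complex)
      (g : (powerResolution J n').complex.X (i - 1) ⟶ M),
      IsLiftPowerProj J h ψ ∧ ψ.f i ≫ f = (powerResolution J n').complex.d i (i - 1) ≫ g

/-- The diagram of Ext modules computing local cohomology. -/
noncomputable abbrev extDiagram (J : Ideal R) (i : ℕ) (M : ModuleCat.{u} R) :
    (ℕᵒᵖ)ᵒᵖ ⥤ ModuleCat.{u} R :=
  localCohomology.diagram (localCohomology.idealPowersDiagram J) i ⋙
    (evaluation _ _).obj M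

/-- The complex computing the Ext modules. -/
noncomputable abbrev extComplex (J : Ideal R) (n : ℕ) (M : ModuleCat.{u} R) :
    ChainComplex (ModuleCat.{u} R)ᵒᵖ ℕ :=
  ((homOp M).mapHomologicalComplex _).obj (powerResolution J n).complex

/-- The isomorphism of the homology of `extComplex` with the Ext modules. -/
noncomputable abbrev extIso (J : Ideal R) (i n : ℕ) (M : ModuleCat.{u} R) :
    ((extComplex J n M).homology i).unop ≅ (extDiagram J i M).obj (op (op n)) :=
  ((powerResolution J n).isoLeftDerivedObj (homOp M) i).unop

lemma extIso_naturality (J : Ideal R) (i : ℕ) (M : ModuleCat.{u} R) {n n' : ℕ} (h : n ≤ n')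
    {ψ : (powerResolution J n').complex ⟶ (powerResolution J n).complex}
    (hψ : IsLiftPowerProj J h ψ) :
    (extIso J i n M).hom ≫ (extDiagram J i M).map (homOfLE h).op.op =
      (HomologicalComplex.homologyMap (((homOp M).mapHomologicalComplex _).map ψ) i).unop ≫
        (extIso J i n' M).hom := by
  have := Functor.leftDerived_map_eq (homOp M) i (powerProj J h) ψ hψ
  exact congr_arg Quiver.Hom.unop
    ((Iso.eq_comp_inv _).1 (this.trans (Category.assoc _ _ _).symm))

lemma subsingleton_localCohomology_iff (J : Ideal R) (i : ℕ) (M : ModuleCat.{u} R) :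
    Subsingleton ((localCohomology J i).obj M) ↔
      ∀ (n : ℕ) (a : (extDiagram J i M).obj (op (op n))), ∃ (n' : ℕ) (h : n ≤ n'),
        (extDiagram J i M).map (homOfLE h).op.op a = 0 := by
  have : PreservesFilteredColimitsOfSize.{0, 0} (forget (ModuleCat.{u} R)) :=
    preservesSmallestFilteredColimits_of_preservesFilteredColimits _
  have hc := isColimitOfPreserves ((evaluation _ _).obj M)
    (colimit.isColimit (localCohomology.diagram (localCohomology.idealPowersDiagram J) i))
  constructor
  · intro hs n a
    have h0 : (((evaluation _ _).obj M).mapCocone (colimit.cocone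
        (localCohomology.diagram (localCohomology.idealPowersDiagram J) i))).ι.app (op (op n)) a =
        (((evaluation _ _).obj M).mapCocone (colimit.cocone
        (localCohomology.diagram (localCohomology.idealPowersDiagram J) i))).ι.app (op (op n)) 0 :=
      Subsingleton.elim (α := (localCohomology J i).obj M) _ _
    obtain ⟨k, f, g, h⟩ := Concrete.isColimit_exists_of_rep_eq _ hc a 0 h0
    obtain rfl : f = g := Subsingleton.elim _ _
    exact ⟨k.unop.unop, leOfHom f.unop.unop, h.trans (map_zero _)⟩
  · intro H
    have hz : ∀ b : (localCohomology J i).obj M, b = 0 := by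
      intro b
      obtain ⟨⟨⟨n⟩⟩, a, rfl⟩ := Concrete.isColimit_exists_rep _ hc b
      obtain ⟨n', h, h0⟩ := H n a
      exact (Concrete.isColimit_rep_eq_of_exists _ a 0 ⟨op (op n'), (homOfLE h).op.op,
        (homOfLE h).op.op, h0.trans (map_zero _).symm⟩).trans (map_zero _)
    exact ⟨fun b c ↦ (hz b).trans (hz c).symm⟩

theorem subsingleton_localCohomology_iff_cocyclesVanish (J : Ideal R) (i : ℕ)
    (M : ModuleCat.{u} R) :
    Subsingleton ((localCohomology J i).obj M) ↔ CocyclesVanish J i M := by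
  rw [subsingleton_localCohomology_iff]
  have key : ∀ {n n' : ℕ} (h : n ≤ n') {ψ} (_ : IsLiftPowerProj J h ψ)
      (a : ((extComplex J n M).homology i).unop) (f : (powerResolution J n).complex.X i ⟶ M)
      (_ : Represents (extComplex J n M) i a f),
      (extDiagram J i M).map (homOfLE h).op.op ((extIso J i n M).hom a) = 0 ↔
        ∃ g, ψ.f i ≫ f = (powerResolution J n').complex.d i (i - 1) ≫ g := by
    intro n n' h ψ hψ a f hf
    have h1 : (extDiagram J i M).map (homOfLE h).op.op ((extIso J i n M).hom a) =
        (extIso J i n' M).hom ((HomologicalComplex.homologyMap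
          (((homOp M).mapHomologicalComplex _).map ψ) i).unop a) :=
      congr_arg (fun φ : ((extComplex J n M).homology i).unop ⟶
        (extDiagram J i M).obj (op (op n')) ↦ φ a) (extIso_naturality J i M h hψ)
    have h2 : Function.Injective (extIso J i n' M).hom :=
      (ModuleCat.mono_iff_injective _).1 inferInstance
    rw [h1, ← map_zero (extIso J i n' M).hom.hom]
    refine h2.eq_iff.trans ((hf.map (((homOp M).mapHomologicalComplex _).map ψ)).eq_zero_iff.trans
      (exists_congr fun g ↦ ?_))
    exact eq_comm
  constructor
  · intro H n f hf
    obtain ⟨a, ha⟩ := Represents.exists_of_d_eq_zero (K := extComplex J n M) (i := i) (f := f) hf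
    obtain ⟨n', h, h0⟩ := H n ((extIso J i n M).hom a)
    obtain ⟨ψ, hψ⟩ := exists_isLiftPowerProj J h
    obtain ⟨g, hg⟩ := (key h hψ a f ha).1 h0
    exact ⟨n', h, ψ, g, hψ, hg⟩
  · intro H n b
    have hs : Function.Surjective (extIso J i n M).hom :=
      (ModuleCat.epi_iff_surjective _).1 inferInstance
    obtain ⟨a, rfl⟩ := hs b
    obtain ⟨f, hf⟩ := Represents.exists_representative (K := extComplex J n M) a
    obtain ⟨n', h, ψ, g, hψ, hg⟩ := H n f hf.d_eq_zero
    exact ⟨n', h, (key h hψ a f hf).2 ⟨g, hg⟩⟩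

end LocalCohomologyVanishing

section CocyclesVanishShortExact

variable {R : Type u} [CommRing R]

lemma IsLiftPowerProj.id (J : Ideal R) (n : ℕ) :
    IsLiftPowerProj J le_rfl (𝟙 (powerResolution J n).complex) := by
  have h : powerProj J (le_refl n) = 𝟙 _ :=
    (localCohomology.ringModIdeals (localCohomology.idealPowersDiagram J)).map_id (op n)
  unfold IsLiftPowerProj
  rw [h, CategoryTheory.Functor.map_id, Category.id_comp, Category.comp_id]

lemma IsLiftPowerProj.comp {J : Ideal R} {n n' n'' : ℕ} {h : n ≤ n'} {h' : n' ≤ n''}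
    {ψ : (powerResolution J n').complex ⟶ (powerResolution J n).complex}
    {φ : (powerResolution J n'').complex ⟶ (powerResolution J n').complex}
    (hψ : IsLiftPowerProj J h ψ) (hφ : IsLiftPowerProj J h' φ) :
    IsLiftPowerProj J (h.trans h') (φ ≫ ψ) := by
  have hp : powerProj J (h.trans h') = powerProj J h' ≫ powerProj J h :=
    (localCohomology.ringModIdeals (localCohomology.idealPowersDiagram J)).map_comp
      (X := op n'') (Y := op n') (Z := op n) (homOfLE h').op (homOfLE h).op
  unfold IsLiftPowerProj at *
  rw [hp, Functor.map_comp, Category.assoc, hψ, ← Category.assoc, hφ, Category.assoc]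

lemma exists_nullhomotopy {J : Ideal R} {n : ℕ} {y : R} (hy : y ∈ J ^ n) :
    ∃ s : ∀ i, (powerResolution J n).complex.X i ⟶ (powerResolution J n).complex.X (i + 1),
      y • 𝟙 ((powerResolution J n).complex.X 0) = s 0 ≫ (powerResolution J n).complex.d 1 0 ∧
      ∀ i, y • 𝟙 ((powerResolution J n).complex.X (i + 1)) =
        (powerResolution J n).complex.d (i + 1) i ≫ s i +
          s (i + 1) ≫ (powerResolution J n).complex.d (i + 2) (i + 1) := by
  have h0 : (y • 𝟙 (powerResolution J n).complex) ≫ (powerResolution J n).π = 0 := by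
    have hy0 : y • 𝟙 (ModuleCat.of R (R ⧸ J ^ n)) = 0 := by
      refine ModuleCat.hom_ext (LinearMap.ext fun a ↦ ?_)
      obtain ⟨a, rfl⟩ := Ideal.Quotient.mk_surjective a
      change y • Ideal.Quotient.mk (J ^ n) a = 0
      rw [← Ideal.Quotient.mk_eq_mk, ← Submodule.Quotient.mk_smul, Submodule.Quotient.mk_eq_zero]
      exact Ideal.mul_mem_right _ _ hy
    have h1 : y • 𝟙 ((ChainComplex.single₀ _).obj (ModuleCat.of R (R ⧸ J ^ n))) = 0 := by
      refine HomologicalComplex.from_single_hom_ext ?_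
      rw [← cancel_mono (HomologicalComplex.singleObjXSelf (ComplexShape.down ℕ) 0 _).hom]
      exact hy0
    rw [Linear.smul_comp, Category.id_comp, ← Category.comp_id (powerResolution J n).π,
      ← Linear.comp_smul, h1, comp_zero]
  have H := ProjectiveResolution.liftHomotopyZero _ h0
  refine ⟨fun i ↦ H.hom i (i + 1), ?_, fun i ↦ ?_⟩
  · have := H.comm 0
    rw [Homotopy.dNext_zero_chainComplex, Homotopy.prevD_chainComplex] at this
    simpa using this
  · have := H.comm (i + 1)
    rw [Homotopy.dNext_succ_chainComplex, Homotopy.prevD_chainComplex] at this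
    simpa using this

variable {M N : ModuleCat.{u} R} {x : R} {β : M ⟶ N} {J : Ideal R}

lemma eq_of_smul_eq_smul [Mono (x • 𝟙 M)] {L : ModuleCat.{u} R} {f g : L ⟶ M} (h : x • f = x • g) : f = g := by
  rw [← cancel_mono (x • 𝟙 M)]
  simpa using h

lemma cocyclesVanish_zero_of_mono [Mono (x • 𝟙 M)] (hx : x ∈ J) : CocyclesVanish J 0 M := by
  intro n f hf
  obtain ⟨s, hs, -⟩ := exists_nullhomotopy (Ideal.pow_mem_pow hx n)
  have h0 : x ^ n • f = 0 := by
    have := congr_arg (· ≫ f) hs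
    simpa [hf] using this
  have hk : ∀ k : ℕ, x ^ k • f = 0 → f = 0 := by
    intro k
    induction k with
    | zero => simp
    | succ k ih =>
      intro h
      refine ih (eq_of_smul_eq_smul (x := x) ?_)
      rw [smul_zero, smul_smul, ← pow_succ', h]
  exact ⟨n, le_rfl, 𝟙 _, 0, IsLiftPowerProj.id J n, by simp [hk n h0]⟩

lemma exists_eq_smul_of_comp_eq_zero (hw : (x • 𝟙 M) ≫ β = 0)
    (hex : (ShortComplex.mk _ _ hw).Exact) {L : ModuleCat.{u} R} [Projective L] {f : L ⟶ M}
    (h : f ≫ β = 0) : ∃ g : L ⟶ M, f = x • g := by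
  refine ⟨hex.liftFromProjective f h, ?_⟩
  have := hex.liftFromProjective_comp f h
  simpa using this.symm

lemma exists_comp_eq_of_smul_eq [Mono (x • 𝟙 M)] [Epi β] (hw : (x • 𝟙 M) ≫ β = 0)
    (hex : (ShortComplex.mk _ _ hw).Exact) {i : ℕ} (hN : CocyclesVanish J i N) {n : ℕ}
    {f : (powerResolution J n).complex.X (i + 1) ⟶ M}
    {h : (powerResolution J n).complex.X i ⟶ M}
    (hf : x • f = (powerResolution J n).complex.d (i + 1) i ≫ h) :
    ∃ (n' : ℕ) (hn : n ≤ n') (ψ : (powerResolution J n').complex ⟶ (powerResolution J n).complex)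
      (l : (powerResolution J n').complex.X i ⟶ M),
      IsLiftPowerProj J hn ψ ∧
        ψ.f (i + 1) ≫ f = (powerResolution J n').complex.d (i + 1) i ≫ l := by
  have hwf : ∀ {L : ModuleCat.{u} R} (g : L ⟶ M), (x • g) ≫ β = 0 := by
    intro L g
    have : x • g = g ≫ (x • 𝟙 M) := by simp
    rw [this, Category.assoc, hw, comp_zero]
  obtain ⟨n', hn, ψ, k', hψ, hk'⟩ := hN n (h ≫ β) (by
    rw [← Category.assoc, ← hf, hwf])
  obtain ⟨k, rfl⟩ : ∃ k, k ≫ β = k' := ⟨_, Projective.factorThru_comp k' β⟩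
  obtain ⟨l, hl⟩ := exists_eq_smul_of_comp_eq_zero hw hex
    (f := ψ.f i ≫ h - (powerResolution J n').complex.d i (i - 1) ≫ k)
    (by rw [Preadditive.sub_comp, Category.assoc, Category.assoc, hk', sub_self])
  refine ⟨n', hn, ψ, l, hψ, eq_of_smul_eq_smul (x := x) ?_⟩
  rw [← Linear.comp_smul, ← Linear.comp_smul, hf, ← hl, Preadditive.comp_sub,
    HomologicalComplex.d_comp_d_assoc, zero_comp, sub_zero, HomologicalComplex.Hom.comm_assoc]

/-- If multiplication by `x` on `M` is injective with cokernel `N`, vanishing of the local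
cohomology of `N` in degree `i` implies vanishing of that of `M` in degree `i + 1`. -/
theorem CocyclesVanish.succ_of_shortExact [Mono (x • 𝟙 M)] [Epi β] (hx : x ∈ J)
    (hw : (x • 𝟙 M) ≫ β = 0) (hex : (ShortComplex.mk _ _ hw).Exact) {i : ℕ}
    (hN : CocyclesVanish J i N) : CocyclesVanish J (i + 1) M := by
  have key : ∀ (k n : ℕ) (f : (powerResolution J n).complex.X (i + 1) ⟶ M)
      (h : (powerResolution J n).complex.X i ⟶ M),
      x ^ k • f = (powerResolution J n).complex.d (i + 1) i ≫ h →
      ∃ (n' : ℕ) (hn : n ≤ n')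
        (ψ : (powerResolution J n').complex ⟶ (powerResolution J n).complex)
        (l : (powerResolution J n').complex.X i ⟶ M), IsLiftPowerProj J hn ψ ∧
          ψ.f (i + 1) ≫ f = (powerResolution J n').complex.d (i + 1) i ≫ l := by
    intro k
    induction k with
    | zero =>
      intro n f h hf
      exact ⟨n, le_rfl, 𝟙 _, h, IsLiftPowerProj.id J n, by simpa using hf⟩
    | succ k ih =>
      intro n f h hf
      rw [pow_succ', ← smul_smul] at hf
      obtain ⟨n₁, hn₁, ψ, l, hψ, hl⟩ := exists_comp_eq_of_smul_eq hw hex hN hf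
      obtain ⟨n₂, hn₂, φ, l', hφ, hl'⟩ := ih n₁ (ψ.f (i + 1) ≫ f) l (by
        rw [← Linear.comp_smul, hl])
      exact ⟨n₂, hn₁.trans hn₂, φ ≫ ψ, l', hψ.comp hφ, by
        rw [HomologicalComplex.comp_f, Category.assoc, hl']⟩
  intro n f hf
  obtain ⟨s, -, hs⟩ := exists_nullhomotopy (Ideal.pow_mem_pow hx n)
  refine key n n f (s i ≫ f) ?_
  have := congr_arg (· ≫ f) (hs i)
  simpa [hf] using this

/-- If multiplication by `x` on `M` is injective with cokernel `N`, vanishing of the local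
cohomology of `M` in degrees `i` and `i + 1` implies vanishing of that of `N` in degree `i`. -/
theorem CocyclesVanish.of_shortExact [Mono (x • 𝟙 M)] [Epi β]
    (hw : (x • 𝟙 M) ≫ β = 0) (hex : (ShortComplex.mk _ _ hw).Exact) {i : ℕ}
    (hM : CocyclesVanish J i M) (hM' : CocyclesVanish J (i + 1) M) : CocyclesVanish J i N := by
  intro n f' hf'
  have hwf : ∀ {L : ModuleCat.{u} R} (g : L ⟶ M), (x • g) ≫ β = 0 := by
    intro L g
    have : x • g = g ≫ (x • 𝟙 M) := by simp
    rw [this, Category.assoc, hw, comp_zero]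
  obtain ⟨f, rfl⟩ : ∃ f, f ≫ β = f' := ⟨_, Projective.factorThru_comp f' β⟩
  obtain ⟨g, hg⟩ := exists_eq_smul_of_comp_eq_zero hw hex
    (f := (powerResolution J n).complex.d (i + 1) i ≫ f) (by rw [Category.assoc, hf'])
  obtain ⟨n₁, hn₁, ψ, (h : (powerResolution J n₁).complex.X i ⟶ M), hψ,
    (hh : _ = (powerResolution J n₁).complex.d (i + 1) i ≫ h)⟩ := hM' n g (eq_of_smul_eq_smul (x := x) (by
    rw [← Linear.comp_smul, ← hg, HomologicalComplex.d_comp_d_assoc, zero_comp, smul_zero]))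
  obtain ⟨n₂, hn₂, φ, k, hφ, hk⟩ := hM n₁ (ψ.f i ≫ f - x • h) (by
    rw [Preadditive.comp_sub, ← HomologicalComplex.Hom.comm_assoc, hg, Linear.comp_smul,
      Linear.comp_smul, hh, sub_self])
  refine ⟨n₂, hn₁.trans hn₂, φ ≫ ψ, k ≫ β, hψ.comp hφ, ?_⟩
  rw [← Category.assoc (((powerResolution J n₂).complex).d _ _), ← hk, Category.assoc,
    Preadditive.sub_comp, hwf, sub_zero, HomologicalComplex.comp_f, Category.assoc, Category.assoc]

lemma CocyclesVanish.eq_zero_of_smul_eq_zero {A : Type u} [AddCommGroup A] [Module R A]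
    (h : CocyclesVanish J 0 (ModuleCat.of R A)) {a : A} (ha : ∀ r ∈ J, r • a = 0) : a = 0 := by
  let θ : (R ⧸ J ^ 1) →ₗ[R] A := (J ^ 1).liftQ (LinearMap.toSpanSingleton R A a) (by
    intro r hr
    rw [pow_one] at hr
    exact ha r hr)
  obtain ⟨n', hn, ψ, g, hψ, hg⟩ := h 1 ((powerResolution J 1).π.f 0 ≫ ModuleCat.ofHom θ) (by
    have := (powerResolution J 1).complex_d_comp_π_f_zero
    exact (Category.assoc _ _ _).symm.trans ((congr_arg (· ≫ ModuleCat.ofHom θ) this).trans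
      zero_comp))
  have h1 : ψ.f 0 ≫ (powerResolution J 1).π.f 0 =
      (powerResolution J n').π.f 0 ≫ powerProj J hn :=
    (HomologicalComplex.congr_hom hψ 0).trans (by simp)
  have h2 : (powerResolution J n').π.f 0 ≫ powerProj J hn ≫ ModuleCat.ofHom θ = 0 := by
    refine (Category.assoc _ _ _).symm.trans ((congr_arg (· ≫ ModuleCat.ofHom θ) h1).symm.trans
      ((Category.assoc _ _ _).trans (hg.trans ?_)))
    simp
  have h3 : powerProj J hn ≫ ModuleCat.ofHom θ = 0 :=
    (cancel_epi ((powerResolution J n').π.f 0)).1 (h2.trans comp_zero.symm)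
  have h4 := congr_arg (fun φ : ModuleCat.of R (R ⧸ J ^ n') ⟶ ModuleCat.of R A ↦
    φ.hom (Submodule.Quotient.mk 1)) h3
  have h5 : (1 : R) • a = 0 := h4
  rwa [one_smul] at h5

end CocyclesVanishShortExact

lemma ringKrullDim_quotient_succ_le {R : Type u} [CommRing R] {P Q : Ideal R} (hP : P.IsPrime) (h : P ≤ Q) {y : R}
    (hyQ : y ∈ Q) (hyP : y ∉ P) : ringKrullDim (R ⧸ Q) + 1 ≤ ringKrullDim (R ⧸ P) := by
  refine ringKrullDim_succ_le_of_surjective (Ideal.Quotient.factor h)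
    (Ideal.Quotient.factor_surjective h) (r := Ideal.Quotient.mk P y) ?_ ?_
  · rw [mem_nonZeroDivisors_iff_ne_zero, Ne, Ideal.Quotient.eq_zero_iff_mem]
    exact hyP
  · rw [Ideal.Quotient.factor_mk, Ideal.Quotient.eq_zero_iff_mem]
    exact hyQ

section AssociatedPrimesQuotient

variable {R : Type u} [CommRing R] [IsNoetherianRing R]

lemma isAssociatedPrime_quotient_iff {I P : Ideal R} :
    IsAssociatedPrime P (R ⧸ I) ↔ P.IsPrime ∧ ∃ a, ∀ r, r ∈ P ↔ r * a ∈ I := by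
  rw [isAssociatedPrime_iff]
  refine and_congr_right fun _ ↦ ⟨?_, ?_⟩
  · rintro ⟨x, rfl⟩
    obtain ⟨a, rfl⟩ := Submodule.Quotient.mk_surjective _ x
    refine ⟨a, fun r ↦ ?_⟩
    rw [Submodule.mem_colon_singleton, Submodule.mem_bot, ← Submodule.Quotient.mk_smul,
      Submodule.Quotient.mk_eq_zero, smul_eq_mul]
  · rintro ⟨a, ha⟩
    refine ⟨Submodule.Quotient.mk a, Ideal.ext fun r ↦ ?_⟩
    rw [Submodule.mem_colon_singleton, Submodule.mem_bot, ← Submodule.Quotient.mk_smul,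
      Submodule.Quotient.mk_eq_zero, smul_eq_mul, ha]

lemma exists_isAssociatedPrime_quotient {I : Ideal R} {c : R} (hc : c ∉ I) :
    ∃ P, IsAssociatedPrime P (R ⧸ I) ∧ ∀ r, r * c ∈ I → r ∈ P := by
  obtain ⟨P, hP, hle⟩ := exists_le_isAssociatedPrime_of_isNoetherianRing R
    (Submodule.Quotient.mk c : R ⧸ I) (by rwa [Ne, Submodule.Quotient.mk_eq_zero])
  refine ⟨P, hP, fun r hr ↦ hle ?_⟩
  rwa [Submodule.mem_colon_singleton, Submodule.mem_bot, ← Submodule.Quotient.mk_smul,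
    Submodule.Quotient.mk_eq_zero, smul_eq_mul]

lemma exists_regular_of_forall_mul_mem {I M : Ideal R}
    (h : ∀ a, (∀ r ∈ M, r * a ∈ I) → a ∈ I) : ∃ y ∈ M, ∀ c, y * c ∈ I → c ∈ I := by
  by_contra! hcon
  have hsub : (M : Set R) ⊆ ⋃ p ∈ associatedPrimes R (R ⧸ I), (id p : Ideal R) := by
    intro y hy
    obtain ⟨c, hc, hcI⟩ := hcon y hy
    obtain ⟨P, hP, h1⟩ := exists_isAssociatedPrime_quotient hcI
    exact Set.mem_iUnion₂_of_mem hP (h1 y hc)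
  obtain ⟨P, hP, hle⟩ := (M.subset_union_prime_finite (associatedPrimes.finite R (R ⧸ I))
    (f := id) 0 0 fun _ h _ _ ↦ h.isPrime).1 hsub
  obtain ⟨hP', a, ha⟩ := isAssociatedPrime_quotient_iff.1 hP
  have haI := h a fun r hr ↦ (ha r).1 (hle hr)
  exact hP'.ne_top ((Ideal.eq_top_iff_one _).2 ((ha 1).2 (by rwa [one_mul])))

variable [IsLocalRing R]

/-- Going from `I` to `I + (y)` with `y` regular modulo `I`, an associated prime can be enlarged
to an associated prime containing `y`. -/
lemma exists_isAssociatedPrime_quotient_sup {I P : Ideal R} (hP : IsAssociatedPrime P (R ⧸ I))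
    {y : R} (hy : y ∈ maximalIdeal R) (hreg : ∀ c, y * c ∈ I → c ∈ I) :
    ∃ Q, IsAssociatedPrime Q (R ⧸ (I ⊔ Ideal.span {y})) ∧ P ≤ Q ∧ y ∈ Q ∧ y ∉ P := by
  obtain ⟨hP', a, ha⟩ := isAssociatedPrime_quotient_iff.1 hP
  have haI : a ∉ I := fun h ↦
    hP'.ne_top ((Ideal.eq_top_iff_one _).2 ((ha 1).2 (by rwa [one_mul])))
  set W : Ideal R := I.colon P with hW
  have hmem : ∀ c, c ∈ W ↔ ∀ r ∈ P, r * c ∈ I := fun c ↦ by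
    rw [hW, Submodule.mem_colon]
    exact forall₂_congr fun r _ ↦ by rw [smul_eq_mul, mul_comm]
  obtain ⟨w, hw, hwI⟩ : ∃ w ∈ W, w ∉ I ⊔ Ideal.span {y} := by
    by_contra! hcon
    have hle : W ≤ I ⊔ maximalIdeal R • W := by
      intro w hw
      obtain ⟨i, hi, b, hb, rfl⟩ := Submodule.mem_sup.1 (hcon w hw)
      obtain ⟨c, rfl⟩ := Ideal.mem_span_singleton'.1 hb
      refine Submodule.add_mem_sup hi ?_
      rw [mul_comm]
      refine Submodule.smul_mem_smul hy ((hmem c).2 fun r hr ↦ hreg _ ?_)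
      have h1 := I.sub_mem ((hmem _).1 hw r hr) (I.mul_mem_left r hi)
      have h2 : r * (i + c * y) - r * i = y * (r * c) := by ring
      rwa [h2] at h1
    have := Submodule.le_of_le_smul_of_le_jacobson_bot (IsNoetherian.noetherian W)
      (IsLocalRing.maximalIdeal_le_jacobson _) hle
    exact haI (this ((hmem a).2 fun r hr ↦ (ha r).1 hr))
  obtain ⟨Q, hQ, hQ'⟩ := exists_isAssociatedPrime_quotient hwI
  refine ⟨Q, hQ, fun r hr ↦ hQ' r (Ideal.mem_sup_left ((hmem w).1 hw r hr)), hQ' y ?_,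
    fun h ↦ haI (hreg a ((ha y).1 h))⟩
  exact Ideal.mem_sup_right (Ideal.mul_mem_right _ _ (Ideal.mem_span_singleton_self y))

end AssociatedPrimesQuotient

section QuotientShortExact

variable {R : Type u} [CommRing R]

/-- The projection `R ⧸ I ⟶ R ⧸ (I + (x))`. -/
noncomputable abbrev quotProj (I : Ideal R) (x : R) :
    ModuleCat.of R (R ⧸ I) ⟶ ModuleCat.of R (R ⧸ (I ⊔ Ideal.span {x})) :=
  ModuleCat.ofHom (Submodule.factor (le_sup_left : I ≤ I ⊔ Ideal.span {x}))

lemma smul_id_comp_quotProj (I : Ideal R) (x : R) :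
    (x • 𝟙 (ModuleCat.of R (R ⧸ I))) ≫ quotProj I x = 0 := by
  refine ModuleCat.hom_ext (LinearMap.ext fun a ↦ ?_)
  obtain ⟨a, rfl⟩ := Submodule.Quotient.mk_surjective _ a
  change (Submodule.Quotient.mk (x * a) : R ⧸ (I ⊔ Ideal.span {x})) = 0
  rw [Submodule.Quotient.mk_eq_zero]
  exact Ideal.mem_sup_right (Ideal.mul_mem_right _ _ (Ideal.mem_span_singleton_self x))

lemma exact_quotProj (I : Ideal R) (x : R) :
    (ShortComplex.mk _ _ (smul_id_comp_quotProj I x)).Exact := by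
  rw [ShortComplex.moduleCat_exact_iff]
  intro a ha
  obtain ⟨a, rfl⟩ := Submodule.Quotient.mk_surjective _ a
  have ha' : (Submodule.Quotient.mk a : R ⧸ (I ⊔ Ideal.span {x})) = 0 := ha
  rw [Submodule.Quotient.mk_eq_zero] at ha'
  obtain ⟨i, hi, b, hb, rfl⟩ := Submodule.mem_sup.1 ha'
  obtain ⟨c, rfl⟩ := Ideal.mem_span_singleton'.1 hb
  refine ⟨Submodule.Quotient.mk c, ?_⟩
  change (Submodule.Quotient.mk (x * c) : R ⧸ I) = Submodule.Quotient.mk (i + c * x)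
  rw [Submodule.Quotient.eq]
  have : x * c - (i + c * x) = -i := by ring
  rw [this]
  exact neg_mem hi

instance (I : Ideal R) (x : R) : Epi (quotProj I x) := by
  rw [ModuleCat.epi_iff_surjective]
  exact Submodule.factor_surjective (le_sup_left : I ≤ I ⊔ Ideal.span {x})

lemma mono_smul_id {I : Ideal R} {x : R} (hreg : ∀ c, x * c ∈ I → c ∈ I) :
    Mono (x • 𝟙 (ModuleCat.of R (R ⧸ I))) := by
  rw [ModuleCat.mono_iff_injective]
  refine (injective_iff_map_eq_zero _).2 fun a ha ↦ ?_
  obtain ⟨a, rfl⟩ := Submodule.Quotient.mk_surjective _ a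
  have ha' : (Submodule.Quotient.mk (x * a) : R ⧸ I) = 0 := ha
  rw [Submodule.Quotient.mk_eq_zero] at ha'
  exact (Submodule.Quotient.mk_eq_zero _).2 (hreg a ha')

end QuotientShortExact

section Depth

variable {R : Type u} [CommRing R] [IsLocalRing R]

/-- The local cohomology of `R ⧸ I` vanishes in degrees less than `t`. -/
def DepthGE (I : Ideal R) (t : ℕ) : Prop :=
  ∀ i < t, CocyclesVanish (maximalIdeal R) i (ModuleCat.of R (R ⧸ I))

lemma DepthGE.succ {I : Ideal R} {x : R} (hx : x ∈ maximalIdeal R)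
    (hreg : ∀ c, x * c ∈ I → c ∈ I) {t : ℕ} (h : DepthGE (I ⊔ Ideal.span {x}) t) :
    DepthGE I (t + 1) := by
  have := mono_smul_id hreg
  intro i hi
  cases i with
  | zero => exact cocyclesVanish_zero_of_mono hx
  | succ i =>
    exact (h i (by omega)).succ_of_shortExact hx (smul_id_comp_quotProj I x) (exact_quotProj I x)

lemma DepthGE.sup_span_singleton {I : Ideal R} {x : R} (hreg : ∀ c, x * c ∈ I → c ∈ I) {t : ℕ}
    (h : DepthGE I (t + 1)) : DepthGE (I ⊔ Ideal.span {x}) t := by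
  have := mono_smul_id hreg
  exact fun i hi ↦ (h i (by omega)).of_shortExact (smul_id_comp_quotProj I x)
    (exact_quotProj I x) (h (i + 1) (by omega))

lemma DepthGE.mem_of_forall_mul_mem {I : Ideal R} {t : ℕ} (h : DepthGE I (t + 1)) {a : R}
    (ha : ∀ r ∈ maximalIdeal R, r * a ∈ I) : a ∈ I := by
  rw [← Submodule.Quotient.mk_eq_zero]
  refine (h 0 (by omega)).eq_zero_of_smul_eq_zero fun r hr ↦ ?_
  rw [← Submodule.Quotient.mk_smul, Submodule.Quotient.mk_eq_zero]
  exact ha r hr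

lemma isCMLocal_iff_depthGE {d : ℕ} (hd : ringKrullDim R = d) :
    IsCMLocal R ↔ DepthGE (⊥ : Ideal R) d := by
  unfold IsCMLocal DepthGE Hmod
  refine forall_congr' fun i ↦ ?_
  rw [hd, Nat.cast_lt, ← subsingleton_localCohomology_iff_cocyclesVanish]
  refine imp_congr_right fun _ ↦ ?_
  have e : (localCohomology (maximalIdeal R) i).obj (ModuleCat.of R R) ≅
      (localCohomology (maximalIdeal R) i).obj (ModuleCat.of R (R ⧸ (⊥ : Ideal R))) :=
    (localCohomology (maximalIdeal R) i).mapIso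
      (Submodule.quotEquivOfEqBot (⊥ : Ideal R) rfl).symm.toModuleIso
  exact e.toLinearEquiv.toEquiv.subsingleton_congr

/-- Depth is at most the dimension of every associated prime. -/
theorem DepthGE.le_ringKrullDim [IsNoetherianRing R] {t : ℕ} {I P : Ideal R} (h : DepthGE I t)
    (hP : IsAssociatedPrime P (R ⧸ I)) : (t : WithBot ℕ∞) ≤ ringKrullDim (R ⧸ P) := by
  induction t generalizing I P with
  | zero =>
    have := hP.isPrime
    exact ringKrullDim_nonneg_of_nontrivial
  | succ t ih =>
    obtain ⟨y, hy, hreg⟩ := exists_regular_of_forall_mul_mem (M := maximalIdeal R)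
      fun a ↦ h.mem_of_forall_mul_mem
    obtain ⟨Q, hQ, hle, hyQ, hyP⟩ := exists_isAssociatedPrime_quotient_sup hP hy hreg
    push_cast
    exact (add_le_add_left (ih (h.sup_span_singleton hreg) hQ) 1).trans
      (ringKrullDim_quotient_succ_le hP.isPrime hle hyQ hyP)

end Depth

section RegularSequence

variable {R : Type u} [CommRing R]

lemma span_image_lt_succ {n : ℕ} (x : Fin n → R) {k : ℕ} (hk : k < n) :
    Ideal.span (x '' {j | j.1 < k + 1}) =
      Ideal.span (x '' {j | j.1 < k}) ⊔ Ideal.span {x ⟨k, hk⟩} := by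
  rw [← Ideal.span_union, ← Set.image_singleton, ← Set.image_union]
  congr 2
  ext j
  simp only [Set.mem_ofPred_eq, Set.mem_union, Set.mem_singleton_iff, Fin.ext_iff]
  omega

variable [IsLocalRing R]

lemma IsRegSeq.isCMLocal {d : ℕ} (hd : ringKrullDim R = d) {x : Fin d → R} (h : IsRegSeq x)
    (hx : ∀ i, x i ∈ maximalIdeal R) : IsCMLocal R := by
  have key : ∀ k ≤ d, DepthGE (Ideal.span (x '' {j | j.1 < d - k})) k := by
    intro k
    induction k with
    | zero => exact fun _ i hi ↦ absurd hi (by omega)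
    | succ k ih =>
      intro hk
      have h1 := ih (by omega)
      rw [show d - k = (d - (k + 1)) + 1 by omega, span_image_lt_succ x (by omega)] at h1
      exact h1.succ (hx _) fun c hc ↦ h ⟨d - (k + 1), by omega⟩ c hc
  rw [isCMLocal_iff_depthGE hd]
  simpa using key d le_rfl

variable [IsNoetherianRing R]

/-- Every system of parameters of a Cohen-Macaulay local ring is a regular sequence. -/
theorem IsCMLocal.isRegSeq (hCM : IsCMLocal R) {d : ℕ} (hd : ringKrullDim R = d)
    {x : Fin d → R} (hx : ∀ i, x i ∈ maximalIdeal R)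
    (hrad : maximalIdeal R ≤ (Ideal.span (Set.range x)).radical) : IsRegSeq x := by
  have hreg : ∀ k (hk : k < d), DepthGE (Ideal.span (x '' {j | j.1 < k})) (d - k) →
      ∀ c, x ⟨k, hk⟩ * c ∈ Ideal.span (x '' {j | j.1 < k}) →
        c ∈ Ideal.span (x '' {j | j.1 < k}) := by
    intro k hk hD c hc
    by_contra hcI
    obtain ⟨P, hP, hP'⟩ := exists_isAssociatedPrime_quotient hcI
    have hle := hD.le_ringKrullDim hP
    have hPprime := hP.isPrime
    have hge := ringKrullDim_quotient_le_card (I := P) (le_maximalIdeal hPprime.ne_top)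
      (fun j : {j : Fin d // k < j.1} ↦ x j) (fun j ↦ hx _) (hrad.trans (Ideal.radical_mono
        (Ideal.span_le.2 ?_)))
    · have hcard : Fintype.card {j : Fin d // k < j.1} ≤ d - (k + 1) := by
        rw [Fintype.card_subtype]
        have : (Finset.univ.filter fun j : Fin d ↦ k < j.1).image Fin.val ⊆
            Finset.Ico (k + 1) d := by
          intro j
          simp only [Finset.mem_image, Finset.mem_filter, Finset.mem_univ, true_and,
            Finset.mem_Ico]
          rintro ⟨i, hi, rfl⟩
          exact ⟨hi, i.2⟩
        rw [← Finset.card_image_of_injective _ Fin.val_injective]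
        exact (Finset.card_le_card this).trans (by simp)
      have := hle.trans (hge.trans (Nat.cast_le.2 hcard))
      have := Nat.cast_le.1 this
      omega
    · rintro _ ⟨j, rfl⟩
      rcases lt_trichotomy j.1 k with h | h | h
      · exact Ideal.mem_sup_left (hP' _ (Ideal.mul_mem_right _ _
          (Ideal.subset_span ⟨j, h, rfl⟩)))
      · refine Ideal.mem_sup_left (hP' _ ?_)
        subst h
        exact hc
      · exact Ideal.mem_sup_right (Ideal.subset_span ⟨⟨j, h⟩, rfl⟩)
  have key : ∀ k ≤ d, DepthGE (Ideal.span (x '' {j | j.1 < k})) (d - k) := by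
    intro k
    induction k with
    | zero =>
      intro _
      have := (isCMLocal_iff_depthGE hd).1 hCM
      simpa using this
    | succ k ih =>
      intro hk
      have h1 := ih (by omega)
      have h2 := hreg k hk h1
      rw [span_image_lt_succ x hk]
      rw [show d - k = d - (k + 1) + 1 by omega] at h1
      exact h1.sup_span_singleton h2
  exact fun i c hc ↦ hreg i.1 i.2 (key i.1 i.2.le) c hc

/-- Over a Cohen-Macaulay local ring there is nothing to kill in the colon quotients of systems
of parameters of quotients by part of a system of parameters. -/
theorem IsCMLocal.killsColons_one (hCM : IsCMLocal R) {a b : ℕ}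
    (hd : ringKrullDim R = (b + a : ℕ)) (w : Fin b → R) (hw : ∀ i, w i ∈ maximalIdeal R) :
    KillsColons (Ideal.span (Set.range w)) a 1 := by
  intro y hy hrad i c hc
  rw [one_mul]
  have hmem : ∀ i, Fin.append w y i ∈ maximalIdeal R := by
    intro i
    refine Fin.addCases (fun j ↦ ?_) (fun j ↦ ?_) i
    · rw [Fin.append_left]; exact hw j
    · rw [Fin.append_right]; exact hy j
  have himage : ∀ i : Fin a, Ideal.span (Set.range w) ⊔ Ideal.span (y '' {j | j < i}) =
      Ideal.span (Fin.append w y '' {j | j < Fin.natAdd b i}) := by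
    intro i
    rw [← Ideal.span_union]
    congr 1
    ext r
    constructor
    · rintro (⟨j, rfl⟩ | ⟨j, hj, rfl⟩)
      · refine ⟨Fin.castAdd a j, ?_, Fin.append_left _ _ _⟩
        change j.1 < b + i.1
        omega
      · refine ⟨Fin.natAdd b j, ?_, Fin.append_right _ _ _⟩
        change b + j.1 < b + i.1
        have : j.1 < i.1 := hj
        omega
    · rintro ⟨j, hj, rfl⟩
      induction j using Fin.addCases with
      | left j => exact Or.inl ⟨j, (Fin.append_left _ _ _).symm⟩
      | right j =>
        refine Or.inr ⟨j, ?_, (Fin.append_right _ _ _).symm⟩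
        have : b + j.1 < b + i.1 := hj
        change j.1 < i.1
        omega
  have hrange : Ideal.span (Set.range w) ⊔ Ideal.span (Set.range y) ≤
      Ideal.span (Set.range (Fin.append w y)) := by
    rw [sup_le_iff, Ideal.span_le, Ideal.span_le]
    constructor
    · rintro _ ⟨j, rfl⟩
      exact Ideal.subset_span ⟨Fin.castAdd a j, Fin.append_left _ _ _⟩
    · rintro _ ⟨j, rfl⟩
      exact Ideal.subset_span ⟨Fin.natAdd b j, Fin.append_right _ _ _⟩
  have hreg := hCM.isRegSeq hd hmem (hrad.trans (Ideal.radical_mono hrange))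
  rw [himage] at hc ⊢
  refine hreg (Fin.natAdd b i) c ?_
  rwa [Fin.append_right]

end RegularSequence

section QuasiRegular

variable {R : Type u} [CommRing R] {κ : Type} [Fintype κ] [DecidableEq κ]

/-- The layers of the filtration by powers of an ideal generated by a quasi-regular family. -/
lemma exists_layer_embedding (y : κ → R) {q : Ideal R} (hq : q = Ideal.span (Set.range y))
    (hJ : ∀ N : ℕ, 0 < N → ∀ c, c * ∏ i, y i ^ N ∈ Ideal.span (Set.range fun i ↦ y i ^ (N + 1)) →
      c ∈ q) (k : ℕ) :
    ∃ Φ : ((Exponents κ k → R) ⧸ Submodule.pi Set.univ (fun _ : Exponents κ k ↦ q)) →ₗ[R]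
      R ⧸ q ^ (k + 1), Function.Injective Φ ∧
      LinearMap.range Φ = Submodule.map (Submodule.mkQ (q ^ (k + 1))) (q ^ k : Ideal R) := by
  let Ψ : (Exponents κ k → R) →ₗ[R] R ⧸ q ^ (k + 1) := (q ^ (k + 1)).mkQ ∘ₗ evalForm y k
  have hker : LinearMap.ker Ψ = Submodule.pi Set.univ (fun _ : Exponents κ k ↦ q) := by
    ext g
    constructor
    · intro hg γ _
      obtain ⟨F, hF, hFg, hc⟩ := exists_form_eq_evalForm y k g
      have hg : evalForm y k g ∈ q ^ (k + 1) := (Submodule.Quotient.mk_eq_zero _).1 hg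
      rw [← hFg, hq] at hg
      exact hc γ ▸ coeff_mem_of_eval_mem_pow y q hJ F hF hg _
    · intro hg
      refine (Submodule.Quotient.mk_eq_zero _).2 ?_
      have := evalForm_mem y (I := q) fun γ ↦ hg γ trivial
      rwa [← hq, ← pow_succ'] at this
  refine ⟨Submodule.liftQ _ Ψ hker.ge, ?_, ?_⟩
  · rw [← LinearMap.ker_eq_bot, Submodule.ker_liftQ, hker, Submodule.mkQ_map_self]
  · rw [Submodule.range_liftQ, LinearMap.range_comp, range_evalForm, hq]

lemma length_quotient_pow_of_quasiRegular (y : κ → R) {e : ℕ} (hκ : Fintype.card κ = e + 1)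
    {q : Ideal R} (hq : q = Ideal.span (Set.range y))
    (hJ : ∀ N : ℕ, 0 < N → ∀ c, c * ∏ i, y i ^ N ∈ Ideal.span (Set.range fun i ↦ y i ^ (N + 1)) →
      c ∈ q) (n : ℕ) :
    Module.length R (R ⧸ q ^ (n + 1)) =
      ((n + (e + 1)).choose (e + 1) : ℕ) * Module.length R (R ⧸ q) := by
  induction n with
  | zero => rw [zero_add, pow_one, zero_add, Nat.choose_self, Nat.cast_one, one_mul]
  | succ n ih =>
    obtain ⟨Φ, hΦ, hr⟩ := exists_layer_embedding y hq hJ (n + 1)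
    rw [length_quotient_eq_add (Ideal.pow_le_pow_right (Nat.le_succ (n + 1))), ih, ← hr,
      ← (LinearEquiv.ofInjective Φ hΦ).length_eq, (piQuotientEquiv q).length_eq, Module.length_pi,
      ENat.card_eq_coe_fintype_card, card_exponents hκ, ← add_mul,
      show n + 1 + (e + 1) = n + 1 + e + 1 by ring, Nat.choose_succ_succ,
      show n + (e + 1) = n + 1 + e by ring]
    push_cast
    ring

end QuasiRegular

section CohenMacaulay

variable {R : Type u} [CommRing R] [IsLocalRing R]

lemma length_socle_pow_of_quasiRegular {κ : Type} [Fintype κ] [DecidableEq κ] (y : κ → R) {e : ℕ}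
    (hκ : Fintype.card κ = e + 1) {q : Ideal R} (hq : q = Ideal.span (Set.range y))
    (hJ : ∀ N : ℕ, 0 < N → ∀ c, c * ∏ i, y i ^ N ∈ Ideal.span (Set.range fun i ↦ y i ^ (N + 1)) →
      c ∈ q) {n : ℕ} (hn : ∀ x, (∀ r ∈ maximalIdeal R, r * x ∈ q ^ (n + 1)) → x ∈ q ^ n) :
    Module.length R (socle R (R ⧸ q ^ (n + 1))) =
      ((n + e).choose e : ℕ) * Module.length R (socle R (R ⧸ q)) := by
  obtain ⟨Φ, hΦ, hr⟩ := exists_layer_embedding y hq hJ n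
  have h1 := length_socle_pi_quotient q (Exponents κ n)
  rw [card_exponents hκ] at h1
  rw [← h1]
  refine le_antisymm ?_ (length_socle_le_of_injective hΦ)
  have h2 : socle R (R ⧸ q ^ (n + 1)) ≤
      (socle R ((Exponents κ n → R) ⧸ Submodule.pi Set.univ (fun _ ↦ q))).map Φ := by
    intro z hz
    have hz' : z ∈ LinearMap.range Φ := by
      obtain ⟨x, rfl⟩ := Submodule.mkQ_surjective _ z
      rw [hr]
      refine ⟨x, hn x fun r hr ↦ ?_, rfl⟩
      exact (Submodule.Quotient.mk_eq_zero _).1 (hz r hr)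
    obtain ⟨g, rfl⟩ := hz'
    exact ⟨g, mem_socle_of_injective hΦ hz, rfl⟩
  refine (length_le_of_le h2).trans (le_of_eq ?_)
  exact ((Submodule.equivMapOfInjective Φ hΦ _).length_eq).symm

variable [IsNoetherianRing R]

/-- For a Cohen-Macaulay ring of dimension at least two and a parameter ideal `q ⊆ 𝔪²`,
the ideal `q : 𝔪` satisfies `𝔪 (q : 𝔪) = 𝔪 q`. -/
lemma maximalIdeal_mul_colonIdeal_le {d : ℕ} (hd : ringKrullDim R = d) (hd2 : 2 ≤ d)
    (h1 : KillsColons (⊥ : Ideal R) d 1) {x : Fin d → R}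
    (hx : ∀ i, x i ∈ maximalIdeal R ^ 2)
    (hrad : maximalIdeal R ≤ (Ideal.span (Set.range x)).radical) :
    maximalIdeal R * colonIdeal R (Ideal.span (Set.range x)) ≤
      maximalIdeal R * Ideal.span (Set.range x) := by
  refine Ideal.mul_le.2 fun y hy a ha ↦ ?_
  by_contra hya
  have haq : ∀ s ∈ maximalIdeal R, s * a ∈ Ideal.span (Set.range x) := ha
  obtain ⟨u, hu⟩ := Ideal.mem_span_range_iff_exists_fun.1 (haq y hy)
  obtain ⟨i, hi⟩ : ∃ i, IsUnit (u i) := by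
    by_contra! hcon
    refine hya ?_
    rw [← hu]
    exact sum_mem fun j _ ↦ Ideal.mul_mem_mul ((mem_maximalIdeal _).2 (hcon j))
      (Ideal.subset_span ⟨j, rfl⟩)
  obtain ⟨v, hv⟩ := hi.exists_right_inv
  set w := Ideal.span (x '' {i}ᶜ) with hw
  have hxi : x i - v * (y * a) ∈ w := by
    rw [← hu, ← Finset.add_sum_erase _ _ (Finset.mem_univ i)]
    rw [show x i - v * (u i * x i + ∑ j ∈ Finset.univ.erase i, u j * x j) =
      x i - (u i * v) * x i - v * ∑ j ∈ Finset.univ.erase i, u j * x j by ring, hv, one_mul,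
      sub_self, zero_sub, neg_mem_iff]
    refine w.mul_mem_left _ (sum_mem fun j hj ↦ w.mul_mem_left _ (Ideal.subset_span ⟨j, ?_, rfl⟩))
    exact Finset.ne_of_mem_erase hj
  have hq : Ideal.span (Set.range x) ≤ Ideal.span {y * a} ⊔ w := by
    rw [Ideal.span_le]
    rintro _ ⟨j, rfl⟩
    by_cases hj : j = i
    · subst hj
      rw [show x j = v * (y * a) + (x j - v * (y * a)) by ring]
      exact Submodule.add_mem_sup (Ideal.mem_span_singleton'.2 ⟨v, rfl⟩) hxi
    · exact Ideal.mem_sup_right (Ideal.subset_span ⟨j, hj, rfl⟩)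
  have hwm : w ≤ maximalIdeal R • maximalIdeal R := by
    rw [hw, Ideal.span_le, smul_eq_mul, ← pow_two]
    rintro _ ⟨j, -, rfl⟩
    exact hx j
  have hm : maximalIdeal R ≤ Ideal.span {y} ⊔ maximalIdeal R • maximalIdeal R := by
    intro s hs
    obtain ⟨c', hc', w', hw', hcw⟩ := Submodule.mem_sup.1 (hq (haq s hs))
    obtain ⟨c, rfl⟩ := Ideal.mem_span_singleton'.1 hc'
    rw [show s = c * y + (s - c * y) by ring]
    refine Submodule.add_mem_sup (Ideal.mem_span_singleton'.2 ⟨c, rfl⟩) (hwm ?_)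
    have := h1.of_fintype (Fintype.card_fin _) x
      (fun j ↦ Ideal.pow_le_self two_ne_zero (hx j)) (by rwa [bot_sup_eq])
      (A := {i}ᶜ) (a := i) (by simp) (c := s - c * y) (by
        rw [bot_sup_eq, show x i * (s - c * y) = (x i - v * (y * a)) * (s - c * y) + v * y * w' by
          linear_combination (-v * y) * hcw]
        exact w.add_mem (w.mul_mem_right _ hxi) (w.mul_mem_left _ hw'))
    rwa [bot_sup_eq, one_mul] at this
  have hy1 : maximalIdeal R ≤ Ideal.span {y} :=
    Submodule.le_of_le_smul_of_le_jacobson_bot (IsNoetherian.noetherian _)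
      (IsLocalRing.maximalIdeal_le_jacobson _) hm
  have := card_le_of_le_radical_span hd (fun _ : Fin 1 ↦ y) (fun _ ↦ hy)
    (by rw [Set.range_const]; exact hy1.trans Ideal.le_radical)
  rw [Fintype.card_fin] at this
  omega

lemma IsCMLocal.isCSOP (hCM : IsCMLocal R) {d : ℕ} (hd : ringKrullDim R = d) {x : Fin d → R}
    (hx : ∀ i, x i ∈ maximalIdeal R)
    (hrad : maximalIdeal R ≤ (Ideal.span (Set.range x)).radical) : IsCSOP R R x := by
  refine ⟨(isSOP_iff x).2 ⟨hd, hx, hrad⟩, fun i ↦ ?_⟩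
  have hlt := i.2
  let w : Fin (d - 1 - i) → R := fun k ↦ x ⟨i + 1 + k, by omega⟩
  let y : Fin (i + 1) → R := fun k ↦ x ⟨k, by omega⟩
  have himg : x '' {j | i < j} = Set.range w := by
    ext r
    constructor
    · rintro ⟨j, hj, rfl⟩
      have hj : i.1 < j.1 := hj
      exact ⟨⟨j - (i + 1), by omega⟩, congrArg x (Fin.ext (by change i + 1 + (j - (i + 1)) = j.1; omega))⟩
    · rintro ⟨k, rfl⟩
      exact ⟨_, by change i.1 < i + 1 + k; omega, rfl⟩
  have hle : Ideal.span (Set.range x) ≤ Ideal.span (Set.range w) ⊔ Ideal.span (Set.range y) := by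
    rw [Ideal.span_le]
    rintro _ ⟨j, rfl⟩
    by_cases hj : i < j
    · exact Ideal.mem_sup_left (himg ▸ Ideal.subset_span ⟨j, hj, rfl⟩)
    · exact Ideal.mem_sup_right (Ideal.subset_span ⟨⟨j, by omega⟩, rfl⟩)
  have hdim := ringKrullDim_quotient_eq_of_isSOP (a := i + 1) (b := d - 1 - i)
    (by rw [hd]; congr; omega) (Fintype.card_fin _) (Fintype.card_fin _) y w (fun _ ↦ hx _)
    (fun _ ↦ hx _) (hrad.trans (Ideal.radical_mono hle))
  have h1 := hCM.killsColons_one (a := i + 1) (b := d - 1 - i)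
    (by rw [hd]; congr; omega) w (fun _ ↦ hx _)
  rw [himg]
  have htop : bIdeal R (R ⧸ (Ideal.span (Set.range w) • (⊤ : Submodule R R))) = ⊤ :=
    (Ideal.eq_top_iff_one _).2 ((mem_bIdeal_quotient_iff _ hdim 1).2 h1)
  rw [htop, Ideal.top_pow]
  exact Submodule.mem_top

lemma exists_isSOP_mem_pow_two {d : ℕ} (hd : ringKrullDim R = d) :
    ∃ x : Fin d → R, (∀ i, x i ∈ maximalIdeal R ^ 2) ∧
      maximalIdeal R ≤ (Ideal.span (Set.range x)).radical := by
  have hht : (maximalIdeal R).height = d := by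
    have := IsLocalRing.maximalIdeal_height_eq_ringKrullDim (R := R)
    rw [hd] at this
    exact_mod_cast this
  obtain ⟨s, hs, hcard⟩ := (maximalIdeal R).exists_finset_card_eq_height_of_isNoetherianRing
  rw [hht] at hcard
  have hcard : s.card = d := by exact_mod_cast hcard
  let f : Fin d → R := fun i ↦ ((s.equivFinOfCardEq hcard).symm i : R)
  have hf : Set.range f = s := by
    ext r
    constructor
    · rintro ⟨i, rfl⟩; exact Subtype.prop _
    · intro hr; exact ⟨s.equivFinOfCardEq hcard ⟨r, hr⟩, by simp [f]⟩
  refine ⟨fun i ↦ f i ^ 2, fun i ↦ ?_, ?_⟩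
  · exact Ideal.pow_mem_pow (hs.1.2 (Ideal.subset_span (hf ▸ Set.mem_range_self i))) 2
  · refine maximalIdeal_le_radical_of_pow (y := f) ?_ fun i ↦ ⟨2, rfl⟩
    rw [hf, Ideal.radical_eq_sInf]
    refine le_sInf fun P hP ↦ ?_
    have := hP.2
    exact hs.2 ⟨hP.2, hP.1⟩ (le_maximalIdeal hP.2.ne_top)

end CohenMacaulay

section CohenMacaulayCoefficients

variable {R : Type u} [CommRing R] [IsLocalRing R] [IsNoetherianRing R]

/-- In a Cohen-Macaulay local ring of dimension at least two, there is a C-parameter ideal whose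
Hilbert coefficients and irreducible multiplicity can be computed explicitly. -/
theorem IsCMLocal.exists_coeff (hCM : IsCMLocal R) {e : ℕ}
    (hd : ringKrullDim R = (e + 2 : ℕ)) {r : ℕ} (hr : IsStableValue R r) :
    ∃ q : Ideal R, IsCParamIdeal R q ∧
      (∃ a a' : ℕ → ℤ, IsHilbCoeff R (colonIdeal R q) (e + 2) a ∧ IsHilbCoeff R q (e + 2) a' ∧
        (r : ℤ) ≤ a 1 - a' 1) ∧
      ∃ f : ℕ → ℤ, IsIrrCoeff R q (e + 2) f ∧ (r : ℤ) ≤ f 0 := by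
  obtain ⟨x, hx2, hrad⟩ := exists_isSOP_mem_pow_two hd
  have hx : ∀ i, x i ∈ maximalIdeal R := fun i ↦ Ideal.pow_le_self two_ne_zero (hx2 i)
  obtain ⟨q, hq⟩ : ∃ q, q = Ideal.span (Set.range x) := ⟨_, rfl⟩
  have hqC : IsCParamIdeal R q := ⟨_, x, hCM.isCSOP hd hx hrad, hq⟩
  have hqm : q ≤ maximalIdeal R := by
    rw [hq, Ideal.span_le]; rintro _ ⟨i, rfl⟩; exact hx i
  have h1 : KillsColons (⊥ : Ideal R) (e + 2) 1 := by
    have := hCM.killsColons_one (a := e + 2) (b := 0) (by rw [hd, zero_add]) Fin.elim0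
      fun i ↦ i.elim0
    rwa [Set.range_eq_empty, Ideal.span_empty] at this
  have hJ : ∀ N : ℕ, 0 < N → ∀ c,
      c * ∏ i, x i ^ N ∈ Ideal.span (Set.range fun i ↦ x i ^ (N + 1)) → c ∈ q := by
    intro N hN c hc
    have := h1.pow_mul_mem_of_mul_prod_mem (Fintype.card_fin _) x hx hrad Finset.univ hN (c := c)
      (by rwa [Finset.coe_univ, Set.image_univ])
    rwa [one_pow, one_mul, Finset.coe_univ, Set.image_univ, ← hq] at this
  have hreg : ∀ c, x 0 * c = 0 → c = 0 := by
    intro c hc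
    have := hCM.isRegSeq hd hx hrad 0 c (hc ▸ zero_mem _)
    simpa using this
  obtain ⟨N, hN⟩ := exists_forall_modColon_pow_le
    (hq ▸ Ideal.subset_span (Set.mem_range_self 0) : x 0 ∈ q) hreg
  have hNm : ∀ n ≥ N, ∀ x, (∀ r ∈ maximalIdeal R, r * x ∈ q ^ (n + 1)) → x ∈ q ^ n :=
    fun n hn x hx ↦ hN n hn x fun r hr ↦ hx r (hqm hr)
  have hsoc : Module.length R (socle R (R ⧸ q)) = r := by
    have := hr q hqC
    rw [irMod_eq] at this
    exact_mod_cast this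
  have hsocn : ∀ n ≥ N, Module.length R (socle R (R ⧸ q ^ (n + 1))) =
      ((n + (e + 1)).choose (e + 1) * r : ℕ) := by
    intro n hn
    rw [length_socle_pow_of_quasiRegular x (Fintype.card_fin _) hq hJ (hNm n hn), hsoc]
    push_cast; rfl
  obtain ⟨l, hl⟩ : ∃ l : ℕ, Module.length R (R ⧸ q) = l := by
    have := (isFiniteLength_quotient_iff q).2 (hq ▸ hrad)
    exact (ENat.ne_top_iff_exists.1 (Module.length_ne_top_iff.2 this)).imp fun _ h ↦ h.symm
  have hlen : ∀ n, Module.length R (R ⧸ q ^ (n + 1)) = ((n + (e + 2)).choose (e + 2) * l : ℕ) := by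
    intro n
    rw [length_quotient_pow_of_quasiRegular x (Fintype.card_fin _) hq hJ n, hl]
    push_cast; rfl
  refine ⟨q, hqC, ⟨fun i ↦ if i = 0 then l else if i = 1 then r else 0,
    fun i ↦ if i = 0 then l else 0, ⟨N, fun n hn ↦ ?_⟩, ⟨0, fun n _ ↦ ?_⟩, by simp⟩,
    fun i ↦ if i = 0 then r else 0, ⟨N, fun n hn ↦ ?_⟩, by simp⟩
  · set I := colonIdeal R q with hI
    have hqI : q ≤ I := le_colonIdeal q
    have hmI : maximalIdeal R * I ≤ maximalIdeal R * q := by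
      rw [hI, hq]; exact maximalIdeal_mul_colonIdeal_le hd (by omega) h1 hx2 hrad
    have hmap : Submodule.map (Submodule.mkQ (q ^ (n + 1))) (I ^ (n + 1) : Ideal R) =
        socle R (R ⧸ q ^ (n + 1)) := by
      apply le_antisymm
      · rintro _ ⟨c, hc, rfl⟩ s hs
        refine (Submodule.Quotient.mk_eq_zero _).2 ?_
        exact Ideal.mul_le_right (le_of_mul_le_mul_pow hmI (n + 1) (Ideal.mul_mem_mul hs hc))
      · intro z hz
        obtain ⟨c, rfl⟩ := Submodule.mkQ_surjective _ z
        have hc : ∀ s ∈ maximalIdeal R, s * c ∈ q ^ (n + 1) := fun s hs ↦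
          (Submodule.Quotient.mk_eq_zero _).1 (hz s hs)
        refine ⟨c, ?_, rfl⟩
        have hcn := hNm n hn c hc
        rw [hq, ← range_evalForm] at hcn
        obtain ⟨g, rfl⟩ := hcn
        have hg : ∀ γ, g γ ∈ I := by
          intro γ s hs
          obtain ⟨F, hF, hFg, hcoeff⟩ := exists_form_eq_evalForm x n (s • g)
          have h2 := hc s hs
          rw [← smul_eq_mul, ← map_smul, ← hFg, hq] at h2
          have h3 := coeff_mem_of_eval_mem_pow x q hJ F hF h2 γ.1
          rw [hcoeff] at h3
          exact h3
        have := evalForm_mem x hg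
        rw [← hq] at this
        rw [pow_succ']
        exact Ideal.mul_mono_right (Ideal.pow_right_mono hqI n) this
    have hadd := length_quotient_eq_add (Ideal.pow_right_mono hqI (n + 1))
    rw [hmap, hsocn n hn, hlen] at hadd
    obtain ⟨L, hL⟩ : ∃ L : ℕ, Module.length R (R ⧸ I ^ (n + 1)) = L := by
      refine (ENat.ne_top_iff_exists.1 fun h ↦ ?_).imp fun _ h ↦ h.symm
      rw [h, add_top] at hadd
      exact ENat.natCast_ne_top _ hadd
    refine ⟨L, by rw [moduleLength_quotient_smul_top, hL]; rfl, ?_⟩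
    rw [hL] at hadd
    have hadd : (n + (e + 2)).choose (e + 2) * l = (n + (e + 1)).choose (e + 1) * r + L := by
      exact_mod_cast hadd
    rw [Finset.sum_range_succ', Finset.sum_range_succ', Finset.sum_eq_zero (by simp)]
    have hadd : ((n + (e + 2)).choose (e + 2) * l : ℤ) =
      (n + (e + 1)).choose (e + 1) * r + L := by exact_mod_cast hadd
    simp only [zero_add, show n + (e + 2) - 1 = n + (e + 1) by omega,
      show e + 2 - 1 = e + 1 by omega, tsub_zero]
    simp
    linarith
  · refine ⟨_, by rw [moduleLength_quotient_smul_top, hlen]; rfl, ?_⟩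
    rw [Finset.sum_range_succ', Finset.sum_eq_zero (by simp)]
    simp
    ring
  · refine ⟨_, by rw [irMod_eq, hsocn n hn]; rfl, ?_⟩
    rw [Finset.sum_range_succ', Finset.sum_eq_zero (by simp)]
    simp only [show n + (e + 2) - 1 - 0 = n + (e + 1) by omega,
      show e + 2 - 1 - 0 = e + 1 by omega]
    simp
    ring

end CohenMacaulayCoefficients

/-- For `R` unmixed of dimension `d ≥ 2`, TFAE: (1) `R` is Cohen-Macaulay;
(2) `𝒩(R) ≤ e_1(q :_R m, R) - e_1(q, R)` for some C-parameter ideal `q` of `R`;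
(3) `𝒩(R) ≤ f_0(q, R)` for some C-parameter ideal `q` of `R`. -/
theorem statement_3 {R : Type u} [CommRing R] [IsLocalRing R] [IsNoetherianRing R]
    (hres : IsHomImageOfCM R)
    (d : ℕ) (hd : 2 ≤ d) (hdim : ringKrullDim R = (d : WithBot ℕ∞))
    (hum : IsUnmixedRing R)
    (NR : ℕ) (hNR : IsStableValue R NR) :
    (IsCMLocal R ↔ ∃ q : Ideal R, IsCParamIdeal R q ∧ ∃ e e' : ℕ → ℤ,
        IsHilbCoeff R (colonIdeal R q) d e ∧ IsHilbCoeff R q d e' ∧ (NR : ℤ) ≤ e 1 - e' 1) ∧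
    (IsCMLocal R ↔ ∃ q : Ideal R, IsCParamIdeal R q ∧ ∃ f : ℕ → ℤ,
        IsIrrCoeff R q d f ∧ (NR : ℤ) ≤ f 0) := by
  obtain ⟨e, rfl⟩ := Nat.exists_eq_add_of_le' hd
  refine ⟨⟨fun hCM ↦ ?_, ?_⟩, ⟨fun hCM ↦ ?_, ?_⟩⟩
  · obtain ⟨q, hq, ⟨a, a', h⟩, -⟩ := hCM.exists_coeff hdim hNR
    exact ⟨q, hq, a, a', h⟩
  · rintro ⟨q, hq, a, a', ha, ha', hle⟩
    have hr := hNR q hq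
    obtain ⟨x, rfl, hx, hrad, ht, hs⟩ := hq.exists_fin hdim
    exact (isRegSeq_of_le_hilbCoeff hdim hx hrad ht hs
      (fun _ hc ↦ eq_zero_of_isUnmixedRing_of_mul_eq_zero hum hdim hx hrad hc) hr ha ha'
      hle).isCMLocal hdim hx
  · obtain ⟨q, hq, -, f, h⟩ := hCM.exists_coeff hdim hNR
    exact ⟨q, hq, f, h⟩
  · rintro ⟨q, hq, f, hf, hle⟩
    have hr := hNR q hq
    obtain ⟨x, rfl, hx, hrad, ht, -⟩ := hq.exists_fin hdim
    exact (isRegSeq_of_le_irrCoeff hx hrad ht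
      (fun _ hc ↦ eq_zero_of_isUnmixedRing_of_mul_eq_zero hum hdim hx hrad hc) hr hf
      hle).isCMLocal hdim hx
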